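/- arXiv:2104.02440 — 7 statements merged into one kernel-verified Lean document; each statement's English description precedes it below -/
import Mathlib

section
/- For any integer n greater than 3, the diagonal quadratic form X_n = ⟨n, n+1, n+2, ..., 2n⟩ (with n+1 variables) is tight T(n)-universal; that is, the set of nonzero integers represented by n·x_0² + (n+1)·x_1² + ... + 2n·x_n² is exactly the set of integers ≥ n. -/
theorem small_aux {a G : ℤ} (ha : 0 < a) (hG : 0 < G) (e1 : 3*G^2 ≤ 4*a) (e2 : 3*a^2 ≤ 4*G) :
    G = 1 ∧ a = 1 := by
  have h1 : G ≤ 1 := by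
    rcases le_total a G with h | h
    · nlinarith
    · have : a ≤ 1 := by nlinarith
      omega
  have h2 : G = 1 := by omega
  subst h2
  exact ⟨rfl, by nlinarith⟩

/-- ternary reduction -/
theorem tern_red : ∀ (A B : ℕ) (a b c d e f : ℤ), a = A → a * b - f^2 = B → 0 < a → 0 < a*b - f^2 →
    a*b*c + 2*d*e*f - a*d^2 - b*e^2 - c*f^2 = 1 →
    ∀ x y z : ℤ, ∃ p q r : ℤ,
      a*x^2+b*y^2+c*z^2+2*d*y*z+2*e*x*z+2*f*x*y = p^2+q^2+r^2 := by
  intro A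
  induction A using Nat.strong_induction_on with
  | _ A ihA =>
  intro B
  induction B using Nat.strong_induction_on with
  | _ B ihB =>
  intro a b c d e f hA hB ha hb hdet x y z
  -- shift by k : f
  have shift : ∀ u v : ℤ, 0 < v → ∃ k : ℤ, |2 * (u + k * v)| ≤ v := by
    intro u v hv
    refine ⟨-((2*u+v)/(2*v)), ?_⟩
    have h1 := Int.emod_add_mul_ediv (2*u+v) (2*v)
    have h2 := Int.emod_nonneg (2*u+v) (b := 2*v) (by omega)
    have h3 := Int.emod_lt_of_pos (2*u+v) (b := 2*v) (by omega)
    rw [abs_le]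
    constructor <;> nlinarith
  -- binary form
  obtain ⟨k, hk⟩ := shift (a*d - e*f) (a*b-f^2) hb
  -- new z-basis vector: e_z + k e_y
  obtain ⟨c', hc'⟩ : ∃ c', c' = c + 2*k*d + k^2*b := ⟨_, rfl⟩
  obtain ⟨d', hd'⟩ : ∃ d', d' = d + k*b := ⟨_, rfl⟩
  obtain ⟨e', he'⟩ : ∃ e', e' = e + k*f := ⟨_, rfl⟩
  have hdet' : a*b*c' + 2*d'*e'*f - a*d'^2 - b*e'^2 - c'*f^2 = 1 := by
    rw [← hdet, hc', hd', he']; ring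
  have hH : a*d' - e'*f = (a*d - e*f) + k*(a*b-f^2) := by rw [hd', he']; ring
  rw [← hH] at hk
  have hval : ∀ Y, a*x^2+b*y^2+c*z^2+2*d*y*z+2*e*x*z+2*f*x*y = Y ↔
      a*x^2+b*(y-k*z)^2+c'*z^2+2*d'*(y-k*z)*z+2*e'*x*z+2*f*x*(y-k*z) = Y := by
    intro Y
    rw [hc', hd', he']
    constructor <;> intro h <;> rw [← h] <;> ring
  simp only [hval]
  generalize y - k*z = y'
  have hBC : (a*b-f^2)*(a*c'-e'^2) - (a*d'-e'*f)^2 = a := by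
    linear_combination a * hdet'
  by_cases hC : a*c'-e'^2 < a*b-f^2
  · have hCpos : 0 < a*c'-e'^2 := by
      by_contra hcon
      push Not at hcon
      nlinarith [sq_nonneg (a*d'-e'*f)]
    obtain ⟨p, q, r, h⟩ := ihB (a*c'-e'^2).toNat (by omega) a c' b d' f e' hA (by omega) ha hCpos
      (by linear_combination hdet') x z y'
    exact ⟨p, q, r, by linear_combination h⟩
  push Not at hC
  obtain ⟨l, hl⟩ := shift f a ha
  obtain ⟨b', hb'⟩ : ∃ b', b' = b + 2*l*f + l^2*a := ⟨_, rfl⟩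
  obtain ⟨d'', hd''⟩ : ∃ d'', d'' = d' + l*e' := ⟨_, rfl⟩
  obtain ⟨f', hf'⟩ : ∃ f', f' = f + l*a := ⟨_, rfl⟩
  rw [← hf'] at hl
  have hBe : a*b'-f'^2 = a*b-f^2 := by rw [hb', hf']; ring
  have hdet'' : a*b'*c' + 2*d''*e'*f' - a*d''^2 - b'*e'^2 - c'*f'^2 = 1 := by
    rw [← hdet', hb', hd'', hf']; ring
  have hb'pos : 0 < b' := by
    by_contra hcon
    push Not at hcon
    nlinarith [sq_nonneg f']
  by_cases hba : b' < a
  · obtain ⟨p, q, r, h⟩ := ihA b'.toNat (by omega) (a*b'-f'^2).toNat b' a c' e' d'' f' (by omega)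
      (by rw [mul_comm b' a]; omega) hb'pos (by rw [mul_comm b' a]; omega)
      (by linear_combination hdet'') y' (x - l*y') z
    refine ⟨p, q, r, ?_⟩
    rw [← h, hb', hd'', hf']; ring
  push Not at hba
  obtain ⟨G, hG⟩ : ∃ G, G = a*b-f^2 := ⟨_, rfl⟩
  obtain ⟨C, hCC⟩ : ∃ C, C = a*c'-e'^2 := ⟨_, rfl⟩
  obtain ⟨H, hHH⟩ : ∃ H, H = a*d'-e'*f := ⟨_, rfl⟩
  rw [← hG, ← hCC] at hC
  rw [← hG, ← hHH] at hk
  rw [← hG] at hBe hb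
  rw [← hG, ← hCC, ← hHH] at hBC
  have hk2 : 4*H^2 ≤ G^2 := by
    have := sq_le_sq' (abs_le.mp hk).1 (abs_le.mp hk).2
    linarith
  have hl2 : 4*f'^2 ≤ a^2 := by
    have := sq_le_sq' (abs_le.mp hl).1 (abs_le.mp hl).2
    linarith
  have e1 : 3*G^2 ≤ 4*a := by linarith [mul_le_mul_of_nonneg_left hC hb.le, sq G]
  have e2 : 3*a^2 ≤ 4*G := by linarith [mul_le_mul_of_nonneg_left hba ha.le, sq a]
  obtain ⟨hG1, ha1⟩ := small_aux ha hb e1 e2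
  have hH0 : H = 0 := by
    rw [hG1] at hk2
    have h0 := sq_nonneg H
    have h1 : H^2 = 0 := by omega
    exact pow_eq_zero_iff (two_ne_zero) |>.mp h1
  have hC1 : C = 1 := by
    rw [hG1, hH0, ha1] at hBC; linarith
  refine ⟨x + f*y' + e'*z, y', z, ?_⟩
  rw [ha1] at hG hCC hHH ⊢
  rw [hG1] at hG
  rw [hC1] at hCC
  rw [hH0] at hHH
  linear_combination -y'^2*hG - z^2 * hCC - 2*y'*z*hHH

theorem three_sq_of {n d P : ℤ} (hd : 0 < d) (hP : 0 < P) (h : P = d*n-1) (hx : ∃ x, P ∣ x^2 + d) :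
    ∃ p q r : ℤ, n = p^2+q^2+r^2 := by
  obtain ⟨x, k, hk⟩ := hx
  have hkpos : 0 < k := by
    by_contra hcon
    push Not at hcon
    nlinarith [sq_nonneg x]
  obtain ⟨p, q, r, hh⟩ := tern_red k.toNat d.toNat k P n 0 1 x (by omega)
    (by rw [mul_comm, ← hk]; ring_nf; omega) hkpos (by rw [mul_comm, ← hk]; linarith)
    (by linear_combination (-n)*hk - h) 0 0 1
  exact ⟨p, q, r, by linarith⟩

open NumberTheorySymbols in
theorem qr_of_jacobi {p : ℕ} (hp : p.Prime) {d : ℤ} (h : J(-d | p) = 1) :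
    ∃ x : ℤ, (p : ℤ) ∣ x^2 + d := by
  haveI := Fact.mk hp
  obtain ⟨y, hy⟩ := ZMod.isSquare_of_jacobiSym_eq_one h
  obtain ⟨x, rfl⟩ := ZMod.intCast_surjective y
  refine ⟨x, ?_⟩
  rw [← ZMod.intCast_zmod_eq_zero_iff_dvd] 
  push_cast at hy ⊢
  linear_combination -hy

open NumberTheorySymbols in
theorem three_sq_two_mod_four (n : ℕ) (hn : n % 4 = 2) :
    ∃ p q r : ℤ, (n : ℤ) = p^2+q^2+r^2 := by
  have hcop : (n-1).Coprime (4*n) := by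
    apply Nat.Coprime.mul_right
    · rw [show 4 = 2^2 by norm_num]
      apply Nat.Coprime.pow_right
      rw [Nat.coprime_two_right]
      exact Nat.odd_iff.mpr (by omega)
    · exact (Nat.coprime_self_sub_left (by omega : 1 ≤ n)).mpr (by simp)
  obtain ⟨p, hgt, hp, hmod⟩ := Nat.forall_exists_prime_gt_and_modEq (4*n) (by omega) hcop
  obtain ⟨j, hj⟩ := (Nat.modEq_iff_dvd' (by omega)).mp hmod.symm
  have hpj : p + 1 = (4*j+1)*n := by
    have : p = 4*n*j + (n-1) := by omega
    rw [this, add_assoc, Nat.sub_add_cancel (by omega)]; ring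
  have hp4 : p % 4 = 1 := by
    have : p = 4*(n*j) + (n-1) := by rw [← mul_assoc]; omega
    omega
  have hJ : J(-((4*j+1 : ℕ):ℤ) | p) = 1 := by
    rw [jacobiSym.neg _ (Nat.odd_iff.mpr (by omega)), ZMod.χ₄_nat_one_mod_four hp4, one_mul,
      jacobiSym.quadratic_reciprocity_one_mod_four' (Nat.odd_iff.mpr (by omega)) hp4]
    have : J((p:ℤ) | 4*j+1) = J(-1 | 4*j+1) := by
      apply jacobiSym.mod_left'
      apply Int.ModEq.symm
      rw [Int.modEq_iff_dvd]
      refine ⟨n, ?_⟩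
      have : (p:ℤ) + 1 = (4*j+1)*n := by exact_mod_cast hpj
      push_cast
      linarith
    rw [this, jacobiSym.at_neg_one (Nat.odd_iff.mpr (by omega)), ZMod.χ₄_nat_one_mod_four (by omega)]
  have hpz : (p:ℤ) + 1 = ((4*j+1 : ℕ):ℤ)*n := by exact_mod_cast hpj
  exact three_sq_of (d := ((4*j+1 : ℕ):ℤ)) (P := p) (by positivity) (by exact_mod_cast hp.pos) (by linarith) (qr_of_jacobi hp hJ)

open NumberTheorySymbols in
theorem three_sq_odd_aux (n c : ℕ) (hc : c = 1 ∧ n % 8 = 3 ∨ c = 3 ∧ n % 4 = 1) :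
    ∃ p q r : ℤ, (n : ℤ) = p^2+q^2+r^2 := by
  obtain ⟨t, ht⟩ : ∃ t, c*n = 2*t+1 := ⟨(c*n-1)/2, by rcases hc with ⟨rfl, h⟩ | ⟨rfl, h⟩ <;> omega⟩
  have hcop : t.Coprime (4*n) := by
    apply Nat.Coprime.mul_right
    · rw [show 4 = 2^2 by norm_num]
      apply Nat.Coprime.pow_right
      rw [Nat.coprime_two_right]
      exact Nat.odd_iff.mpr (by rcases hc with ⟨rfl, h⟩ | ⟨rfl, h⟩ <;> omega)
    · rw [← Nat.isCoprime_iff_coprime]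
      refine ⟨-2, c, ?_⟩
      have : (c:ℤ)*n = 2*t+1 := by exact_mod_cast ht
      linarith
  obtain ⟨p, hgt, hp, hmod⟩ := Nat.forall_exists_prime_gt_and_modEq (4*n+t) (by rcases hc with ⟨rfl, h⟩ | ⟨rfl, h⟩ <;> omega) hcop
  obtain ⟨j, hj⟩ := (Nat.modEq_iff_dvd' (by omega)).mp hmod.symm
  have hpt : p = 4*(n*j) + t := by rw [← mul_assoc]; omega
  have hpj : 2*p + 1 = (8*j+c)*n := by
    rw [hpt, add_mul, ht]; ring
  obtain ⟨d, hd⟩ : ∃ d, d = 8*j+c := ⟨_, rfl⟩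
  rw [← hd] at hpj
  have hpz : 2*(p:ℤ) + 1 = (d:ℤ)*n := by exact_mod_cast hpj
  have hdodd : Odd d := Nat.odd_iff.mpr (by omega)
  have hpodd : Odd p := Nat.odd_iff.mpr (by rcases hc with ⟨rfl, h⟩ | ⟨rfl, h⟩ <;> omega)
  have hpd : J((p:ℤ) | d) = 1 := by
    have h1 : J(-2 | d) = 1 := by
      rw [jacobiSym.at_neg_two hdodd]
      rw [ZMod.χ₈'_nat_eq_if_mod_eight]
      have : d % 8 = 1 ∨ d % 8 = 3 := by omega
      have : d % 2 ≠ 0 := by omega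
      simp_all
    have h2 : J(-2 * (p:ℤ) | d) = J(1 | d) := by
      apply jacobiSym.mod_left'
      apply Int.ModEq.symm
      rw [Int.modEq_iff_dvd]
      exact ⟨-n, by linarith⟩
    rw [jacobiSym.mul_left, h1, one_mul, jacobiSym.one_left] at h2
    exact h2
  have hJ : J(-(d:ℤ) | p) = 1 := by
    rw [jacobiSym.neg _ hpodd]
    by_cases hp4 : p % 4 = 1
    · rw [ZMod.χ₄_nat_one_mod_four hp4, one_mul,
        jacobiSym.quadratic_reciprocity_one_mod_four' hdodd hp4, hpd]
    · have hp4' : p % 4 = 3 := by rw [Nat.odd_iff] at hpodd; omega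
      rw [ZMod.χ₄_nat_three_mod_four hp4',
        jacobiSym.quadratic_reciprocity_three_mod_four (by rcases hc with ⟨rfl, h⟩ | ⟨rfl, h⟩ <;> omega) hp4', hpd]
      norm_num
  obtain ⟨x, hx⟩ := qr_of_jacobi hp hJ
  have hpo : Odd (p:ℤ) := by exact_mod_cast hpodd
  have hdo : Odd (d:ℤ) := by exact_mod_cast hdodd
  refine three_sq_of (d := (d:ℤ)) (P := 2*p) (by have := hdodd.pos; exact_mod_cast this) (by have := hp.pos; positivity) (by linarith) ?_
  have key : ∀ y : ℤ, Odd y → (p:ℤ) ∣ y^2+d → 2*(p:ℤ) ∣ y^2+d := by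
    intro y hy h
    apply IsCoprime.mul_dvd _ _ h
    · rw [Int.isCoprime_iff_gcd_eq_one]
      exact (Nat.coprime_two_left).mpr hpodd
    · exact ((hy.pow).add_odd hdo).two_dvd
  rcases Int.even_or_odd x with h | h
  · refine ⟨x+p, key _ (h.add_odd hpo) ?_⟩
    have : (x+p)^2+d = (x^2+d) + p*(2*x+p) := by ring
    rw [this]
    exact dvd_add hx (dvd_mul_right _ _)
  · exact ⟨x, key x h hx⟩

theorem three_sq (n : ℤ) (h0 : 0 ≤ n) (h4 : n % 4 ≠ 0) (h8 : n % 8 ≠ 7) :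
    ∃ p q r : ℤ, n = p^2+q^2+r^2 := by
  lift n to ℕ using h0
  have : n % 4 = 2 ∨ n % 8 = 3 ∨ n % 4 = 1 := by omega
  rcases this with h | h | h
  · exact three_sq_two_mod_four n h
  · exact three_sq_odd_aux n 1 (Or.inl ⟨rfl, h⟩)
  · exact three_sq_odd_aux n 3 (Or.inr ⟨rfl, h⟩)

theorem parity_perm (n p q r : ℤ) (h : n = p^2+q^2+r^2) : 
    ∃ p q r : ℤ, n = p^2+q^2+r^2 ∧ p % 2 = q % 2 := by
  by_cases h1 : p % 2 = q % 2
  · exact ⟨p, q, r, h, h1⟩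
  by_cases h2 : p % 2 = r % 2
  · exact ⟨p, r, q, by linarith, h2⟩
  · exact ⟨q, r, p, by linarith, by omega⟩

/-- sign normalization -/
theorem sgn3 (p : ℤ) : ∃ p', p'^2 = p^2 ∧ p' % 2 = p % 2 ∧ (p' % 3 = 0 ∨ p' % 3 = 1) := by
  by_cases h : p % 3 = 2
  · exact ⟨-p, by ring, by omega, by omega⟩
  · exact ⟨p, rfl, rfl, by omega⟩

theorem sq3 (p : ℤ) (h : p % 3 = 0 ∨ p % 3 = 1) : p^2 % 3 = p % 3 := by
  rcases h with h | h <;> simp [pow_two, Int.mul_emod, h]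

theorem rep126 (K : ℤ) (h : ∃ p q r : ℤ, 3*K = p^2+q^2+r^2) :
    ∃ x y w : ℤ, K = x^2+2*y^2+6*w^2 := by
  obtain ⟨p, q, r, h⟩ := h
  obtain ⟨p, q, r, h, hpq⟩ := parity_perm _ _ _ _ h
  obtain ⟨p', hp1, hp2, hp3⟩ := sgn3 p
  obtain ⟨q', hq1, hq2, hq3⟩ := sgn3 q
  obtain ⟨r', hr1, hr2, hr3⟩ := sgn3 r
  have ep := sq3 _ hp3
  have eq := sq3 _ hq3
  have er := sq3 _ hr3
  rw [← hp1, ← hq1, ← hr1] at h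
  have hall : p' % 3 = q' % 3 ∧ q' % 3 = r' % 3 := by omega
  obtain ⟨x, hx⟩ : ∃ x, p'+q'+r' = 3*x := ⟨(p'+q'+r')/3, by omega⟩
  obtain ⟨w, hw⟩ : ∃ w, p'-q' = 6*w := ⟨(p'-q')/6, by omega⟩
  obtain ⟨y, hy⟩ : ∃ y, p'+q'-2*r' = 6*y := ⟨(p'+q'-2*r')/6, by omega⟩
  refine ⟨x, y, w, ?_⟩
  have e1 : p' = x + y + 3*w := by omega
  have e2 : q' = x + y - 3*w := by omega
  have e3 : r' = x - 2*y := by omega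
  rw [e1, e2, e3] at h
  linarith

theorem rep123 (N : ℤ) (h0 : 0 ≤ N) (h : N % 2 = 1) : ∃ x y z : ℤ, N = x^2+2*y^2+3*z^2 := by
  obtain ⟨x, y, w, hh⟩ := rep126 (2*N) (three_sq _ (by omega) (by omega) (by omega))
  have : x % 2 = 0 := by
    rcases Int.emod_two_eq_zero_or_one x with h | h
    · exact h
    · have : x^2 % 2 = 1 := by simp [pow_two, Int.mul_emod, h]
      omega
  obtain ⟨x', rfl⟩ : ∃ x', x = 2*x' := ⟨x/2, by omega⟩
  exact ⟨y, x', w, by linarith⟩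

theorem rep236 (N : ℤ) (h0 : 0 ≤ N) (h : N % 2 = 1) (h8 : N % 8 ≠ 7) (h3 : N % 3 ≠ 1) :
    ∃ x y z : ℤ, N = 2*x^2+3*y^2+6*z^2 := by
  obtain ⟨p, q, r, h⟩ := three_sq N h0 (by omega) h8
  obtain ⟨p, q, r, h, hpq⟩ := parity_perm _ _ _ _ h
  obtain ⟨p', hp1, hp2, hp3⟩ := sgn3 p
  obtain ⟨q', hq1, hq2, hq3⟩ := sgn3 q
  obtain ⟨r', hr1, hr2, hr3⟩ := sgn3 r
  have ep := sq3 _ hp3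
  have eq := sq3 _ hq3
  have er := sq3 _ hr3
  rw [← hp1, ← hq1, ← hr1] at h
  obtain ⟨P, Q, R, hs, hpar, h⟩ : ∃ P Q R : ℤ, (P + Q + R) % 3 = 0 ∧ P % 2 = Q % 2 ∧ N = P^2+Q^2+R^2 := by
    by_cases a1 : (p' + q' + r') % 3 = 0
    · exact ⟨p', q', r', a1, by omega, h⟩
    by_cases a2 : (p' + q' - r') % 3 = 0
    · exact ⟨p', q', -r', by omega, by omega, by rw [h]; ring⟩
    · exact ⟨p', -q', r', by omega, by omega, by rw [h]; ring⟩
  obtain ⟨a, hx⟩ : ∃ x, P+Q+R = 3*x := ⟨(P+Q+R)/3, by omega⟩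
  obtain ⟨b, hw⟩ : ∃ w, P-Q = 2*w := ⟨(P-Q)/2, by omega⟩
  obtain ⟨c, hy⟩ : ∃ y, P+Q-2*R = 6*y := ⟨(P+Q-2*R)/6, by omega⟩
  refine ⟨b, a, c, ?_⟩
  have e1 : P = a + c + b := by omega
  have e2 : Q = a + c - b := by omega
  have e3 : R = a - 2*c := by omega
  rw [h, e1, e2, e3]; ring

theorem rep1233 (N : ℤ) (h0 : 0 ≤ N) : ∃ x y z w : ℤ, N = x^2+2*y^2+3*z^2+3*w^2 := by
  rcases Int.emod_two_eq_zero_or_one N with h | h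
  · by_cases h4 : 4 ≤ N
    · obtain ⟨x, y, z, hh⟩ := rep123 (N-3) (by omega) (by omega)
      exact ⟨x, y, z, 1, by linarith⟩
    · have : N = 0 ∨ N = 2 := by omega
      rcases this with rfl | rfl
      · exact ⟨0, 0, 0, 0, by norm_num⟩
      · exact ⟨0, 1, 0, 0, by norm_num⟩
  · obtain ⟨x, y, z, hh⟩ := rep123 N (by omega) (by omega)
    exact ⟨x, y, z, 0, by linarith⟩

/-- `v` is represented using the variables with index in `S`. -/
def RepOn (n : ℕ) (S : Finset ℕ) (v : ℤ) : Prop :=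
  ∃ x : ℕ → ℤ, ∑ i ∈ S, ((n : ℤ) + i) * x i ^ 2 = v

theorem RepOn.add {n : ℕ} {S T : Finset ℕ} {v w : ℤ} (h1 : RepOn n S v) (h2 : RepOn n T w)
    (hd : Disjoint S T) : RepOn n (S ∪ T) (v + w) := by
  obtain ⟨x, hx⟩ := h1
  obtain ⟨y, hy⟩ := h2
  refine ⟨fun i => if i ∈ S then x i else y i, ?_⟩
  rw [Finset.sum_union hd, ← hx, ← hy]
  congr 1
  · exact Finset.sum_congr rfl fun i hi => by simp [hi]
  · exact Finset.sum_congr rfl fun i hi => by simp [Finset.disjoint_right.mp hd hi]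

theorem RepOn.zero (n : ℕ) (S : Finset ℕ) : RepOn n S 0 := ⟨fun _ => 0, by simp⟩

theorem RepOn.mono {n : ℕ} {S T : Finset ℕ} {v : ℤ} (h1 : RepOn n S v) (h : S ⊆ T) :
    RepOn n T v := by
  have := h1.add (RepOn.zero n (T \ S)) Finset.disjoint_sdiff
  rwa [Finset.union_sdiff_of_subset h, add_zero] at this

theorem RepOn.single (n i : ℕ) (x : ℤ) : RepOn n {i} (((n : ℤ) + i) * x ^ 2) :=
  ⟨fun _ => x, by simp⟩

theorem RepOn.pair (n i j : ℕ) (h : i ≠ j) (x y : ℤ) :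
    RepOn n {i, j} (((n : ℤ) + i) * x ^ 2 + ((n : ℤ) + j) * y ^ 2) := by
  have := (RepOn.single n i x).add (RepOn.single n j y) (by simpa using h)
  exact this

theorem RepOn.fin {n : ℕ} {m : ℤ} (h : RepOn n (Finset.range (n+1)) m) :
    ∃ x : Fin (n + 1) → ℤ, ∑ i : Fin (n + 1), ((n : ℤ) + (i : ℕ)) * (x i) ^ 2 = m := by
  obtain ⟨x, hx⟩ := h
  refine ⟨fun i => x i, ?_⟩
  rw [← hx, Finset.sum_range]

/-- bounded search for representations -/
def srch (n : ℕ) : List ℕ → ℕ → Bool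
  | [], m => m == 0
  | i :: l, m => srch n l m || (decide (n+i ≤ m) && srch n l (m-(n+i)))
      || (decide (4*(n+i) ≤ m) && srch n l (m-4*(n+i)))
      || (decide (9*(n+i) ≤ m) && srch n l (m-9*(n+i)))
      || (decide (16*(n+i) ≤ m) && srch n l (m-16*(n+i)))

theorem srch_sound (n : ℕ) : ∀ (l : List ℕ) (m : ℕ), l.Nodup → srch n l m = true →
    RepOn n l.toFinset m := by
  intro l
  induction l with
  | nil =>
    intro m _ h
    have : m = 0 := by simpa [srch] using h
    subst this
    exact_mod_cast RepOn.zero n _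
  | cons i l ih =>
    intro m hnd h
    rw [List.nodup_cons] at hnd
    have key : ∀ k : ℕ, k^2*(n+i) ≤ m → srch n l (m-k^2*(n+i)) = true →
        RepOn n (i :: l).toFinset m := by
      intro k hk hs
      have := (RepOn.single n i k).add (ih _ hnd.2 hs) (by simpa using hnd.1)
      rw [List.toFinset_cons, Finset.insert_eq]
      convert this using 1
      push_cast [hk]
      ring
    simp only [srch, Bool.or_eq_true, Bool.and_eq_true, decide_eq_true_eq] at h
    rcases h with (((h | h) | h) | h) | h
    · exact key 0 (by simp) (by simpa using h)
    · exact key 1 (by simpa using h.1) (by simpa using h.2)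
    · exact key 2 (by simpa using h.1) (by simpa using h.2)
    · exact key 3 (by simpa using h.1) (by simpa using h.2)
    · exact key 4 (by simpa using h.1) (by simpa using h.2)

theorem repOn_123 (n j : ℕ) (hj : 0 < j) (hj2 : 2*j < n) (N : ℤ) (h0 : 0 ≤ N) (h : N % 2 = 1) :
    RepOn n ({0, n} ∪ {j, n-j}) (n*N) := by
  obtain ⟨x, y, z, hh⟩ := rep123 N h0 h
  have := (RepOn.pair n 0 n (by omega) x y).add (RepOn.pair n j (n-j) (by omega) z z)
    (by rw [Finset.disjoint_left]; simp; omega)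
  convert this using 1
  rw [hh]
  push_cast [show j ≤ n by omega]
  ring

theorem repOn_1233 (n : ℕ) (hn : 11 ≤ n) (N : ℤ) (h0 : 0 ≤ N) :
    RepOn n (({0, n} ∪ {3, n-3}) ∪ {5, n-5}) (n*N) := by
  obtain ⟨x, y, z, w, hh⟩ := rep1233 N h0
  have := ((RepOn.pair n 0 n (by omega) x y).add (RepOn.pair n 3 (n-3) (by omega) z z)
    (by rw [Finset.disjoint_left]; simp; omega)).add (RepOn.pair n 5 (n-5) (by omega) w w)
    (by rw [Finset.disjoint_left]; simp; omega)
  convert this using 1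
  rw [hh]
  push_cast [show 3 ≤ n by omega, show 5 ≤ n by omega]
  ring

theorem large_n (n : ℕ) (hn : 11 ≤ n) (m : ℕ) (hm : n ≤ m) :
    RepOn n (Finset.range (n+1)) m := by
  by_cases h4 : m < 4*n
  · by_cases h2 : m ≤ 2*n
    · have := RepOn.single n (m-n) 1
      convert this.mono (T := Finset.range (n+1)) (by intro i; simp; omega) using 1
      push_cast [hm]; ring
    · by_cases h3 : m ≤ 3*n
      · have := RepOn.pair n 0 (m-2*n) (by omega) 1 1
        convert this.mono (T := Finset.range (n+1)) (by intro i; simp; omega) using 1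
        push_cast [show 2*n ≤ m by omega]; ring
      · have := RepOn.pair n (m-3*n) n (by omega) 1 1
        convert this.mono (T := Finset.range (n+1)) (by intro i; simp; omega) using 1
        push_cast [show 3*n ≤ m by omega]; ring
  · suffices ∃ (S : Finset ℕ) (R : ℕ), RepOn n S R ∧ S ⊆ Finset.range n ∧
        (∀ i ∈ S, i ≠ 0 ∧ i ≠ 3 ∧ i ≠ n-3 ∧ i ≠ 5 ∧ i ≠ n-5) ∧ R ≤ 4*n ∧ R % n = m % n by
      obtain ⟨S, R, hR, hS, hS2, hle, hmod⟩ := this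
      obtain ⟨q, hq⟩ := (Nat.modEq_iff_dvd' (by omega : R ≤ m)).mp hmod
      have := (repOn_1233 n hn q (by positivity)).add hR (by
        rw [Finset.disjoint_right]
        intro i hi
        have h1 := hS2 i hi
        have h2 := Finset.mem_range.mp (hS hi)
        simp; omega)
      have h3 := this.mono (T := Finset.range (n+1)) (by
        intro i hi
        rw [Finset.mem_union] at hi
        rcases hi with hi | hi
        · simp at hi ⊢; omega
        · have := Finset.mem_range.mp (hS hi)
          simp; omega)
      convert h3 using 1
      have : m = n*q+R := by omega
      rw [this]; push_cast; ring
    have hr : m % n < n := Nat.mod_lt _ (by omega)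
    generalize m % n = r at hr
    by_cases r0 : r = 0
    · exact ⟨∅, 0, RepOn.zero _ _, by simp, by simp, by omega, by simp [r0]⟩
    have mk2 : ∀ i j : ℕ, i ≠ j → RepOn n {i, j} ((2*n+i+j : ℕ) : ℤ) := by
      intro i j hij
      convert RepOn.pair n i j hij 1 1 using 1
      push_cast; ring
    have md : ∀ a k : ℕ, a = n*k + r → a % n = r := by
      intro a k h
      rw [h, Nat.mul_add_mod, Nat.mod_eq_of_lt hr]
    by_cases r3 : r = 3
    · exact ⟨_, _, mk2 1 2 (by omega), by intro i; simp; omega, by simp; omega, by omega,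
        md _ 2 (by omega)⟩
    by_cases r5 : r = 5
    · exact ⟨_, _, mk2 1 4 (by omega), by intro i; simp; omega, by simp; omega, by omega,
        md _ 2 (by omega)⟩
    by_cases r3' : r = n - 3
    · exact ⟨_, _, mk2 (n-1) (n-2) (by omega), by intro i; simp; omega, by simp; omega, by omega,
        md _ 3 (by omega)⟩
    by_cases r5' : r = n - 5
    · exact ⟨_, _, mk2 (n-1) (n-4) (by omega), by intro i; simp; omega, by simp; omega, by omega,
        md _ 3 (by omega)⟩
    refine ⟨{r}, n + r, ?_, by simpa using hr, by simp; omega, by omega, md _ 1 (by omega)⟩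
    convert RepOn.single n r 1 using 1
    push_cast; ring

theorem mid_n (n j B : ℕ) (l : List ℕ) (hj : 0 < j) (hj2 : 2*j < n) (hl : l.Nodup)
    (hl2 : ∀ i ∈ l, i < n ∧ i ≠ 0 ∧ i ≠ j ∧ i ≠ n-j)
    (hres : ∀ t < 2*n, ∃ R ≤ B, R % (2*n) = t ∧ srch n l R = true)
    (hsm : ∀ m < B, n ≤ m → srch n (List.range (n+1)) m = true)
    (m : ℕ) (hm : n ≤ m) : RepOn n (Finset.range (n+1)) m := by
  by_cases hB : m < B
  · have := srch_sound n _ m List.nodup_range (hsm m hB hm)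
    exact this.mono (by intro i; simp)
  · obtain ⟨R, hRB, hR, hs⟩ := hres ((m+n) % (2*n)) (Nat.mod_lt _ (by omega))
    obtain ⟨q, hq⟩ := (Nat.modEq_iff_dvd' (by omega : R ≤ m + n)).mp hR
    have hq1 : 0 < q := by
      rcases Nat.eq_zero_or_pos q with h | h
      · subst h; omega
      · exact h
    have h1 := srch_sound n _ R hl hs
    have := (repOn_123 n j hj hj2 (2*q-1) (by omega) (by omega)).add h1 (by
        rw [Finset.disjoint_right]
        intro i hi
        have h1 := hl2 i (by simpa using hi)
        simp; omega)
    have h3 := this.mono (T := Finset.range (n+1)) (by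
        intro i hi
        rw [Finset.mem_union] at hi
        rcases hi with hi | hi
        · simp at hi ⊢; omega
        · have := hl2 i (by simpa using hi)
          simp; omega)
    convert h3 using 1
    have : ((m + n : ℕ) : ℤ) = 2*n*q+R := by
      have : m + n = 2*n*q+R := by omega
      exact_mod_cast this
    push_cast at this
    linarith

theorem four_small : ∀ m < 72, 4 ≤ m → srch 4 (List.range 5) m = true := by
  decide +kernel

theorem case_four (m : ℕ) (hm : 4 ≤ m) :
    ∃ x a w b y : ℤ, 4*x^2+5*a^2+6*w^2+7*b^2+8*y^2 = (m:ℤ) := by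
  by_cases hsm : m < 72
  · obtain ⟨x, hx⟩ := srch_sound 4 _ m List.nodup_range (four_small m hsm hm)
    refine ⟨x 0, x 1, x 2, x 3, x 4, ?_⟩
    rw [← hx, List.toFinset_range]
    simp [Finset.sum_range_succ]
  push Not at hsm
  have use126 : ∀ (K a b : ℤ), 0 ≤ K → (K % 4 = 2 ∨ K % 4 = 3) → (m:ℤ) = 4*K+5*a^2+7*b^2 →
      ∃ x a w b y : ℤ, 4*x^2+5*a^2+6*w^2+7*b^2+8*y^2 = (m:ℤ) := by
    intro K a b h0 hK h
    obtain ⟨x, y, w, hh⟩ := rep126 K (three_sq _ (by omega) (by omega) (by omega))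
    exact ⟨x, a, 2*w, b, y, by rw [h, hh]; ring⟩
  have h4 : m % 4 = 0 ∨ m % 4 = 1 ∨ m % 4 = 2 ∨ m % 4 = 3 := by omega
  rcases h4 with h | h | h | h
  · obtain ⟨q, rfl⟩ : ∃ q, m = 4*q := ⟨m/4, by omega⟩
    by_cases h0 : q % 4 = 0
    · exact use126 (q-5) 2 0 (by omega) (by omega) (by push_cast; ring)
    by_cases h1 : q % 4 = 1
    · exact use126 (q-7) 0 2 (by omega) (by omega) (by push_cast; ring)
    · exact use126 q 0 0 (by omega) (by omega) (by push_cast; ring)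
  · obtain ⟨q, rfl⟩ : ∃ q, m = 4*q+5 := ⟨(m-5)/4, by omega⟩
    by_cases h0 : q % 4 = 0
    · exact use126 (q-10) 3 0 (by omega) (by omega) (by push_cast; ring)
    by_cases h1 : q % 4 = 1
    · exact use126 (q-7) 1 2 (by omega) (by omega) (by push_cast; ring)
    · exact use126 q 1 0 (by omega) (by omega) (by push_cast; ring)
  · obtain ⟨M, rfl⟩ : ∃ M, m = 2*M := ⟨m/2, by omega⟩
    have use236 : ∀ y : ℤ, 0 ≤ (M:ℤ)-4*y^2 → ((M:ℤ)-4*y^2) % 8 ≠ 7 → ((M:ℤ)-4*y^2) % 3 ≠ 1 →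
        ∃ x a w b y : ℤ, 4*x^2+5*a^2+6*w^2+7*b^2+8*y^2 = ((2*M : ℕ):ℤ) := by
      intro y h0 h8 h3
      obtain ⟨x, w, z, hh⟩ := rep236 _ h0 (by omega) h8 h3
      refine ⟨x, z, w, z, y, ?_⟩
      push_cast
      linear_combination -2*hh
    by_cases h3 : M % 3 = 1
    · by_cases h7 : M % 8 = 7
      · exact use236 1 (by omega) (by omega) (by omega)
      · exact use236 2 (by omega) (by omega) (by omega)
    · by_cases h7 : M % 8 = 7
      · exact use236 3 (by omega) (by omega) (by omega)
      · exact use236 0 (by omega) (by omega) (by omega)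
  · obtain ⟨q, rfl⟩ : ∃ q, m = 4*q+7 := ⟨(m-7)/4, by omega⟩
    by_cases h0 : q % 4 = 0 ∨ q % 4 = 1
    · exact use126 (q-14) 0 3 (by omega) (by omega) (by push_cast; ring)
    · exact use126 q 0 1 (by omega) (by omega) (by push_cast; ring)

theorem repOn_all (n : ℕ) (hn : 3 < n) (m : ℕ) (hm : n ≤ m) :
    RepOn n (Finset.range (n+1)) m := by
  by_cases h11 : 11 ≤ n
  · exact large_n n h11 m hm
  have : n = 4 ∨ n = 5 ∨ n = 6 ∨ n = 7 ∨ n = 8 ∨ n = 9 ∨ n = 10 := by omega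
  rcases this with rfl | rfl | rfl | rfl | rfl | rfl | rfl
  · obtain ⟨x, a, w, b, y, h⟩ := case_four m hm
    refine ⟨fun i => if i = 0 then x else if i = 1 then a else if i = 2 then w else
      if i = 3 then b else y, ?_⟩
    rw [← h]
    simp [Finset.sum_range_succ]
  · exact mid_n 5 2 180 [1, 4] (by norm_num) (by norm_num) (by decide) (by decide)
      (by decide +kernel) (by decide +kernel) m hm
  · exact mid_n 6 2 180 [1, 3, 5] (by norm_num) (by norm_num) (by decide) (by decide)
      (by decide +kernel) (by decide +kernel) m hm
  · exact mid_n 7 3 180 [1, 2, 5, 6] (by norm_num) (by norm_num) (by decide) (by decide)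
      (by decide +kernel) (by decide +kernel) m hm
  · exact mid_n 8 3 180 [1, 2, 4, 6, 7] (by norm_num) (by norm_num) (by decide) (by decide)
      (by decide +kernel) (by decide +kernel) m hm
  · exact mid_n 9 3 180 [1, 2, 4, 5, 7, 8] (by norm_num) (by norm_num) (by decide) (by decide)
      (by decide +kernel) (by decide +kernel) m hm
  · exact mid_n 10 3 180 [1, 2, 4, 5, 6, 8, 9] (by norm_num) (by norm_num) (by decide) (by decide)
      (by decide +kernel) (by decide +kernel) m hm

theorem stmt_3 (n : ℕ) (hn : 3 < n) :
    ∀ m : ℤ, m ≠ 0 →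
      ((∃ x : Fin (n + 1) → ℤ, ∑ i : Fin (n + 1), ((n : ℤ) + (i : ℕ)) * (x i) ^ 2 = m) ↔ (n : ℤ) ≤ m) := by
  intro m hm0
  constructor
  · rintro ⟨x, rfl⟩
    have hnn : ∀ i ∈ Finset.univ, 0 ≤ ((n : ℤ) + ((i : Fin (n+1)) : ℕ)) * (x i) ^ 2 :=
      fun i _ => by positivity
    obtain ⟨i, hi, hne⟩ := Finset.exists_ne_zero_of_sum_ne_zero hm0
    have hx : x i ≠ 0 := by
      intro h
      simp [h] at hne
    have h1 : 1 ≤ (x i)^2 := by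
      have : 0 < (x i)^2 := by positivity
      omega
    have h2 := Finset.single_le_sum hnn hi
    refine le_trans ?_ h2
    have h3 : (0:ℤ) ≤ (i : ℕ) := by positivity
    nlinarith
  · intro h
    lift m to ℕ using by omega
    exact (repOn_all n hn m (by exact_mod_cast h)).fin
end

section
/- For any integer n greater than 3, t(n) ≤ n + 1, where t(n) is the smallest possible rank of a tight T(n)-universal integral quadratic form. -/
/-- The value of the integral quadratic form given by the symmetric matrix `M`
at the integer vector `x`: `∑ i j, M i j * x i * x j`. -/
def QFval {k : ℕ} (M : Matrix (Fin k) (Fin k) ℤ) (x : Fin k → ℤ) : ℤ :=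
  ∑ i, ∑ j, M i j * x i * x j

/-- The quadratic form given by `M` is positive definite. -/
def QFPosDef {k : ℕ} (M : Matrix (Fin k) (Fin k) ℤ) : Prop :=
  ∀ x : Fin k → ℤ, x ≠ 0 → 0 < QFval M x

/-- The integer `m` is represented by the quadratic form given by `M`. -/
def QFRep {k : ℕ} (M : Matrix (Fin k) (Fin k) ℤ) (m : ℤ) : Prop :=
  ∃ x : Fin k → ℤ, QFval M x = m

/-- The quadratic form given by `M` is tight `T(n)`-universal: the set of nonzero
integers it represents is exactly the set of integers `≥ n`. -/
def QFTight (n : ℕ) {k : ℕ} (M : Matrix (Fin k) (Fin k) ℤ) : Prop :=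
  ∀ m : ℤ, m ≠ 0 → (QFRep M m ↔ (n : ℤ) ≤ m)

/-- Adding one orthogonal variable. -/
theorem aux_add {k : ℕ} (M : Matrix (Fin k) (Fin k) ℤ) (hM : M.IsSymm) (a : ℤ) :
    ∃ M' : Matrix (Fin (k+1)) (Fin (k+1)) ℤ, M'.IsSymm ∧
      ∀ x : Fin (k+1) → ℤ, QFval M' x = a * x 0 ^ 2 + QFval M (fun i => x i.succ) := by
  refine ⟨Matrix.of fun i j => Fin.cases (Fin.cases a (fun _ => 0) j)
    (fun i' => Fin.cases 0 (fun j' => M i' j') j) i, ?_, ?_⟩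
  · ext i j
    refine Fin.cases ?_ (fun i' => ?_) i <;> refine Fin.cases ?_ (fun j' => ?_) j <;>
      simp [Matrix.transpose_apply]
    exact hM.apply i' j'
  · intro x
    simp [QFval, Fin.sum_univ_succ]
    ring

theorem aux_final {n : ℕ} (hn : 3 < n) {k : ℕ} (M : Matrix (Fin k) (Fin k) ℤ)
    (hmin : ∀ x : Fin k → ℤ, x ≠ 0 → (n : ℤ) ≤ QFval M x)
    (hrep : ∀ m : ℤ, (n : ℤ) ≤ m → QFRep M m) : QFPosDef M ∧ QFTight n M := by
  refine ⟨fun x hx => by have := hmin x hx; omega, fun m hm => ⟨?_, hrep m⟩⟩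
  rintro ⟨x, rfl⟩
  apply hmin
  rintro rfl
  exact hm (by simp [QFval])

theorem aux_four (k : ℤ) (hk : 0 ≤ k) : ∃ a b c d : ℤ, a^2+b^2+c^2+d^2 = k := by
  obtain ⟨a, b, c, d, h⟩ := Nat.sum_four_squares k.toNat
  refine ⟨a, b, c, d, ?_⟩
  have : ((a^2+b^2+c^2+d^2 : ℕ) : ℤ) = k := by rw [h]; omega
  push_cast at this
  exact this

/-- The ternary block. -/
theorem aux_block (h a b c : ℤ) (hh : 0 ≤ h) (ha : 1 ≤ a) (hb : 1 ≤ b) (hc : 1 ≤ c) :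
    ∃ M : Matrix (Fin 3) (Fin 3) ℤ, M.IsSymm ∧
      (∀ x : Fin 3 → ℤ, x ≠ 0 → 2 * h + 1 ≤ QFval M x) ∧
      QFRep M (2*h+a) ∧ QFRep M (2*h+b) ∧ QFRep M (2*h+c) ∧
      QFRep M (2*h+a+b) ∧ QFRep M (2*h+a+c) ∧ QFRep M (2*h+b+c) := by
  have hv : ∀ x : Fin 3 → ℤ, QFval !![2*h+a, h, h; h, 2*h+b, h; h, h, 2*h+c] x =
      2*h*(x 0^2+x 1^2+x 2^2+x 0*x 1+x 1*x 2+x 0*x 2)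
        + (a*x 0^2+b*x 1^2+c*x 2^2) := by
    intro x
    simp [QFval, Fin.sum_univ_succ]
    ring
  refine ⟨!![2*h+a, h, h; h, 2*h+b, h; h, h, 2*h+c], ?_, ?_, ⟨![1,0,0], ?_⟩, ⟨![0,1,0], ?_⟩,
    ⟨![0,0,1], ?_⟩, ⟨![1,-1,0], ?_⟩, ⟨![1,0,-1], ?_⟩, ⟨![0,1,-1], ?_⟩⟩
  · ext i j
    fin_cases i <;> fin_cases j <;> rfl
  · intro x hx
    rw [hv]
    have hs : 1 ≤ x 0^2+x 1^2+x 2^2 := by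
      by_contra hcon
      apply hx
      have h0 : x 0 = 0 := by
        have : x 0 ^ 2 = 0 := by nlinarith [sq_nonneg (x 0), sq_nonneg (x 1), sq_nonneg (x 2)]
        simpa using this
      have h1 : x 1 = 0 := by
        have : x 1 ^ 2 = 0 := by nlinarith [sq_nonneg (x 0), sq_nonneg (x 1), sq_nonneg (x 2)]
        simpa using this
      have h2 : x 2 = 0 := by
        have : x 2 ^ 2 = 0 := by nlinarith [sq_nonneg (x 0), sq_nonneg (x 1), sq_nonneg (x 2)]
        simpa using this
      ext i
      fin_cases i <;> simp [h0, h1, h2]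
    have hF : 1 ≤ x 0^2+x 1^2+x 2^2+x 0*x 1+x 1*x 2+x 0*x 2 := by
      nlinarith [sq_nonneg (x 0 + x 1 + x 2)]
    have h3 : 1 ≤ a*x 0^2+b*x 1^2+c*x 2^2 := by
      nlinarith [mul_nonneg (sub_nonneg.2 ha) (sq_nonneg (x 0)),
        mul_nonneg (sub_nonneg.2 hb) (sq_nonneg (x 1)),
        mul_nonneg (sub_nonneg.2 hc) (sq_nonneg (x 2))]
    nlinarith [mul_nonneg hh (sub_nonneg.2 hF)]
  all_goals
    rw [hv]
    simp
    try ring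

theorem aux_block' (n : ℤ) (hn : 6 ≤ n) :
    ∃ M : Matrix (Fin 3) (Fin 3) ℤ, M.IsSymm ∧
      (∀ x : Fin 3 → ℤ, x ≠ 0 → n ≤ QFval M x) ∧
      ∀ j : ℤ, 1 ≤ j → j ≤ 6 → QFRep M (n + j) := by
  rcases Int.even_or_odd' n with ⟨h, rfl | rfl⟩
  · obtain ⟨M, hs, hm, h1, h2, h3, h4, h5, h6⟩ :=
      aux_block h 1 2 4 (by omega) (by norm_num) (by norm_num) (by norm_num)
    refine ⟨M, hs, fun x hx => by have := hm x hx; omega, fun j hj hj' => ?_⟩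
    interval_cases j
    · exact h1
    · exact h2
    · convert h4 using 1; ring
    · exact h3
    · convert h5 using 1; ring
    · convert h6 using 1; ring
  · obtain ⟨M, hs, hm, h1, h2, h3, h4, h5, h6⟩ :=
      aux_block h 2 3 4 (by omega) (by norm_num) (by norm_num) (by norm_num)
    refine ⟨M, hs, fun x hx => by have := hm x hx; omega, fun j hj hj' => ?_⟩
    interval_cases j
    · convert h1 using 1; ring
    · convert h2 using 1; ring
    · convert h3 using 1; ring
    · convert h4 using 1; ring
    · convert h5 using 1; ring
    · convert h6 using 1; ring

theorem aux_min {n a : ℤ} (hn : 0 < n) (ha : n ≤ a) {k : ℕ} {M : Matrix (Fin k) (Fin k) ℤ}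
    (hm : ∀ x : Fin k → ℤ, x ≠ 0 → n ≤ QFval M x)
    {M' : Matrix (Fin (k+1)) (Fin (k+1)) ℤ}
    (hv : ∀ x : Fin (k+1) → ℤ, QFval M' x = a * x 0 ^ 2 + QFval M (fun i => x i.succ)) :
    ∀ x : Fin (k+1) → ℤ, x ≠ 0 → n ≤ QFval M' x := by
  intro x hx
  rw [hv]
  by_cases h : (fun i => x (Fin.succ i)) = 0
  · have h0 : x 0 ≠ 0 := by
      intro h0
      apply hx
      ext i
      refine Fin.cases h0 (fun i => congrFun h i) i
    rw [h]
    have : QFval M 0 = 0 := by simp [QFval]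
    have h1 : 1 ≤ x 0 ^ 2 := by
      have := sq_pos_of_ne_zero h0
      omega
    rw [this]
    nlinarith
  · have := hm _ h
    nlinarith [sq_nonneg (x 0)]

theorem aux_diag (n : ℤ) (hn : 6 ≤ n) (r : ℕ) :
    ∃ M : Matrix (Fin (3+r)) (Fin (3+r)) ℤ, M.IsSymm ∧
      (∀ x : Fin (3+r) → ℤ, x ≠ 0 → n ≤ QFval M x) ∧
      ∀ j : ℤ, 1 ≤ j → j ≤ 6 + r → QFRep M (n + j) := by
  induction r with
  | zero => simpa using aux_block' n hn
  | succ r ih =>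
    obtain ⟨M, hs, hm, hr⟩ := ih
    obtain ⟨M', hs', hv⟩ := aux_add M hs (n + (6 + r + 1))
    refine ⟨M', hs', aux_min (by omega) (by omega) hm hv, fun j hj hj' => ?_⟩
    by_cases hjr : j ≤ 6 + r
    · obtain ⟨x, hx⟩ := hr j hj hjr
      refine ⟨Fin.cons 0 x, ?_⟩
      rw [hv]
      simpa using hx
    · refine ⟨Fin.cons 1 0, ?_⟩
      rw [hv]
      have : j = 6 + r + 1 := by push_cast at hj'; omega
      subst this
      simp [QFval]

theorem aux_ge6 (n : ℕ) (hn : 6 ≤ n) :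
    ∃ k ≤ n + 1, ∃ M : Matrix (Fin k) (Fin k) ℤ,
      M.IsSymm ∧ QFPosDef M ∧ QFTight n M := by
  have hn' : (6:ℤ) ≤ n := by exact_mod_cast hn
  obtain ⟨M, hs, hm, hr⟩ := aux_diag n hn' (n - 7)
  obtain ⟨M1, hs1, hv1⟩ := aux_add M hs n
  have hm1 := aux_min (by omega) le_rfl hm hv1
  obtain ⟨M2, hs2, hv2⟩ := aux_add M1 hs1 n
  have hm2 := aux_min (by omega) le_rfl hm1 hv2
  obtain ⟨M3, hs3, hv3⟩ := aux_add M2 hs2 n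
  have hm3 := aux_min (by omega) le_rfl hm2 hv3
  obtain ⟨M4, hs4, hv4⟩ := aux_add M3 hs3 n
  have hm4 := aux_min (by omega) le_rfl hm3 hv4
  refine ⟨3 + (n - 7) + 1 + 1 + 1 + 1, by omega, M4, hs4, aux_final (by omega) M4 hm4 ?_⟩
  have key : ∀ (q : ℤ) (e : ℤ), 0 ≤ q → QFRep M e → QFRep M4 (n * q + e) := by
    rintro q e hq ⟨x, rfl⟩
    obtain ⟨a, b, c, d, rfl⟩ := aux_four q hq
    refine ⟨Fin.cons a (Fin.cons b (Fin.cons c (Fin.cons d x))), ?_⟩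
    rw [hv4]
    simp only [Fin.cons_zero, Fin.cons_succ]
    rw [hv3]
    simp only [Fin.cons_zero, Fin.cons_succ]
    rw [hv2]
    simp only [Fin.cons_zero, Fin.cons_succ]
    rw [hv1]
    simp only [Fin.cons_zero, Fin.cons_succ]
    ring
  intro m hm
  have hdiv := Int.mul_ediv_add_emod m n
  have hr0 := Int.emod_nonneg m (show (n:ℤ) ≠ 0 by omega)
  have hr1 := Int.emod_lt_of_pos m (show (0:ℤ) < n by omega)
  have hq : 1 ≤ m / n := by
    rw [Int.le_ediv_iff_mul_le (by omega)]; omega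
  by_cases h0 : m % n = 0
  · have := key (m / n) 0 (by omega) ⟨0, by simp [QFval]⟩
    convert this using 1
    omega
  · have := key (m / n - 1) (n + m % n) (by omega) (hr _ (by omega) (by omega))
    convert this using 1
    linarith

theorem aux_rep5 (x1 x2 x3 x4 u v m : ℤ) (h : (x1+x2+u+v) % 2 = 0)
    (hm : m = 5*(x1^2+x2^2+x3^2+x4^2)+2*u^2+4*v^2) : ∃ a b c d u v : ℤ,
    m = 5*(2*a+b+u+v)^2+5*b^2+5*c^2+5*d^2+2*u^2+4*v^2 := by
  refine ⟨(x1-x2-u-v)/2, x2, x3, x4, u, v, ?_⟩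
  have : 2*((x1-x2-u-v)/2) + x2+u+v = x1 := by omega
  rw [this, hm]; ring

theorem aux_ev (k : ℤ) (hk : 0 ≤ k) :
    ∃ a b c d : ℤ, a^2+b^2+c^2+d^2 = k ∧ (a+b) % 2 = 0 := by
  obtain ⟨a, b, c, d, h⟩ := aux_four k hk
  by_cases h1 : (a+b) % 2 = 0
  · exact ⟨a, b, c, d, h, h1⟩
  by_cases h2 : (a+c) % 2 = 0
  · exact ⟨a, c, b, d, by linarith, h2⟩
  · exact ⟨b, c, a, d, by linarith, by omega⟩

theorem aux_sq4 (a : ℤ) : (a % 2 = 0 ∧ a^2 % 4 = 0) ∨ (a % 2 = 1 ∧ a^2 % 4 = 1) := by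
  rcases Int.emod_two_eq_zero_or_one a with h | h
  · left
    refine ⟨h, ?_⟩
    obtain ⟨b, rfl⟩ : ∃ b, a = 2*b := ⟨a/2, by omega⟩
    have : (2*b)^2 = 4*b^2 := by ring
    omega
  · right
    refine ⟨h, ?_⟩
    obtain ⟨b, rfl⟩ : ∃ b, a = 2*b+1 := ⟨a/2, by omega⟩
    have : (2*b+1)^2 = 4*(b^2+b)+1 := by ring
    omega

theorem aux_od (k : ℤ) (hk : 0 ≤ k) (hk4 : k % 4 ≠ 0) :
    ∃ a b c d : ℤ, a^2+b^2+c^2+d^2 = k ∧ (a+b) % 2 = 1 := by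
  obtain ⟨a, b, c, d, h⟩ := aux_four k hk
  by_cases h1 : (a+b) % 2 = 1
  · exact ⟨a, b, c, d, h, h1⟩
  by_cases h2 : (a+c) % 2 = 1
  · exact ⟨a, c, b, d, by linarith, h2⟩
  by_cases h3 : (a+d) % 2 = 1
  · exact ⟨a, d, b, c, by linarith, h3⟩
  exfalso
  have ha := aux_sq4 a
  have hb := aux_sq4 b
  have hc := aux_sq4 c
  have hd := aux_sq4 d
  generalize a^2 = A at *
  generalize b^2 = B at *
  generalize c^2 = C at *
  generalize d^2 = D at *
  omega

theorem aux_all5 (m : ℤ) (hm : 5 ≤ m) : ∃ a b c d u v : ℤ,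
    m = 5*(2*a+b+u+v)^2+5*b^2+5*c^2+5*d^2+2*u^2+4*v^2 := by
  have hE : ∀ u v k : ℤ, 0 ≤ k → (u+v) % 2 = 0 → m = 5*k+2*u^2+4*v^2 → ∃ a b c d u v : ℤ,
      m = 5*(2*a+b+u+v)^2+5*b^2+5*c^2+5*d^2+2*u^2+4*v^2 := by
    intro u v k hk huv hmk
    obtain ⟨a, b, c, d, h, hp⟩ := aux_ev k hk
    exact aux_rep5 a b c d u v m (by omega) (by rw [h]; exact hmk)
  have hO : ∀ u v k : ℤ, 0 ≤ k → k % 4 ≠ 0 → (u+v) % 2 = 1 → m = 5*k+2*u^2+4*v^2 →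
      ∃ a b c d u v : ℤ,
      m = 5*(2*a+b+u+v)^2+5*b^2+5*c^2+5*d^2+2*u^2+4*v^2 := by
    intro u v k hk hk4 huv hmk
    obtain ⟨a, b, c, d, h, hp⟩ := aux_od k hk hk4
    exact aux_rep5 a b c d u v m (by omega) (by rw [h]; exact hmk)
  have h5 : m % 5 = 0 ∨ m % 5 = 1 ∨ m % 5 = 2 ∨ m % 5 = 3 ∨ m % 5 = 4 := by omega
  rcases h5 with h | h | h | h | h
  · exact hE 0 0 (m/5) (by omega) (by norm_num) (by omega)
  · exact hE 1 1 (m/5-1) (by omega) (by norm_num) (by omega)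
  · by_cases h4 : (m/5) % 4 = 0
    · exact hO 2 1 (m/5-2) (by omega) (by omega) (by norm_num) (by omega)
    · exact hO 1 0 (m/5) (by omega) h4 (by norm_num) (by omega)
  · exact hE 2 0 (m/5-1) (by omega) (by norm_num) (by omega)
  · by_cases h4 : (m/5) % 4 = 0
    · exact hE 2 2 (m/5-4) (by omega) (by norm_num) (by omega)
    · exact hO 0 1 (m/5) (by omega) h4 (by norm_num) (by omega)

theorem aux_one_le_sq {x : ℤ} (h : x ≠ 0) : 1 ≤ x^2 := by
  have := sq_pos_of_ne_zero h
  omega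

theorem aux_min5 (a b c d u v : ℤ) 
    (h : 5*(2*a+b+u+v)^2+5*b^2+5*c^2+5*d^2+2*u^2+4*v^2 < 5) :
    a = 0 ∧ b = 0 ∧ c = 0 ∧ d = 0 ∧ u = 0 ∧ v = 0 := by
  have p1 := sq_nonneg (2*a+b+u+v)
  have p2 := sq_nonneg b
  have p3 := sq_nonneg c
  have p4 := sq_nonneg d
  have p5 := sq_nonneg u
  have p6 := sq_nonneg v
  have h1 : 2*a+b+u+v = 0 := by
    by_contra hc; have := aux_one_le_sq hc; omega
  have hb : b = 0 := by
    by_contra hc; have := aux_one_le_sq hc; omega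
  have hc : c = 0 := by
    by_contra hc; have := aux_one_le_sq hc; omega
  have hd : d = 0 := by
    by_contra hc; have := aux_one_le_sq hc; omega
  have hu1 : u ≤ 1 := by nlinarith
  have hu2 : -1 ≤ u := by nlinarith
  have hv1 : v ≤ 1 := by nlinarith
  have hv2 : -1 ≤ v := by nlinarith
  interval_cases u <;> interval_cases v <;> omega

theorem aux_5 :
    ∃ k ≤ 5 + 1, ∃ M : Matrix (Fin k) (Fin k) ℤ,
      M.IsSymm ∧ QFPosDef M ∧ QFTight 5 M := by
  have hv : ∀ x : Fin 6 → ℤ, QFval !![20,10,0,0,10,10; 10,10,0,0,5,5; 0,0,5,0,0,0;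
      0,0,0,5,0,0; 10,5,0,0,7,5; 10,5,0,0,5,9] x =
      5*(2*x 0+x 1+x 4+x 5)^2+5*(x 1)^2+5*(x 2)^2+5*(x 3)^2+2*(x 4)^2+4*(x 5)^2 := by
    intro x
    simp [QFval, Fin.sum_univ_six]
    ring
  refine ⟨6, le_rfl, !![20,10,0,0,10,10; 10,10,0,0,5,5; 0,0,5,0,0,0;
      0,0,0,5,0,0; 10,5,0,0,7,5; 10,5,0,0,5,9], ?_,
    aux_final (by norm_num) _ ?_ ?_⟩
  · ext i j
    fin_cases i <;> fin_cases j <;> rfl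
  · intro x hx
    by_contra hc
    apply hx
    rw [hv] at hc
    obtain ⟨h0, h1, h2, h3, h4, h5⟩ := aux_min5 _ _ _ _ _ _ (not_le.1 hc)
    ext i
    fin_cases i <;> assumption
  · intro m hm
    obtain ⟨a, b, c, d, u, v, h⟩ := aux_all5 m (by exact_mod_cast hm)
    refine ⟨![a,b,c,d,u,v], ?_⟩
    rw [hv, h]
    rfl

theorem aux_norm3 (x : ℤ) : ∃ y : ℤ, (y = x ∨ y = -x) ∧ (y % 3 = 0 ∨ y % 3 = 1) := by
  by_cases h : x % 3 = 2
  · exact ⟨-x, Or.inr rfl, by omega⟩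
  · exact ⟨x, Or.inl rfl, by omega⟩

theorem aux_sq3 (y : ℤ) (h : y % 3 = 0 ∨ y % 3 = 1) :
    (y % 3 = 0 ∧ y^2 % 9 = 0) ∨ (y % 3 = 1 ∧ y^2 % 3 = 1) := by
  rcases h with h | h
  · left
    refine ⟨h, ?_⟩
    obtain ⟨b, rfl⟩ : ∃ b, y = 3*b := ⟨y/3, by omega⟩
    have : (3*b)^2 = 9*b^2 := by ring
    omega
  · right
    refine ⟨h, ?_⟩
    obtain ⟨b, rfl⟩ : ∃ b, y = 3*b+1 := ⟨y/3, by omega⟩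
    have : (3*b+1)^2 = 3*(3*b^2+2*b)+1 := by ring
    omega

theorem aux_pm {x y : ℤ} (h : y = x ∨ y = -x) : y^2 = x^2 := by
  rcases h with rfl | rfl <;> ring

theorem aux_sgn_core (a b c d A B C D N : ℤ) (hN : A+B+C+D = N)
    (ha : (a % 3 = 0 ∧ A % 9 = 0) ∨ (a % 3 = 1 ∧ A % 3 = 1))
    (hb : (b % 3 = 0 ∧ B % 9 = 0) ∨ (b % 3 = 1 ∧ B % 3 = 1))
    (hc : (c % 3 = 0 ∧ C % 9 = 0) ∨ (c % 3 = 1 ∧ C % 3 = 1))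
    (hd : (d % 3 = 0 ∧ D % 9 = 0) ∨ (d % 3 = 1 ∧ D % 3 = 1)) :
    (N % 3 ≠ 1 → ∃ y1 y2 y3 y4 : ℤ, (y1 = a ∨ y1 = -a) ∧ (y2 = b ∨ y2 = -b) ∧ (y3 = c ∨ y3 = -c) ∧ (y4 = d ∨ y4 = -d) ∧
      (y1+y2+y3+y4) % 3 = 0) ∧
    (N % 9 ≠ 0 → ∃ y1 y2 y3 y4 : ℤ, (y1 = a ∨ y1 = -a) ∧ (y2 = b ∨ y2 = -b) ∧ (y3 = c ∨ y3 = -c) ∧ (y4 = d ∨ y4 = -d) ∧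
      (y1+y2+y3+y4) % 3 = 1) := by
  constructor
  · intro h
    rcases ha with ⟨a1, a2⟩ | ⟨a1, a2⟩ <;> rcases hb with ⟨b1, b2⟩ | ⟨b1, b2⟩ <;>
    rcases hc with ⟨c1, c2⟩ | ⟨c1, c2⟩ <;> rcases hd with ⟨d1, d2⟩ | ⟨d1, d2⟩ <;>
    first
    | (exfalso; omega)
    | exact ⟨a, b, c, d, .inl rfl, .inl rfl, .inl rfl, .inl rfl, by omega⟩
    | exact ⟨-a, b, c, d, .inr rfl, .inl rfl, .inl rfl, .inl rfl, by omega⟩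
    | exact ⟨a, -b, c, d, .inl rfl, .inr rfl, .inl rfl, .inl rfl, by omega⟩
    | exact ⟨a, b, -c, d, .inl rfl, .inl rfl, .inr rfl, .inl rfl, by omega⟩
  · intro h
    rcases ha with ⟨a1, a2⟩ | ⟨a1, a2⟩ <;> rcases hb with ⟨b1, b2⟩ | ⟨b1, b2⟩ <;>
    rcases hc with ⟨c1, c2⟩ | ⟨c1, c2⟩ <;> rcases hd with ⟨d1, d2⟩ | ⟨d1, d2⟩ <;>
    first
    | (exfalso; omega)
    | exact ⟨a, b, c, d, .inl rfl, .inl rfl, .inl rfl, .inl rfl, by omega⟩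
    | exact ⟨-a, b, c, d, .inr rfl, .inl rfl, .inl rfl, .inl rfl, by omega⟩
    | exact ⟨a, -b, c, d, .inl rfl, .inr rfl, .inl rfl, .inl rfl, by omega⟩
    | exact ⟨-a, -b, -c, -d, .inr rfl, .inr rfl, .inr rfl, .inr rfl, by omega⟩

theorem aux_pm_trans {x y z : ℤ} (h : y = x ∨ y = -x) (h' : z = y ∨ z = -y) :
    z = x ∨ z = -x := by omega

theorem aux_sgn (x1 x2 x3 x4 : ℤ) (N : ℤ) (hN : x1^2+x2^2+x3^2+x4^2 = N) :
    (N % 3 ≠ 1 → ∃ y1 y2 y3 y4 : ℤ, (y1 = x1 ∨ y1 = -x1) ∧ (y2 = x2 ∨ y2 = -x2) ∧ (y3 = x3 ∨ y3 = -x3) ∧ (y4 = x4 ∨ y4 = -x4) ∧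
      (y1+y2+y3+y4) % 3 = 0) ∧
    (N % 9 ≠ 0 → ∃ y1 y2 y3 y4 : ℤ, (y1 = x1 ∨ y1 = -x1) ∧ (y2 = x2 ∨ y2 = -x2) ∧ (y3 = x3 ∨ y3 = -x3) ∧ (y4 = x4 ∨ y4 = -x4) ∧
      (y1+y2+y3+y4) % 3 = 1) := by
  obtain ⟨a, ha, ha'⟩ := aux_norm3 x1
  obtain ⟨b, hb, hb'⟩ := aux_norm3 x2
  obtain ⟨c, hc, hc'⟩ := aux_norm3 x3
  obtain ⟨d, hd, hd'⟩ := aux_norm3 x4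
  rw [← aux_pm ha, ← aux_pm hb, ← aux_pm hc, ← aux_pm hd] at hN
  obtain ⟨k1, k2⟩ := aux_sgn_core a b c d _ _ _ _ N hN (aux_sq3 a ha') (aux_sq3 b hb')
    (aux_sq3 c hc') (aux_sq3 d hd')
  constructor
  · intro h
    obtain ⟨p, q, r, s, hp, hq, hr, hs, hh⟩ := k1 h
    exact ⟨p, q, r, s, aux_pm_trans ha hp, aux_pm_trans hb hq, aux_pm_trans hc hr,
      aux_pm_trans hd hs, hh⟩
  · intro h
    obtain ⟨p, q, r, s, hp, hq, hr, hs, hh⟩ := k2 h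
    exact ⟨p, q, r, s, aux_pm_trans ha hp, aux_pm_trans hb hq, aux_pm_trans hc hr,
      aux_pm_trans hd hs, hh⟩

theorem aux_perm4 (N : ℤ) (hN : 0 ≤ N) (h4 : N % 4 = 1) : ∃ a b c d : ℤ,
    a^2+b^2+c^2+d^2 = N ∧ a % 2 = 1 ∧ b % 2 = 0 ∧ c % 2 = 0 ∧ d % 2 = 0 := by
  obtain ⟨a, b, c, d, h⟩ := aux_four N hN
  have key : (a % 2 = 1 ∧ b % 2 = 0 ∧ c % 2 = 0 ∧ d % 2 = 0) ∨
    (b % 2 = 1 ∧ a % 2 = 0 ∧ c % 2 = 0 ∧ d % 2 = 0) ∨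
    (c % 2 = 1 ∧ b % 2 = 0 ∧ a % 2 = 0 ∧ d % 2 = 0) ∨
    (d % 2 = 1 ∧ b % 2 = 0 ∧ c % 2 = 0 ∧ a % 2 = 0) := by
    have ha := aux_sq4 a
    have hb := aux_sq4 b
    have hc := aux_sq4 c
    have hd := aux_sq4 d
    generalize a^2 = A at *
    generalize b^2 = B at *
    generalize c^2 = C at *
    generalize d^2 = D at *
    omega
  rcases key with k | k | k | k
  · exact ⟨a, b, c, d, h, k⟩
  · exact ⟨b, a, c, d, by linarith, k⟩
  · exact ⟨c, b, a, d, by linarith, k⟩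
  · exact ⟨d, b, c, a, by linarith, k⟩

theorem aux_rep4 (y1 y2 y3 y4 t m : ℤ) (h1 : y1 % 2 = t % 2) (h2 : y2 % 2 = 0)
    (h3 : y3 % 2 = 0) (h4 : y4 % 2 = 0) (h : (y1+y2+y3+y4) % 3 = t % 3)
    (hm : 2*m = y1^2+y2^2+y3^2+y4^2+9*t^2) : ∃ a b c d t : ℤ,
    2*m = (6*a-2*(b+c+d)+t)^2+4*b^2+4*c^2+4*d^2+9*t^2 := by
  refine ⟨(y1+y2+y3+y4-t)/6, y2/2, y3/2, y4/2, t, ?_⟩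
  obtain ⟨b, rfl⟩ : ∃ b, y2 = 2*b := ⟨y2/2, by omega⟩
  obtain ⟨c, rfl⟩ : ∃ c, y3 = 2*c := ⟨y3/2, by omega⟩
  obtain ⟨d, rfl⟩ : ∃ d, y4 = 2*d := ⟨y4/2, by omega⟩
  have e1 : 6*((y1+2*b+2*c+2*d-t)/6) - 2*(2*b/2+2*c/2+2*d/2) + t = y1 := by omega
  have e2 : 2*b/2 = b := by omega
  have e3 : 2*c/2 = c := by omega
  have e4 : 2*d/2 = d := by omega
  rw [e1, e2, e3, e4, hm]
  ring

theorem aux_all4 (m : ℤ) (hm : 4 ≤ m) : ∃ a b c d t : ℤ,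
    2*m = (6*a-2*(b+c+d)+t)^2+4*b^2+4*c^2+4*d^2+9*t^2 := by
  rcases Int.emod_two_eq_zero_or_one m with h | h
  · obtain ⟨k, rfl⟩ : ∃ k, m = 2*k := ⟨m/2, by omega⟩
    by_cases h3 : k % 3 = 1
    · by_cases h10 : k < 10
      · have : k = 4 ∨ k = 7 := by omega
        rcases this with rfl | rfl
        · exact aux_rep4 2 2 (-2) (-2) 0 _ (by norm_num) (by norm_num) (by norm_num)
            (by norm_num) (by norm_num) (by norm_num)
        · exact aux_rep4 4 2 2 (-2) 0 _ (by norm_num) (by norm_num) (by norm_num)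
            (by norm_num) (by norm_num) (by norm_num)
      · obtain ⟨a, b, c, d, hk⟩ := aux_four (k - 9) (by omega)
        obtain ⟨p, q, r, s, hp, hq, hr, hs, hh⟩ := (aux_sgn a b c d _ hk).2 (by omega)
        rw [← aux_pm hp, ← aux_pm hq, ← aux_pm hr, ← aux_pm hs] at hk
        exact aux_rep4 (2*p) (2*q) (2*r) (2*s) 2 _ (by omega) (by omega) (by omega) (by omega)
          (by omega) (by linarith)
    · obtain ⟨a, b, c, d, hk⟩ := aux_four k (by omega)
      obtain ⟨p, q, r, s, hp, hq, hr, hs, hh⟩ := (aux_sgn a b c d _ hk).1 (by omega)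
      rw [← aux_pm hp, ← aux_pm hq, ← aux_pm hr, ← aux_pm hs] at hk
      exact aux_rep4 (2*p) (2*q) (2*r) (2*s) 0 _ (by omega) (by omega) (by omega) (by omega)
        (by omega) (by linarith)
  · by_cases h9 : (2*m-9) % 9 = 0
    · by_cases h41 : m < 41
      · have : m = 9 ∨ m = 27 := by omega
        rcases this with rfl | rfl
        · exact aux_rep4 (-1) (-2) (-2) 0 1 _ (by norm_num) (by norm_num) (by norm_num)
            (by norm_num) (by norm_num) (by norm_num)
        · exact aux_rep4 5 4 (-2) 0 1 _ (by norm_num) (by norm_num) (by norm_num)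
            (by norm_num) (by norm_num) (by norm_num)
      · obtain ⟨a, b, c, d, hk, ha, hb, hc, hd⟩ := aux_perm4 (2*m-81) (by omega) (by omega)
        obtain ⟨p, q, r, s, hp, hq, hr, hs, hh⟩ := (aux_sgn a b c d _ hk).1 (by omega)
        rw [← aux_pm hp, ← aux_pm hq, ← aux_pm hr, ← aux_pm hs] at hk
        exact aux_rep4 p q r s 3 _ (by omega) (by omega) (by omega) (by omega)
          (by omega) (by linarith)
    · obtain ⟨a, b, c, d, hk, ha, hb, hc, hd⟩ := aux_perm4 (2*m-9) (by omega) (by omega)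
      obtain ⟨p, q, r, s, hp, hq, hr, hs, hh⟩ := (aux_sgn a b c d _ hk).2 (by omega)
      rw [← aux_pm hp, ← aux_pm hq, ← aux_pm hr, ← aux_pm hs] at hk
      exact aux_rep4 p q r s 1 _ (by omega) (by omega) (by omega) (by omega)
        (by omega) (by linarith)

theorem aux_min4 (a b c d t : ℤ)
    (h : (6*a-2*(b+c+d)+t)^2+4*b^2+4*c^2+4*d^2+9*t^2 < 8) :
    a = 0 ∧ b = 0 ∧ c = 0 ∧ d = 0 ∧ t = 0 := by
  have p1 := sq_nonneg (6*a-2*(b+c+d)+t)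
  have p2 := sq_nonneg b
  have p3 := sq_nonneg c
  have p4 := sq_nonneg d
  have p5 := sq_nonneg t
  have ht : t = 0 := by
    by_contra hc; have := aux_one_le_sq hc; omega
  subst ht
  obtain ⟨w, hw⟩ : ∃ w, w = 3*a-(b+c+d) := ⟨_, rfl⟩
  have e : 6*a-2*(b+c+d)+0 = 2*w := by omega
  rw [e] at h
  have p6 := sq_nonneg w
  have hw1 : w ≤ 1 := by nlinarith
  have hw2 : -1 ≤ w := by nlinarith
  have hb1 : b ≤ 1 := by nlinarith
  have hb2 : -1 ≤ b := by nlinarith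
  have hc1 : c ≤ 1 := by nlinarith
  have hc2 : -1 ≤ c := by nlinarith
  have hd1 : d ≤ 1 := by nlinarith
  have hd2 : -1 ≤ d := by nlinarith
  clear p1 p2 p3 p4 p5 p6 e
  interval_cases w <;> interval_cases b <;> interval_cases c <;> interval_cases d <;> omega

theorem aux_4 :
    ∃ k ≤ 4 + 1, ∃ M : Matrix (Fin k) (Fin k) ℤ,
      M.IsSymm ∧ QFPosDef M ∧ QFTight 4 M := by
  have hv : ∀ x : Fin 5 → ℤ, 2 * QFval !![18,-6,-6,-6,3; -6,4,2,2,-1; -6,2,4,2,-1;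
      -6,2,2,4,-1; 3,-1,-1,-1,5] x =
      (6*x 0-2*(x 1+x 2+x 3)+x 4)^2+4*(x 1)^2+4*(x 2)^2+4*(x 3)^2+9*(x 4)^2 := by
    intro x
    simp [QFval, Fin.sum_univ_five]
    ring
  refine ⟨5, le_rfl, !![18,-6,-6,-6,3; -6,4,2,2,-1; -6,2,4,2,-1;
      -6,2,2,4,-1; 3,-1,-1,-1,5], ?_,
    aux_final (by norm_num) _ ?_ ?_⟩
  · ext i j
    fin_cases i <;> fin_cases j <;> rfl
  · intro x hx
    by_contra hc
    apply hx
    obtain ⟨h0, h1, h2, h3, h4⟩ := aux_min4 (x 0) (x 1) (x 2) (x 3) (x 4)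
      (by rw [← hv]; push_cast at hc; omega)
    ext i
    fin_cases i <;> assumption
  · intro m hm
    obtain ⟨a, b, c, d, t, h⟩ := aux_all4 m (by exact_mod_cast hm)
    refine ⟨![a,b,c,d,t], ?_⟩
    have h2 := hv ![a,b,c,d,t]
    have h3 : 2 * m = _ := h.trans h2.symm
    omega

/-- For `n > 3`, `t(n) ≤ n + 1`: there is a tight `T(n)`-universal positive definite
integral quadratic form of rank at most `n + 1`. -/
theorem stmt_4 (n : ℕ) (hn : 3 < n) :
    ∃ k ≤ n + 1, ∃ M : Matrix (Fin k) (Fin k) ℤ,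
      M.IsSymm ∧ QFPosDef M ∧ QFTight n M := by
  have : n = 4 ∨ n = 5 ∨ 6 ≤ n := by omega
  rcases this with rfl | rfl | h
  · exact aux_4
  · exact aux_5
  · exact aux_ge6 n h
end

section
/- For any integer n greater than 3, the diagonal quadratic form Y_n = ⟨n, n, n+1, n+2, ..., 2n−1⟩ (with n+1 variables) is tight T(n)-universal; that is, the set of nonzero integers represented by n·x_0² + n·x_1² + (n+1)·x_2² + ... + (2n−1)·x_n² is exactly the set of integers ≥ n. -/
lemma bin_shift (a b : ℤ) (ha : 0 < a) : ∃ k : ℤ, 2 * (b + k * a) ≤ a ∧ -a ≤ 2 * (b + k * a) := by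
  refine ⟨-((2 * b + a) / (2 * a)), ?_⟩
  have h1 := Int.emod_add_mul_ediv (2 * b + a) (2 * a)
  have h2 := Int.emod_nonneg (2 * b + a) (show 2 * a ≠ 0 by omega)
  have h3 := Int.emod_lt_of_pos (2 * b + a) (show 0 < 2 * a by omega)
  constructor <;> nlinarith

lemma bin_red (N : ℕ) : ∀ (a b c : ℤ), a.toNat ≤ N → 0 < a → 0 < a * c - b ^ 2 →
    ∃ p q r s : ℤ, p * s - q * r = 1 ∧
      0 < a * p ^ 2 + 2 * b * p * r + c * r ^ 2 ∧
      2 * (a * p * q + b * (p * s + q * r) + c * r * s) ≤ a * p ^ 2 + 2 * b * p * r + c * r ^ 2 ∧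
      -(a * p ^ 2 + 2 * b * p * r + c * r ^ 2) ≤ 2 * (a * p * q + b * (p * s + q * r) + c * r * s) ∧
      a * p ^ 2 + 2 * b * p * r + c * r ^ 2 ≤ a * q ^ 2 + 2 * b * q * s + c * s ^ 2 := by
  induction N with
  | zero => intro a b c h1 h2; omega
  | succ N ih =>
    intro a b c h1 h2 h3
    obtain ⟨k, hk1, hk2⟩ := bin_shift a b h2
    by_cases hc : a ≤ a * k ^ 2 + 2 * b * k + c
    · refine ⟨1, k, 0, 1, by ring, by linarith, ?_, ?_, ?_⟩ <;> ring_nf at * <;> linarith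
    · push Not at hc
      have hdet : a * (a * k ^ 2 + 2 * b * k + c) - (b + k * a) ^ 2 = a * c - b ^ 2 := by ring
      have hpos : 0 < a * k ^ 2 + 2 * b * k + c := by
        by_contra hcon
        push Not at hcon
        nlinarith [sq_nonneg (b + k * a)]
      obtain ⟨p, q, r, s, e1, e2, e3, e4, e5⟩ := ih (a * k ^ 2 + 2 * b * k + c) (-(b + k * a)) a
        (by omega) hpos (by nlinarith)
      refine ⟨k * p - r, k * q - s, p, q, by linarith, ?_, ?_, ?_, ?_⟩ <;> ring_nf at * <;> linarith

def TP (a b c f g h : ℤ) : Prop :=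
  ∃ u1 u2 u3 v1 v2 v3 w1 w2 w3 : ℤ,
    (∀ x y z : ℤ, a * x ^ 2 + b * y ^ 2 + c * z ^ 2 + 2 * f * y * z + 2 * g * x * z + 2 * h * x * y
      = (u1 * x + u2 * y + u3 * z) ^ 2 + (v1 * x + v2 * y + v3 * z) ^ 2
        + 3 * (w1 * x + w2 * y + w3 * z) ^ 2) ∨
    (∀ x y z : ℤ, a * x ^ 2 + b * y ^ 2 + c * z ^ 2 + 2 * f * y * z + 2 * g * x * z + 2 * h * x * y
      = (u1 * x + u2 * y + u3 * z) ^ 2 + 2 * (v1 * x + v2 * y + v3 * z) ^ 2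
        + 2 * (v1 * x + v2 * y + v3 * z) * (w1 * x + w2 * y + w3 * z)
        + 2 * (w1 * x + w2 * y + w3 * z) ^ 2)

/-- substitution y = p y' + q z', z = r y' + s z' -/
lemma TP_yz (a b c f g h p q r s : ℤ) (hd : p * s - q * r = 1)
    (H : TP a (b * p ^ 2 + 2 * f * p * r + c * r ^ 2) (b * q ^ 2 + 2 * f * q * s + c * s ^ 2)
      (b * p * q + f * (p * s + q * r) + c * r * s) (h * q + g * s) (h * p + g * r)) :
    TP a b c f g h := by
  obtain ⟨u1, u2, u3, v1, v2, v3, w1, w2, w3, H⟩ := H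
  refine ⟨u1, u2 * s - u3 * r, u3 * p - u2 * q, v1, v2 * s - v3 * r, v3 * p - v2 * q,
    w1, w2 * s - w3 * r, w3 * p - w2 * q, ?_⟩
  have key : ∀ y z : ℤ, y = p * (s * y - q * z) + q * (p * z - r * y) ∧
      z = r * (s * y - q * z) + s * (p * z - r * y) := by
    intro y z
    constructor
    · linear_combination (-y) * hd
    · linear_combination (-z) * hd
  rcases H with H | H
  · left
    intro x y z
    have := H x (s * y - q * z) (p * z - r * y)
    obtain ⟨k1, k2⟩ := key y z
    have e : a * x ^ 2 + b * y ^ 2 + c * z ^ 2 + 2 * f * y * z + 2 * g * x * z + 2 * h * x * y =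
      a * x ^ 2 + b * (p * (s * y - q * z) + q * (p * z - r * y)) ^ 2
       + c * (r * (s * y - q * z) + s * (p * z - r * y)) ^ 2
       + 2 * f * (p * (s * y - q * z) + q * (p * z - r * y)) * (r * (s * y - q * z) + s * (p * z - r * y))
       + 2 * g * x * (r * (s * y - q * z) + s * (p * z - r * y))
       + 2 * h * x * (p * (s * y - q * z) + q * (p * z - r * y)) := by
      rw [← k1, ← k2]
    rw [e]
    linear_combination this
  · right
    intro x y z
    have := H x (s * y - q * z) (p * z - r * y)
    obtain ⟨k1, k2⟩ := key y z
    have e : a * x ^ 2 + b * y ^ 2 + c * z ^ 2 + 2 * f * y * z + 2 * g * x * z + 2 * h * x * y =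
      a * x ^ 2 + b * (p * (s * y - q * z) + q * (p * z - r * y)) ^ 2
       + c * (r * (s * y - q * z) + s * (p * z - r * y)) ^ 2
       + 2 * f * (p * (s * y - q * z) + q * (p * z - r * y)) * (r * (s * y - q * z) + s * (p * z - r * y))
       + 2 * g * x * (r * (s * y - q * z) + s * (p * z - r * y))
       + 2 * h * x * (p * (s * y - q * z) + q * (p * z - r * y)) := by
      rw [← k1, ← k2]
    rw [e]
    linear_combination this

/-- substitution x = x' + k y -/
lemma TP_shift (a b c f g h k : ℤ)
    (H : TP a (a * k ^ 2 + 2 * h * k + b) c (f + g * k) g (h + k * a)) :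
    TP a b c f g h := by
  obtain ⟨u1, u2, u3, v1, v2, v3, w1, w2, w3, H⟩ := H
  refine ⟨u1, u2 - k * u1, u3, v1, v2 - k * v1, v3, w1, w2 - k * w1, w3, ?_⟩
  rcases H with H | H
  · left
    intro x y z
    have := H (x - k * y) y z
    linear_combination this
  · right
    intro x y z
    have := H (x - k * y) y z
    linear_combination this

lemma TP_swap (a b c f g h : ℤ) (H : TP b a c g f h) : TP a b c f g h := by
  obtain ⟨u1, u2, u3, v1, v2, v3, w1, w2, w3, H⟩ := H
  refine ⟨u2, u1, u3, v2, v1, v3, w2, w1, w3, ?_⟩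
  rcases H with H | H
  · left
    intro x y z
    have := H y x z
    linear_combination this
  · right
    intro x y z
    have := H y x z
    linear_combination this

lemma tern_red_s5 (N : ℕ) : ∀ (a b c f g h : ℤ), a.toNat ≤ N → 0 < a → 0 < a * b - h ^ 2 →
    a * b * c + 2 * f * g * h - a * f ^ 2 - b * g ^ 2 - c * h ^ 2 = 3 → TP a b c f g h := by
  induction N with
  | zero => intro a b c f g h h1 h2; omega
  | succ N ih =>
    intro a b c f g h h1 ha hα hD
    have hG : (a * b - h ^ 2) * (a * c - g ^ 2) - (a * f - h * g) ^ 2 = 3 * a := by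
      linear_combination a * hD
    obtain ⟨p, q, r, s, e1, e2, e3, e4, e5⟩ := bin_red (a * b - h ^ 2).toNat (a * b - h ^ 2)
      (a * f - h * g) (a * c - g ^ 2) le_rfl hα (by linarith)
    apply TP_yz a b c f g h p q r s e1
    -- rename the coefficients
    obtain ⟨b', hb'⟩ : ∃ t, t = b * p ^ 2 + 2 * f * p * r + c * r ^ 2 := ⟨_, rfl⟩
    obtain ⟨c', hc'⟩ : ∃ t, t = b * q ^ 2 + 2 * f * q * s + c * s ^ 2 := ⟨_, rfl⟩
    obtain ⟨f', hf'⟩ : ∃ t, t = b * p * q + f * (p * s + q * r) + c * r * s := ⟨_, rfl⟩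
    obtain ⟨g', hg'⟩ : ∃ t, t = h * q + g * s := ⟨_, rfl⟩
    obtain ⟨h', hh'⟩ : ∃ t, t = h * p + g * r := ⟨_, rfl⟩
    rw [← hb', ← hc', ← hf', ← hg', ← hh']
    have i1 : (a * b - h ^ 2) * p ^ 2 + 2 * (a * f - h * g) * p * r + (a * c - g ^ 2) * r ^ 2
        = a * b' - h' ^ 2 := by rw [hb', hh']; ring
    have i2 : (a * b - h ^ 2) * q ^ 2 + 2 * (a * f - h * g) * q * s + (a * c - g ^ 2) * s ^ 2
        = a * c' - g' ^ 2 := by rw [hc', hg']; ring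
    have i3 : (a * b - h ^ 2) * p * q + (a * f - h * g) * (p * s + q * r) + (a * c - g ^ 2) * r * s
        = a * f' - h' * g' := by rw [hf', hh', hg']; ring
    have hD' : a * b' * c' + 2 * f' * g' * h' - a * f' ^ 2 - b' * g' ^ 2 - c' * h' ^ 2 = 3 := by
      have : a * b' * c' + 2 * f' * g' * h' - a * f' ^ 2 - b' * g' ^ 2 - c' * h' ^ 2 =
        (a * b * c + 2 * f * g * h - a * f ^ 2 - b * g ^ 2 - c * h ^ 2) * (p * s - q * r) ^ 2 := by
        rw [hf', hh', hg', hb', hc']; ring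
      rw [this, hD, e1]; norm_num
    rw [i1] at e2 e3 e4 e5
    rw [i3] at e3 e4
    rw [i2] at e5
    clear hb' hc' hf' hg' hh' i1 i2 i3 hG hD hα e1
    clear b c f g h p q r s
    rename' b' => b, c' => c, f' => f, g' => g, h' => h
    have hG : (a * b - h ^ 2) * (a * c - g ^ 2) - (a * f - h * g) ^ 2 = 3 * a := by
      linear_combination a * hD'
    have hα : (a * b - h ^ 2) ^ 2 ≤ 4 * a := by
      have : 4 * (a * f - h * g) ^ 2 ≤ (a * b - h ^ 2) ^ 2 := by nlinarith
      nlinarith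
    obtain ⟨k, hk1, hk2⟩ := bin_shift a h ha
    by_cases hba : a * k ^ 2 + 2 * h * k + b < a
    · apply TP_shift a b c f g h k
      apply TP_swap
      have hab : a * (a * k ^ 2 + 2 * h * k + b) - (h + k * a) ^ 2 = a * b - h ^ 2 := by ring
      have hpos : 0 < a * k ^ 2 + 2 * h * k + b := by
        by_contra hcon
        push Not at hcon
        nlinarith [sq_nonneg (h + k * a)]
      apply ih
      · omega
      · exact hpos
      · linarith
      · linear_combination hD'
    · push Not at hba
      have hab : a * (a * k ^ 2 + 2 * h * k + b) - (h + k * a) ^ 2 = a * b - h ^ 2 := by ring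
      have h4 : 4 * (h + k * a) ^ 2 ≤ a ^ 2 := by nlinarith
      have h5 : 3 * a ^ 2 ≤ 4 * (a * b - h ^ 2) := by nlinarith
      have ha1 : a = 1 := by
        by_contra hne
        have h2 : 2 ≤ a := by omega
        have h6 : (3 * a ^ 2) ^ 2 ≤ (4 * (a * b - h ^ 2)) ^ 2 :=
          pow_le_pow_left₀ (by positivity) h5 2
        have h7 : 9 * a ^ 4 ≤ 64 * a := by nlinarith
        have h8 : 8 * a ≤ a ^ 4 := by
          have : 2 ^ 3 ≤ a ^ 3 := pow_le_pow_left₀ (by norm_num) h2 3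
          nlinarith
        nlinarith
      subst ha1
      obtain ⟨α, hα'⟩ : ∃ t, t = 1 * b - h ^ 2 := ⟨_, rfl⟩
      obtain ⟨β, hβ'⟩ : ∃ t, t = 1 * f - h * g := ⟨_, rfl⟩
      obtain ⟨γ, hγ'⟩ : ∃ t, t = 1 * c - g ^ 2 := ⟨_, rfl⟩
      rw [← hα'] at e2 e3 e4 e5 hα hG
      rw [← hβ'] at e3 e4 hG
      rw [← hγ'] at e5 hG
      have hb : b = α + h ^ 2 := by linarith
      have hc : c = γ + g ^ 2 := by linarith
      have hf : f = β + h * g := by linarith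
      have hα2 : α ≤ 2 := by nlinarith
      have : α = 1 ∨ α = 2 := by omega
      rcases this with rfl | rfl
      · have hβ : β = 0 := by omega
        subst hβ
        have hγ : γ = 3 := by linarith
        subst hγ
        refine ⟨1, h, g, 0, 1, 0, 0, 0, 1, Or.inl ?_⟩
        intro x y z; rw [hb, hc, hf]; ring
      · have : β = 0 ∨ β = 1 ∨ β = -1 := by omega
        rcases this with rfl | rfl | rfl
        · omega
        · have hγ : γ = 2 := by linarith
          subst hγ
          refine ⟨1, h, g, 0, 1, 0, 0, 0, 1, Or.inr ?_⟩
          intro x y z; rw [hb, hc, hf]; ring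
        · have hγ : γ = 2 := by linarith
          subst hγ
          refine ⟨1, h, g, 0, 1, 0, 0, 0, -1, Or.inr ?_⟩
          intro x y z; rw [hb, hc, hf]; ring

lemma prime_sq (M : ℕ) (hM : M % 3 ≠ 0) : ∃ e p : ℕ, e % 12 = 1 ∧ p + 3 = 4 * e * M ∧
    0 < p ∧ ∃ h a : ℤ, h ^ 2 + 4 * e = a * p := by
  have hM0 : 0 < M := by omega
  have hcop : Nat.Coprime (4 * M - 3) (48 * M) := by
    have h1 : Nat.Coprime (4 * M - 3) 2 := by
      rw [Nat.coprime_two_right]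
      exact Nat.odd_iff.mpr (by omega)
    have h3 : Nat.Coprime (4 * M - 3) 3 := by
      rw [Nat.coprime_comm, Nat.Prime.coprime_iff_not_dvd Nat.prime_three]
      omega
    have hMc : Nat.Coprime (4 * M - 3) M := by
      have h3M : Nat.Coprime 3 M := by
        rw [Nat.Prime.coprime_iff_not_dvd Nat.prime_three]; omega
      have hd : (4 * M - 3).gcd M ∣ 3 := by
        have d1 := Nat.gcd_dvd_left (4 * M - 3) M
        have d2 := Nat.gcd_dvd_right (4 * M - 3) M
        have := Nat.dvd_sub (Dvd.dvd.mul_left d2 4) d1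
        have e : 4 * M - (4 * M - 3) = 3 := by omega
        rwa [e] at this
      have := Nat.dvd_gcd hd (Nat.gcd_dvd_right (4 * M - 3) M)
      rw [h3M] at this
      exact Nat.dvd_one.mp this
    have : 48 * M = 2 ^ 4 * 3 * M := by ring
    rw [this]
    exact Nat.Coprime.mul_right (Nat.Coprime.mul_right (h1.pow_right 4) h3) hMc
  have : NeZero (48 * M) := ⟨by omega⟩
  obtain ⟨p, hp1, hp, hp2⟩ := Nat.forall_exists_prime_gt_and_eq_mod
    ((ZMod.isUnit_iff_coprime (4 * M - 3) (48 * M)).mpr hcop) (48 * M + 4 * M)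
  rw [ZMod.natCast_eq_natCast_iff] at hp2
  have hdvd := (Nat.modEq_iff_dvd' (by omega)).mp hp2.symm
  obtain ⟨f, hf⟩ := hdvd
  have hpf : p + 3 = 4 * (12 * f + 1) * M := by
    have : p = 48 * M * f + (4 * M - 3) := by omega
    have h2 : 4 * (12 * f + 1) * M = 48 * M * f + 4 * M := by ring
    omega
  refine ⟨12 * f + 1, p, by omega, hpf, hp.pos, ?_⟩
  have : Fact p.Prime := ⟨hp⟩
  have hp4 : p % 4 = 1 := by
    have : p + 3 = 4 * ((12 * f + 1) * M) := by rw [hpf]; ring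
    omega
  set e := 12 * f + 1 with he
  have heodd : Odd e := Nat.odd_iff.mpr (by omega)
  have j1 : jacobiSym (e : ℤ) p = 1 := by
    rw [jacobiSym.quadratic_reciprocity_one_mod_four' heodd hp4]
    have : jacobiSym (p : ℤ) e = jacobiSym (-1 * 3) e := by
      rw [jacobiSym.mod_left, jacobiSym.mod_left (-1 * 3)]
      congr 1
      apply Int.ModEq.symm
      rw [Int.modEq_iff_dvd]
      refine ⟨4 * M, ?_⟩
      have : (p : ℤ) + 3 = 4 * e * M := by exact_mod_cast hpf
      linarith
    rw [this, jacobiSym.mul_left, jacobiSym.at_neg_one heodd,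
      ZMod.χ₄_nat_one_mod_four (by omega)]
    have h3 : jacobiSym (3 : ℤ) e = jacobiSym (e : ℤ) 3 :=
      jacobiSym.quadratic_reciprocity_one_mod_four' (a := 3) (by decide) (by omega)
    rw [h3, jacobiSym.mod_left]
    have : (e : ℤ) % ((3 : ℕ) : ℤ) = 1 := by push_cast; omega
    rw [this]
    simp
  have j2 : legendreSym p (-1 * (2 * 2) * e) = 1 := by
    rw [jacobiSym.legendreSym.to_jacobiSym, jacobiSym.mul_left, jacobiSym.mul_left, j1,
      jacobiSym.at_neg_one (Nat.odd_iff.mpr (by omega)), ZMod.χ₄_nat_one_mod_four hp4,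
      jacobiSym.mul_left, ← sq, jacobiSym.sq_one]
    · norm_num
    · have : Nat.Coprime 2 p := by
        rw [Nat.coprime_two_left]; exact Nat.odd_iff.mpr (by omega)
      simpa [Int.gcd] using this
  have hne : ((-1 * (2 * 2) * e : ℤ) : ZMod p) ≠ 0 := by
    intro h0
    rw [(legendreSym.eq_zero_iff p _).mpr h0] at j2
    norm_num at j2
  obtain ⟨t, ht⟩ := (legendreSym.eq_one_iff p hne).mp j2
  obtain ⟨h, rfl⟩ := ZMod.intCast_surjective t
  have : (p : ℤ) ∣ h ^ 2 + 4 * e := by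
    rw [← ZMod.intCast_zmod_eq_zero_iff_dvd] <;> try infer_instance
    push_cast at ht ⊢
    linear_combination -ht
  obtain ⟨a, ha⟩ := this
  exact ⟨h, a, by linarith⟩

lemma rep113 (M : ℕ) (hM : M % 3 ≠ 0) : ∃ x y z : ℤ, x ^ 2 + y ^ 2 + 3 * z ^ 2 = M := by
  obtain ⟨e, p, he, hp, hp0, h, a, ha⟩ := prime_sq M hM
  have hpz : (p : ℤ) + 3 = 4 * e * M := by exact_mod_cast hp
  have hp0' : (0 : ℤ) < p := by exact_mod_cast hp0
  have he0 : (0 : ℤ) < e := by omega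
  have ha0 : 0 < a := by
    by_contra hc
    push Not at hc
    nlinarith [sq_nonneg h]
  have := tern_red_s5 a.toNat a p M 0 1 h le_rfl ha0 (by linarith)
    (by linear_combination (-(M : ℤ)) * ha - hpz)
  obtain ⟨u1, u2, u3, v1, v2, v3, w1, w2, w3, H | H⟩ := this
  · refine ⟨u3, v3, w3, ?_⟩
    have := H 0 0 1
    linear_combination -this
  · exfalso
    have h1 := H 1 0 0
    have h2 := H 0 1 0
    have h3 := H 1 1 0
    have ea : a = u1 ^ 2 + 2 * v1 ^ 2 + 2 * v1 * w1 + 2 * w1 ^ 2 := by linear_combination h1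
    have eb : (p : ℤ) = u2 ^ 2 + 2 * v2 ^ 2 + 2 * v2 * w2 + 2 * w2 ^ 2 := by linear_combination h2
    have eh : h = u1 * u2 + 2 * v1 * v2 + v1 * w2 + v2 * w1 + 2 * w1 * w2 := by
      have : 2 * h = 2 * (u1 * u2 + 2 * v1 * v2 + v1 * w2 + v2 * w1 + 2 * w1 * w2) := by
        linear_combination h3 - h1 - h2
      linarith
    have hd : 4 * (e : ℤ) = 3 * ((v1 * w2 - v2 * w1) ^ 2
        - 2 * (w1 * u2 - w2 * u1) * (u1 * v2 - u2 * v1))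
        + 2 * (((w1 * u2 - w2 * u1) + (u1 * v2 - u2 * v1)) ^ 2) := by
      have : 4 * (e : ℤ) = a * p - h ^ 2 := by linarith
      rw [this, ea, eb, eh]; ring
    generalize (w1 * u2 - w2 * u1) + (u1 * v2 - u2 * v1) = T at hd
    generalize (v1 * w2 - v2 * w1) ^ 2 - 2 * (w1 * u2 - w2 * u1) * (u1 * v2 - u2 * v1) = R at hd
    have hT : T ^ 2 % 3 = 0 ∨ T ^ 2 % 3 = 1 := by
      have : T % 3 = 0 ∨ T % 3 = 1 ∨ T % 3 = 2 := by omega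
      rcases this with h | h | h <;> simp [pow_two, Int.mul_emod, h]
    omega

lemma rep113Z (M : ℤ) (h0 : 0 ≤ M) (hM : M % 3 ≠ 0) :
    ∃ x y z : ℤ, x ^ 2 + y ^ 2 + 3 * z ^ 2 = M := by
  obtain ⟨x, y, z, h⟩ := rep113 M.toNat (by omega)
  exact ⟨x, y, z, by rw [h]; omega⟩

lemma rep1133 (N : ℕ) : ∃ x y z w : ℤ, x ^ 2 + y ^ 2 + 3 * z ^ 2 + 3 * w ^ 2 = N := by
  induction N using Nat.strong_induction_on with
  | _ N ih =>
    by_cases h0 : N = 0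
    · exact ⟨0, 0, 0, 0, by simp [h0]⟩
    by_cases h3 : N % 3 = 0
    · obtain ⟨x, y, z, w, h⟩ := ih (N / 3) (by omega)
      refine ⟨3 * z, 3 * w, x, y, ?_⟩
      have : (N : ℤ) = 3 * ((N / 3 : ℕ) : ℤ) := by omega
      rw [this, ← h]; ring
    · obtain ⟨x, y, z, h⟩ := rep113 N h3
      exact ⟨x, y, z, 0, by rw [← h]; ring⟩

lemma rep1133Z (M : ℤ) (h0 : 0 ≤ M) :
    ∃ x y z w : ℤ, x ^ 2 + y ^ 2 + 3 * z ^ 2 + 3 * w ^ 2 = M := by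
  obtain ⟨x, y, z, w, h⟩ := rep1133 M.toNat
  exact ⟨x, y, z, w, by rw [h]; omega⟩

lemma rep223 (M : ℤ) (h0 : 0 ≤ M) (hM : M % 3 ≠ 0) (h4 : M % 4 = 2 ∨ M % 4 = 3) :
    ∃ x y z : ℤ, 4 * x ^ 2 + 4 * y ^ 2 + 6 * z ^ 2 = 2 * M := by
  obtain ⟨a, b, c, h⟩ := rep113Z M h0 hM
  have sq4 : ∀ t : ℤ, (t % 2 = 0 ∧ t ^ 2 % 4 = 0) ∨ (t % 2 = 1 ∧ t ^ 2 % 4 = 1) := by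
    intro t
    rcases Int.even_or_odd' t with ⟨k, rfl | rfl⟩
    · left; constructor
      · omega
      · ring_nf; omega
    · right; constructor
      · omega
      · ring_nf; omega
  have hab : (a + b) % 2 = 0 := by
    have := sq4 a
    have := sq4 b
    have := sq4 c
    omega
  obtain ⟨x, hx⟩ : ∃ x, a + b = 2 * x := ⟨(a + b) / 2, by omega⟩
  refine ⟨x, a - x, c, ?_⟩
  have hb : b = 2 * x - a := by linarith
  subst hb
  linear_combination 2 * h

lemma list_rep (c : ℕ → ℤ) (N : ℕ) (l : List (ℕ × ℤ)) (hl : ∀ q ∈ l, q.1 < N)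
    (hnd : (l.map Prod.fst).Nodup) :
    ∃ x : Fin N → ℤ, (∀ i : Fin N, (i : ℕ) ∉ l.map Prod.fst → x i = 0) ∧
      ∑ i : Fin N, c i * (x i) ^ 2 = (l.map (fun q => c q.1 * q.2 ^ 2)).sum := by
  induction l with
  | nil => exact ⟨fun _ => 0, by simp, by simp⟩
  | cons q l ih =>
    rw [List.map_cons, List.nodup_cons] at hnd
    obtain ⟨x, hx0, hx⟩ := ih (fun q' hq' => hl q' (List.mem_cons_of_mem _ hq')) hnd.2
    have hq := hl q List.mem_cons_self
    refine ⟨Function.update x ⟨q.1, hq⟩ q.2, ?_, ?_⟩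
    · intro i hi
      simp only [List.map_cons, List.mem_cons, not_or] at hi
      rw [Function.update_of_ne, hx0 i hi.2]
      intro h; exact hi.1 (by rw [h])
    · rw [List.map_cons, List.sum_cons, ← hx,
        ← Finset.add_sum_erase _ _ (Finset.mem_univ (⟨q.1, hq⟩ : Fin N)),
        ← Finset.add_sum_erase (a := (⟨q.1, hq⟩ : Fin N)) Finset.univ (fun i : Fin N => c i * x i ^ 2)
          (Finset.mem_univ _)]
      have h0 : x ⟨q.1, hq⟩ = 0 := hx0 _ hnd.1
      have : ∑ i ∈ Finset.univ.erase (⟨q.1, hq⟩ : Fin N),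
          c i * Function.update x ⟨q.1, hq⟩ q.2 i ^ 2 =
          ∑ i ∈ Finset.univ.erase (⟨q.1, hq⟩ : Fin N), c i * x i ^ 2 := by
        apply Finset.sum_congr rfl
        intro i hi
        rw [Function.update_of_ne (Finset.ne_of_mem_erase hi)]
      rw [this, h0]
      simp

def RepY (n : ℕ) (m : ℤ) : Prop :=
  ∃ x : Fin (n + 1) → ℤ,
    ∑ i : Fin (n + 1), (if (i : ℕ) = 0 then (n : ℤ) else (n : ℤ) + (i : ℕ) - 1) * (x i) ^ 2 = m

lemma RepY_list (n : ℕ) (m : ℤ) (l : List (ℕ × ℤ)) (hl : ∀ q ∈ l, q.1 < n + 1)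
    (hnd : (l.map Prod.fst).Nodup)
    (hs : (l.map (fun q => (if q.1 = 0 then (n : ℤ) else (n : ℤ) + (q.1 : ℕ) - 1) * q.2 ^ 2)).sum = m) :
    RepY n m := by
  obtain ⟨x, -, hx⟩ := list_rep (fun i => if i = 0 then (n : ℤ) else (n : ℤ) + (i : ℕ) - 1) (n + 1) l hl hnd
  exact ⟨x, by rw [← hs, ← hx]⟩

/-- a single coefficient n+j -/
lemma RepY_one (n j : ℕ) (hj : j < n) : RepY n (n + j) := by
  apply RepY_list n _ [(j + 1, 1)]
  · simp; omega
  · simp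
  · simp; ring

lemma RepY_n_add (n j : ℕ) (hj : j < n) : RepY n (n + (n + j)) := by
  apply RepY_list n _ [(0, 1), (j + 1, 1)]
  · simp; omega
  · simp
  · simp; ring

/-- universal part plus two further coefficients n+i, n+j, with values s, t -/
lemma RepY_gen (n i j : ℕ) (s t : ℤ) (hn : 9 ≤ n) (hi : 3 ≤ i) (hij : i < j) (hj : j ≤ n - 3)
    (M : ℤ) (hM : 0 ≤ M) : RepY n (n * M + (n + i) * s ^ 2 + (n + j) * t ^ 2) := by
  obtain ⟨x, y, z, w, h⟩ := rep1133Z M hM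
  apply RepY_list n _ [(0, x), (1, y), (2, z), (n, z), (3, w), (n - 1, w), (i + 1, s), (j + 1, t)]
  · simp; omega
  · simp; omega
  · have h1 : n ≠ 0 := by omega
    have h2 : n - 1 ≠ 0 := by omega
    have h3 : ((n - 1 : ℕ) : ℤ) = n - 1 := by omega
    simp [h1, h2, h3, ← h]
    ring

lemma RepY_large (n : ℕ) (hn : 9 ≤ n) (m : ℤ) (hm : (n : ℤ) ≤ m) : RepY n m := by
  obtain ⟨m, rfl⟩ := Int.eq_ofNat_of_zero_le (show 0 ≤ m by omega)
  have hm : n ≤ m := by exact_mod_cast hm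
  have hdm := Nat.div_add_mod m n
  have hr := Nat.mod_lt m (show 0 < n by omega)
  obtain ⟨q, hq⟩ : ∃ q, q = m / n := ⟨_, rfl⟩
  obtain ⟨r, hr'⟩ : ∃ r, r = m % n := ⟨_, rfl⟩
  rw [← hq, ← hr'] at hdm
  rw [← hr'] at hr
  have hq1 : 1 ≤ q := by
    by_contra hc
    have : q = 0 := by omega
    subst this; omega
  have hmz : (m : ℤ) = n * q + r := by exact_mod_cast hdm.symm
  have gen : ∀ (i j : ℕ) (s t M : ℤ), 3 ≤ i → i < j → j ≤ n - 3 → 0 ≤ M →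
      (m : ℤ) = n * M + (n + i) * s ^ 2 + (n + j) * t ^ 2 → RepY n m := by
    intro i j s t M h1 h2 h3 h4 h5
    rw [h5]
    exact RepY_gen n i j s t hn h1 h2 h3 M h4
  -- the cases q = 1, 2
  by_cases hq2 : q = 1
  · subst hq2
    have := RepY_one n r hr
    rwa [show (n : ℤ) + r = m by rw [hmz]; push_cast; ring] at this
  by_cases hq3 : q = 2
  · subst hq3
    have := RepY_n_add n r hr
    rwa [show (n : ℤ) + (n + r) = m by rw [hmz]; push_cast; ring] at this
  have hq4 : 3 ≤ q := by omega
  by_cases hr0 : r = 0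
  · exact gen 3 4 0 0 q (by omega) (by omega) (by omega) (by omega) (by rw [hmz, hr0]; push_cast; ring)
  by_cases hr1 : r = 1
  · refine gen 4 (n - 3) 1 1 (q - 3) (by omega) (by omega) (by omega) (by omega) ?_
    rw [hmz, hr1, show ((n - 3 : ℕ) : ℤ) = n - 3 by omega]; push_cast; ring
  by_cases hr2 : r = 2
  · refine gen 5 (n - 3) 1 1 (q - 3) (by omega) (by omega) (by omega) (by omega) ?_
    rw [hmz, hr2, show ((n - 3 : ℕ) : ℤ) = n - 3 by omega]; push_cast; ring
  by_cases hrn1 : r = n - 1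
  · refine gen 3 (n - 4) 1 1 (q - 2) (by omega) (by omega) (by omega) (by omega) ?_
    rw [hmz, hrn1, show ((n - 4 : ℕ) : ℤ) = n - 4 by omega,
      show ((n - 1 : ℕ) : ℤ) = n - 1 by omega]; push_cast; ring
  by_cases hrn2 : r = n - 2
  · refine gen 3 (n - 5) 1 1 (q - 2) (by omega) (by omega) (by omega) (by omega) ?_
    rw [hmz, hrn2, show ((n - 5 : ℕ) : ℤ) = n - 5 by omega,
      show ((n - 2 : ℕ) : ℤ) = n - 2 by omega]; push_cast; ring
  by_cases hr3 : r = 3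
  · refine gen 3 4 1 0 (q - 1) (by omega) (by omega) (by omega) (by omega) ?_
    rw [hmz, hr3]; push_cast; ring
  · refine gen 3 r 0 1 (q - 1) (by omega) (by omega) (by omega) (by omega) ?_
    rw [hmz]; ring

lemma RepY8 (m : ℤ) (hm : 8 ≤ m) : RepY 8 m := by
  have A : ∀ (M a b c : ℤ), 0 ≤ M → m = 8 * M + 11 * a ^ 2 + 12 * b ^ 2 + 13 * c ^ 2 → RepY 8 m := by
    intro M a b c hM h
    obtain ⟨x, y, z, w, hx⟩ := rep1133Z M hM
    refine ⟨![x, y, z, w, a, b, c, w, z], ?_⟩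
    simp [Fin.sum_univ_succ]
    rw [h, ← hx]; ring
  have B : ∀ (M a b : ℤ), 0 ≤ M → m = 8 * M + 10 * a ^ 2 + 14 * b ^ 2 → RepY 8 m := by
    intro M a b hM h
    obtain ⟨x, y, z, w, hx⟩ := rep1133Z M hM
    refine ⟨![x, y, z, a, w, 0, w, b, z], ?_⟩
    simp [Fin.sum_univ_succ]
    rw [h, ← hx]; ring
  by_cases h9 : m = 9
  · subst h9; exact RepY_one 8 1 (by omega)
  by_cases h15 : m = 15
  · subst h15; exact RepY_one 8 7 (by omega)
  by_cases h17 : m = 17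
  · subst h17; exact RepY_n_add 8 1 (by omega)
  have : m % 8 = 0 ∨ m % 8 = 1 ∨ m % 8 = 2 ∨ m % 8 = 3 ∨ m % 8 = 4 ∨ m % 8 = 5 ∨ m % 8 = 6 ∨ m % 8 = 7 := by
    omega
  rcases this with h | h | h | h | h | h | h | h
  · exact A (m / 8) 0 0 0 (by omega) (by omega)
  · exact A ((m - 25) / 8) 0 1 1 (by omega) (by omega)
  · exact B ((m - 10) / 8) 1 0 (by omega) (by omega)
  · exact A ((m - 11) / 8) 1 0 0 (by omega) (by omega)
  · exact A ((m - 12) / 8) 0 1 0 (by omega) (by omega)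
  · exact A ((m - 13) / 8) 0 0 1 (by omega) (by omega)
  · exact B ((m - 14) / 8) 0 1 (by omega) (by omega)
  · exact A ((m - 23) / 8) 1 1 0 (by omega) (by omega)

lemma RepY7 (m : ℤ) (hm : 7 ≤ m) : RepY 7 m := by
  have A : ∀ (M a b : ℤ), 0 ≤ M → m = 7 * M + 8 * a ^ 2 + 13 * b ^ 2 → RepY 7 m := by
    intro M a b hM h
    obtain ⟨x, y, z, w, hx⟩ := rep1133Z M hM
    refine ⟨![x, y, a, z, w, w, z, b], ?_⟩
    simp [Fin.sum_univ_succ]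
    rw [h, ← hx]; ring
  have B : ∀ (M a b : ℤ), 0 ≤ M → m = 7 * M + 9 * a ^ 2 + 12 * b ^ 2 → RepY 7 m := by
    intro M a b hM h
    obtain ⟨x, y, z, w, hx⟩ := rep1133Z M hM
    refine ⟨![x, y, z, a, w, w, b, z], ?_⟩
    simp [Fin.sum_univ_succ]
    rw [h, ← hx]; ring
  have C : ∀ (M a b : ℤ), 0 ≤ M → m = 7 * M + 10 * a ^ 2 + 11 * b ^ 2 → RepY 7 m := by
    intro M a b hM h
    obtain ⟨x, y, z, w, hx⟩ := rep1133Z M hM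
    refine ⟨![x, y, z, w, a, b, w, z], ?_⟩
    simp [Fin.sum_univ_succ]
    rw [h, ← hx]; ring
  have : m % 7 = 0 ∨ m % 7 = 1 ∨ m % 7 = 2 ∨ m % 7 = 3 ∨ m % 7 = 4 ∨ m % 7 = 5 ∨ m % 7 = 6 := by
    omega
  rcases this with h | h | h | h | h | h | h
  · exact A (m / 7) 0 0 (by omega) (by omega)
  · exact A ((m - 8) / 7) 1 0 (by omega) (by omega)
  · exact B ((m - 9) / 7) 1 0 (by omega) (by omega)
  · exact C ((m - 10) / 7) 1 0 (by omega) (by omega)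
  · exact C ((m - 11) / 7) 0 1 (by omega) (by omega)
  · exact B ((m - 12) / 7) 0 1 (by omega) (by omega)
  · exact A ((m - 13) / 7) 0 1 (by omega) (by omega)

lemma small4 : ∀ m < 83, 4 ≤ m → ∃ x < 2, ∃ y < 3, ∃ z < 3, ∃ w < 4, ∃ t < 3,
    4 * x ^ 2 + 4 * y ^ 2 + 5 * z ^ 2 + 6 * w ^ 2 + 7 * t ^ 2 = m := by
  decide +kernel

lemma small5 : ∀ m < 79, 5 ≤ m → ∃ x < 3, ∃ y < 3, ∃ z < 3, ∃ w < 3, ∃ t < 3, ∃ u < 3,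
    5 * x ^ 2 + 5 * y ^ 2 + 6 * z ^ 2 + 7 * w ^ 2 + 8 * t ^ 2 + 9 * u ^ 2 = m := by
  decide +kernel

lemma small6 : ∀ m < 53, 6 ≤ m → ∃ x < 2, ∃ y < 2, ∃ z < 2, ∃ w < 2, ∃ t < 2, ∃ u < 2, ∃ v < 3,
    6 * x ^ 2 + 6 * y ^ 2 + 7 * z ^ 2 + 8 * w ^ 2 + 9 * t ^ 2 + 10 * u ^ 2 + 11 * v ^ 2 = m := by
  decide +kernel

lemma RepY6 (m : ℤ) (hm : 6 ≤ m) : RepY 6 m := by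
  by_cases hs : m < 53
  · obtain ⟨x, -, y, -, z, -, w, -, t, -, u, -, v, -, h⟩ := small6 m.toNat (by omega) (by omega)
    refine ⟨![x, y, z, w, t, u, v], ?_⟩
    have h' : (6 * x ^ 2 + 6 * y ^ 2 + 7 * z ^ 2 + 8 * w ^ 2 + 9 * t ^ 2 + 10 * u ^ 2
      + 11 * v ^ 2 : ℤ) = m := by
      have : ((m.toNat : ℕ) : ℤ) = m := by omega
      rw [← this, ← h]; push_cast; ring
    simp [Fin.sum_univ_succ]
    linarith
  have U : ∀ (M a : ℤ), 0 ≤ M → m = 6 * M + 9 * a ^ 2 → RepY 6 m := by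
    intro M a hM h
    obtain ⟨x, y, z, w, hx⟩ := rep1133Z M hM
    refine ⟨![x, y, z, w, a, w, z], ?_⟩
    simp [Fin.sum_univ_succ]
    rw [h, ← hx]; ring
  have A : ∀ (M a b c : ℤ), 0 ≤ M → M % 3 ≠ 0 → m = 6 * M + 7 * a ^ 2 + 9 * b ^ 2 + 11 * c ^ 2 →
      RepY 6 m := by
    intro M a b c hM hM3 h
    obtain ⟨x, y, z, hx⟩ := rep113Z M hM hM3
    refine ⟨![x, y, a, z, b, z, c], ?_⟩
    simp [Fin.sum_univ_succ]
    rw [h, ← hx]; ring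
  have B : ∀ (M a b : ℤ), 0 ≤ M → M % 3 ≠ 0 → m = 6 * M + 8 * a ^ 2 + 10 * b ^ 2 →
      RepY 6 m := by
    intro M a b hM hM3 h
    obtain ⟨x, y, z, hx⟩ := rep113Z M hM hM3
    refine ⟨![x, y, z, a, 0, b, z], ?_⟩
    simp [Fin.sum_univ_succ]
    rw [h, ← hx]; ring
  have : m % 6 = 0 ∨ m % 6 = 1 ∨ m % 6 = 2 ∨ m % 6 = 3 ∨ m % 6 = 4 ∨ m % 6 = 5 := by
    omega
  rcases this with h | h | h | h | h | h
  · exact U (m / 6) 0 (by omega) (by omega)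
  · by_cases h3 : ((m - 7) / 6) % 3 = 0
    · exact A ((m - 37) / 6) 2 1 0 (by omega) (by omega) (by omega)
    · exact A ((m - 7) / 6) 1 0 0 (by omega) (by omega) (by omega)
  · by_cases h3 : ((m - 8) / 6) % 3 = 0
    · exact B ((m - 32) / 6) 2 0 (by omega) (by omega) (by omega)
    · exact B ((m - 8) / 6) 1 0 (by omega) (by omega) (by omega)
  · exact U ((m - 9) / 6) 1 (by omega) (by omega)
  · by_cases h3 : ((m - 10) / 6) % 3 = 0
    · exact B ((m - 40) / 6) 0 2 (by omega) (by omega) (by omega)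
    · exact B ((m - 10) / 6) 0 1 (by omega) (by omega) (by omega)
  · by_cases h3 : ((m - 11) / 6) % 3 = 0
    · exact A ((m - 53) / 6) 0 1 2 (by omega) (by omega) (by omega)
    · exact A ((m - 11) / 6) 0 0 1 (by omega) (by omega) (by omega)

lemma RepY5 (m : ℤ) (hm : 5 ≤ m) : RepY 5 m := by
  by_cases hs : m < 79
  · obtain ⟨x, -, y, -, z, -, w, -, t, -, u, -, h⟩ := small5 m.toNat (by omega) (by omega)
    refine ⟨![x, y, z, w, t, u], ?_⟩
    have h' : (5 * x ^ 2 + 5 * y ^ 2 + 6 * z ^ 2 + 7 * w ^ 2 + 8 * t ^ 2 + 9 * u ^ 2 : ℤ) = m := by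
      have : ((m.toNat : ℕ) : ℤ) = m := by omega
      rw [← this, ← h]; push_cast; ring
    simp [Fin.sum_univ_succ]
    linarith
  have U : ∀ (M : ℤ), 0 ≤ M → m = 5 * M → RepY 5 m := by
    intro M hM h
    obtain ⟨x, y, z, w, hx⟩ := rep1133Z M hM
    refine ⟨![x, y, z, w, w, z], ?_⟩
    simp [Fin.sum_univ_succ]
    rw [h, ← hx]; ring
  have A : ∀ (M a b : ℤ), 0 ≤ M → M % 3 ≠ 0 → m = 5 * M + 7 * a ^ 2 + 8 * b ^ 2 →
      RepY 5 m := by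
    intro M a b hM hM3 h
    obtain ⟨x, y, z, hx⟩ := rep113Z M hM hM3
    refine ⟨![x, y, z, a, b, z], ?_⟩
    simp [Fin.sum_univ_succ]
    rw [h, ← hx]; ring
  have : m % 5 = 0 ∨ m % 5 = 1 ∨ m % 5 = 2 ∨ m % 5 = 3 ∨ m % 5 = 4 := by
    omega
  rcases this with h | h | h | h | h
  · exact U (m / 5) (by omega) (by omega)
  · by_cases h3 : ((m - 36) / 5) % 3 = 0
    · exact A ((m - 71) / 5) 3 1 (by omega) (by omega) (by omega)
    · exact A ((m - 36) / 5) 2 1 (by omega) (by omega) (by omega)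
  · by_cases h3 : ((m - 7) / 5) % 3 = 0
    · exact A ((m - 32) / 5) 0 2 (by omega) (by omega) (by omega)
    · exact A ((m - 7) / 5) 1 0 (by omega) (by omega) (by omega)
  · by_cases h3 : ((m - 8) / 5) % 3 = 0
    · exact A ((m - 28) / 5) 2 0 (by omega) (by omega) (by omega)
    · exact A ((m - 8) / 5) 0 1 (by omega) (by omega) (by omega)
  · by_cases h3 : ((m - 39) / 5) % 3 = 0
    · exact A ((m - 79) / 5) 1 3 (by omega) (by omega) (by omega)
    · exact A ((m - 39) / 5) 1 2 (by omega) (by omega) (by omega)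

lemma RepY4 (m : ℤ) (hm : 4 ≤ m) : RepY 4 m := by
  by_cases hs : m < 83
  · obtain ⟨x, -, y, -, z, -, w, -, t, -, h⟩ := small4 m.toNat (by omega) (by omega)
    refine ⟨![x, y, z, w, t], ?_⟩
    have h' : (4 * x ^ 2 + 4 * y ^ 2 + 5 * z ^ 2 + 6 * w ^ 2 + 7 * t ^ 2 : ℤ) = m := by
      have : ((m.toNat : ℕ) : ℤ) = m := by omega
      rw [← this, ← h]; push_cast; ring
    simp [Fin.sum_univ_succ]
    linarith
  have A : ∀ (M a b : ℤ), 0 ≤ M → M % 3 ≠ 0 → (M % 4 = 2 ∨ M % 4 = 3) →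
      m = 2 * M + 5 * a ^ 2 + 7 * b ^ 2 → RepY 4 m := by
    intro M a b hM hM3 hM4 h
    obtain ⟨x, y, z, hx⟩ := rep223 M hM hM3 hM4
    refine ⟨![x, y, a, z, b], ?_⟩
    simp [Fin.sum_univ_succ]
    rw [h, ← hx]; ring
  have : (m % 8 = 1 ∨ m % 8 = 3) ∨ m % 8 = 5 ∨ m % 8 = 7 ∨ (m % 8 = 4 ∨ m % 8 = 6) ∨
      (m % 8 = 0 ∨ m % 8 = 2) := by
    omega
  rcases this with h | h | h | h | h
  · by_cases h3 : ((m - 5) / 2) % 3 = 0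
    · exact A ((m - 45) / 2) 3 0 (by omega) (by omega) (by omega) (by omega)
    · exact A ((m - 5) / 2) 1 0 (by omega) (by omega) (by omega) (by omega)
  · by_cases h3 : ((m - 7) / 2) % 3 = 0
    · exact A ((m - 63) / 2) 0 3 (by omega) (by omega) (by omega) (by omega)
    · exact A ((m - 7) / 2) 0 1 (by omega) (by omega) (by omega) (by omega)
  · by_cases h3 : ((m - 27) / 2) % 3 = 0
    · exact A ((m - 83) / 2) 2 3 (by omega) (by omega) (by omega) (by omega)
    · exact A ((m - 27) / 2) 2 1 (by omega) (by omega) (by omega) (by omega)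
  · by_cases h3 : (m / 2) % 3 = 0
    · exact A ((m - 80) / 2) 4 0 (by omega) (by omega) (by omega) (by omega)
    · exact A (m / 2) 0 0 (by omega) (by omega) (by omega) (by omega)
  · by_cases h3 : ((m - 12) / 2) % 3 = 0
    · exact A ((m - 52) / 2) 3 1 (by omega) (by omega) (by omega) (by omega)
    · exact A ((m - 12) / 2) 1 1 (by omega) (by omega) (by omega) (by omega)

theorem stmt_5 (n : ℕ) (hn : 3 < n) :
    ∀ m : ℤ, m ≠ 0 →
      ((∃ x : Fin (n + 1) → ℤ,
          ∑ i : Fin (n + 1), (if (i : ℕ) = 0 then (n : ℤ) else (n : ℤ) + (i : ℕ) - 1) * (x i) ^ 2 = m) ↔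
        (n : ℤ) ≤ m) := by
  intro m hm
  constructor
  · rintro ⟨x, hx⟩
    have hc : ∀ i : Fin (n + 1),
        (n : ℤ) ≤ (if (i : ℕ) = 0 then (n : ℤ) else (n : ℤ) + (i : ℕ) - 1) := by
      intro i; split_ifs <;> omega
    have hex : ∃ i, x i ≠ 0 := by
      by_contra hcon
      push Not at hcon
      apply hm
      rw [← hx]
      simp [hcon]
    obtain ⟨i, hi⟩ := hex
    have h1 : (if (i : ℕ) = 0 then (n : ℤ) else (n : ℤ) + (i : ℕ) - 1) * (x i) ^ 2 ≤ m := by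
      rw [← hx]
      exact Finset.single_le_sum
        (f := fun i : Fin (n + 1) =>
          (if (i : ℕ) = 0 then (n : ℤ) else (n : ℤ) + (i : ℕ) - 1) * (x i) ^ 2)
        (fun j _ => mul_nonneg (le_trans (by omega) (hc j)) (sq_nonneg _)) (Finset.mem_univ i)
    have h2 : 0 < x i ^ 2 := by positivity
    have h3 := hc i
    nlinarith
  · intro h
    change RepY n m
    by_cases h9 : 9 ≤ n
    · exact RepY_large n h9 m h
    · have : n = 4 ∨ n = 5 ∨ n = 6 ∨ n = 7 ∨ n = 8 := by omega
      rcases this with rfl | rfl | rfl | rfl | rfl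
      · exact RepY4 m (by exact_mod_cast h)
      · exact RepY5 m (by exact_mod_cast h)
      · exact RepY6 m (by exact_mod_cast h)
      · exact RepY7 m (by exact_mod_cast h)
      · exact RepY8 m (by exact_mod_cast h)
end

section
/- The diagonal quadratic form ⟨2,3,4,5⟩ is tight T(2)-universal; that is, the set of nonzero integers represented by 2x² + 3y² + 4z² + 5t² is exactly the set of integers ≥ 2. -/
set_option maxHeartbeats 2000000 in
theorem red_aux (w N : ℤ) : ∀ n : ℕ, ∀ k : ℕ, ∀ a b c f g h : ℤ, a.toNat = n → (a*b-h^2).toNat = k →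
    0 < a → 0 < a*b-h^2 → a*b*c+2*f*g*h-a*f^2-b*g^2-c*h^2 = 3 →
    (∃ x y z : ℤ, a*x^2+b*y^2+c*z^2+2*f*y*z+2*g*x*z+2*h*x*y = w) →
    (∃ x y z : ℤ, a*x^2+b*y^2+c*z^2+2*f*y*z+2*g*x*z+2*h*x*y = N) →
    (∃ x y z : ℤ, x^2+y^2+3*z^2 = w) ∨ (∃ x y z : ℤ, x^2+2*(y^2+y*z+z^2) = N) := by
  intro n
  induction n using Nat.strong_induction_on with
  | _ n ihn =>
  intro k
  induction k using Nat.strong_induction_on with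
  | _ k ihk =>
  intro a b c f g h hn hk ha hB hD hw hN
  -- reduce E = a f - g h modulo B by z-shift
  obtain ⟨q, hq⟩ : ∃ q : ℤ, |2*((a*f-g*h) + q*(a*b-h^2))| ≤ a*b-h^2 := by
    refine ⟨-((2*(a*f-g*h) + (a*b-h^2)) / (2*(a*b-h^2))), ?_⟩
    have h1 := Int.emod_add_mul_ediv (2*(a*f-g*h) + (a*b-h^2)) (2*(a*b-h^2))
    have h2 := Int.emod_nonneg (2*(a*f-g*h) + (a*b-h^2)) (b := 2*(a*b-h^2)) (by omega)
    have h3 := Int.emod_lt_of_pos (2*(a*f-g*h) + (a*b-h^2)) (b := 2*(a*b-h^2)) (by omega)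
    rw [abs_le]
    constructor <;> nlinarith
  -- new coefficients: y -> y + q z
  obtain ⟨c', hc'⟩ : ∃ c', c' = c + 2*f*q + b*q^2 := ⟨_, rfl⟩
  obtain ⟨f', hf'⟩ : ∃ f', f' = f + b*q := ⟨_, rfl⟩
  obtain ⟨g', hg'⟩ : ∃ g', g' = g + h*q := ⟨_, rfl⟩
  have hE : a*f'-g'*h = (a*f-g*h) + q*(a*b-h^2) := by subst hf' hg'; ring
  rw [← hE] at hq
  have hD' : a*b*c'+2*f'*g'*h-a*f'^2-b*g'^2-c'*h^2 = 3 := by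
    rw [← hD]; subst hc' hf' hg'; ring
  have tr : ∀ v, (∃ x y z : ℤ, a*x^2+b*y^2+c*z^2+2*f*y*z+2*g*x*z+2*h*x*y = v) →
     (∃ x y z : ℤ, a*x^2+b*y^2+c'*z^2+2*f'*y*z+2*g'*x*z+2*h*x*y = v) := by
    rintro v ⟨x, y, z, rfl⟩
    exact ⟨x, y - q*z, z, by subst hc' hf' hg'; ring⟩
  replace hw := tr _ hw
  replace hN := tr _ hN
  clear tr
  clear hE hD hc' hf' hg'
  clear q c f g
  obtain ⟨B, hBd⟩ : ∃ B, B = a*b-h^2 := ⟨_, rfl⟩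
  obtain ⟨E, hEd⟩ : ∃ E, E = a*f'-g'*h := ⟨_, rfl⟩
  obtain ⟨C, hCd⟩ : ∃ C, C = a*c'-g'^2 := ⟨_, rfl⟩
  have hBC : B*C - E^2 = 3*a := by
    rw [← hD']; subst hBd hEd hCd; ring
  rw [← hBd, ← hEd] at hq
  rw [← hBd] at hB hk
  have hCpos : 0 < C := by nlinarith [sq_nonneg E]
  by_cases hCB : C < B
  · refine ihk C.toNat (by omega) a c' b f' h g' hn (by rw [hCd]) ha (by rw [← hCd]; exact hCpos) ?_ ?_ ?_
    · rw [← hD']; ring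
    · obtain ⟨x, y, z, e⟩ := hw; exact ⟨x, z, y, by rw [← e]; ring⟩
    · obtain ⟨x, y, z, e⟩ := hN; exact ⟨x, z, y, by rw [← e]; ring⟩
  push Not at hCB
  have hE2 : 4*E^2 ≤ B^2 := by
    have := sq_le_sq' (abs_le.1 hq).1 (abs_le.1 hq).2
    nlinarith
  have hB2 : B^2 ≤ 4*a := by nlinarith
  by_cases ha1 : a = 1
  · subst ha1
    have hB3 : B ≤ 2 := by nlinarith
    have hE3 := abs_le.1 hq
    have key : ∀ v, (∃ x y z : ℤ, 1*x^2+b*y^2+c'*z^2+2*f'*y*z+2*g'*x*z+2*h*x*y = v) →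
      ∃ x y z : ℤ, x^2 + B*y^2+2*E*y*z+C*z^2 = v := by
      rintro v ⟨x, y, z, rfl⟩
      exact ⟨x + h*y+g'*z, y, z, by subst hBd hEd hCd; ring⟩
    obtain ⟨x, y, z, hw⟩ := key _ hw
    obtain ⟨x', y', z', hN⟩ := key _ hN
    obtain rfl | rfl : B = 1 ∨ B = 2 := by omega
    · left
      obtain rfl : E = 0 := by omega
      obtain rfl : C = 3 := by linarith
      exact ⟨x, y, z, by rw [← hw]; ring⟩
    · right
      obtain rfl | rfl | rfl : E = 0 ∨ E = 1 ∨ E = -1 := by omega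
      · omega
      · obtain rfl : C = 2 := by linarith
        exact ⟨x', y', z', by rw [← hN]; ring⟩
      · obtain rfl : C = 2 := by linarith
        exact ⟨x', y', -z', by rw [← hN]; ring⟩
  have ha2 : 2 ≤ a := by omega
  obtain ⟨q, hq⟩ : ∃ q : ℤ, |2*(h + q*a)| ≤ a := by
    refine ⟨-((2*h + a) / (2*a)), ?_⟩
    have h1 := Int.emod_add_mul_ediv (2*h + a) (2*a)
    have h2 := Int.emod_nonneg (2*h + a) (b := 2*a) (by omega)
    have h3 := Int.emod_lt_of_pos (2*h + a) (b := 2*a) (by omega)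
    rw [abs_le]
    constructor <;> nlinarith
  -- x -> x + q y
  have hh2 : 4*(h+q*a)^2 ≤ a^2 := by
    have := sq_le_sq' (abs_le.1 hq).1 (abs_le.1 hq).2
    nlinarith
  have hb' : a*(b+2*h*q+a*q^2) = B + (h+q*a)^2 := by subst hBd; ring
  have hba : b+2*h*q+a*q^2 < a := by
    by_contra hcon
    push Not at hcon
    have h0 := mul_le_mul_of_nonneg_left hcon ha.le
    have h1 : 3*a^2 ≤ 4*B := by linarith [sq a]
    have h2 : 9*a^4 ≤ 16*B^2 := by linarith [pow_le_pow_left₀ (by positivity) h1 2]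
    have h3 : 9*a^4 ≤ 64*a := by linarith
    have h4 : 8*a ≤ a^4 := by
      have : 4 ≤ a^2 := by nlinarith
      have : 8 ≤ a^3 := by nlinarith
      nlinarith
    linarith
  have hbpos : 0 < b+2*h*q+a*q^2 := by
    have : 0 < a*(b+2*h*q+a*q^2) := by rw [hb']; positivity
    exact pos_of_mul_pos_right this ha.le
  refine ihn (b+2*h*q+a*q^2).toNat (by omega) _ (b+2*h*q+a*q^2) a c' g' (f'+g'*q) (h+q*a) rfl rfl hbpos ?_ ?_ ?_ ?_
  · have : (b+2*h*q+a*q^2)*a-(h+q*a)^2 = B := by rw [hBd]; ring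
    rw [this]; exact hB
  · rw [← hD']; ring
  · obtain ⟨x, y, z, e⟩ := hw; exact ⟨y, x - q*y, z, by rw [← e]; ring⟩
  · obtain ⟨x, y, z, e⟩ := hN; exact ⟨y, x - q*y, z, by rw [← e]; ring⟩

/-- ternary representation from a congruence condition -/
theorem rep_of (N b c s : ℤ) (hb : 0 < b) (hc : c = 3*b*N-1) (hc0 : 0 < c) (hs : c ∣ s^2 + b) :
    ∃ x y z : ℤ, x^2+2*(y^2+y*z+z^2) = N := by
  obtain ⟨r, hr⟩ := hs
  have hr0 : 0 < r := by
    have : 0 < c * r := by rw [← hr]; positivity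
    exact pos_of_mul_pos_right this hc0.le
  have hB : 3*r*(3*c) - (3*s)^2 = 9*b := by linear_combination -9*hr
  rcases red_aux (3*c) N _ _ (3*r) (3*c) N 0 1 (3*s) rfl rfl (by omega) (by omega)
    (by linear_combination N*hB - 3*hc) ⟨0, 1, 0, by ring⟩ ⟨0, 0, 1, by ring⟩ with ⟨x, y, z, h⟩ | h
  · exfalso
    have h1 : x^2+y^2+3*z^2 = 9*(b*N) - 3 := by rw [h, hc]; ring
    have h2 : (x^2+y^2) % 3 = 0 := by omega
    have hx : x % 3 = 0 ∧ y % 3 = 0 := by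
      have a1 : x % 3 = 0 ∨ x % 3 = 1 ∨ x % 3 = 2 := by omega
      have a2 : y % 3 = 0 ∨ y % 3 = 1 ∨ y % 3 = 2 := by omega
      rcases a1 with e | e | e <;> rcases a2 with e' | e' | e' <;> simp [Int.add_emod, pow_two, Int.mul_emod, e, e'] at h2 ⊢
    obtain ⟨x', rfl⟩ := Int.dvd_of_emod_eq_zero hx.1
    obtain ⟨y', rfl⟩ := Int.dvd_of_emod_eq_zero hx.2
    have h3 : z^2 = 3*(b*N - x'^2 - y'^2) - 1 := by linarith
    have h4 : z^2 % 3 = 2 := by omega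
    have a1 : z % 3 = 0 ∨ z % 3 = 1 ∨ z % 3 = 2 := by omega
    rcases a1 with e | e | e <;> simp [pow_two, Int.mul_emod, e] at h4
  · exact h

theorem sq_of_jac (p : ℕ) (hp : p.Prime) (b : ℤ) (h : jacobiSym (-b) p = 1) :
    ∃ s : ℤ, (p : ℤ) ∣ s^2 + b := by
  have : Fact p.Prime := ⟨hp⟩
  obtain ⟨r, hr⟩ := ZMod.isSquare_of_jacobiSym_eq_one h
  obtain ⟨s, rfl⟩ := ZMod.intCast_surjective r
  refine ⟨s, ?_⟩
  rw [← ZMod.intCast_zmod_eq_zero_iff_dvd]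
  push_cast at hr ⊢
  rw [sq, ← hr]; ring

theorem jac_neg_one (b : ℕ) (h : b % 4 = 1) : jacobiSym (-1) b = 1 := by
  rw [jacobiSym.at_neg_one (Nat.odd_iff.2 (by omega)), ZMod.χ₄_nat_one_mod_four h]

theorem jac_two (b : ℕ) (h : b % 8 = 1) : jacobiSym 2 b = 1 := by
  rw [jacobiSym.at_two (Nat.odd_iff.2 (by omega)), ZMod.χ₈_nat_eq_if_mod_eight]
  simp [h, show b % 2 ≠ 0 by omega]

theorem jac_main (b p : ℕ) (j : ℤ) (hb : b % 4 = 1) (hp : p % 4 = 1) (hj : (b : ℤ) ∣ j * p + 1)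
    (hj1 : jacobiSym j b = 1) : jacobiSym (-b) p = 1 := by
  have e : (-(b:ℤ)) = -1 * b := by ring
  rw [e, jacobiSym.mul_left, jac_neg_one p hp, one_mul,
    jacobiSym.quadratic_reciprocity_one_mod_four hb (Nat.odd_iff.2 (by omega))]
  have h1 : jacobiSym (j * p) b = jacobiSym (-1) b := by
    apply jacobiSym.mod_left'
    exact (Int.modEq_iff_dvd.2 (by simpa using hj)).symm
  rw [jacobiSym.mul_left, hj1, one_mul, jac_neg_one b hb] at h1
  exact h1

theorem dirichlet (M r : ℕ) (hM : M ≠ 0) (h : r.Coprime M) : ∃ p k : ℕ, p.Prime ∧ p = r + M * k := by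
  obtain ⟨p, hp, hpp, hm⟩ := Nat.forall_exists_prime_gt_and_modEq r hM h
  obtain ⟨k, hk⟩ := (Nat.modEq_iff_dvd' hp.le).1 hm.symm
  exact ⟨p, k, hpp, by omega⟩

theorem rep2 (N : ℕ) (h : N % 4 = 2) : ∃ x y z : ℤ, x^2+2*(y^2+y*z+z^2) = N := by
  obtain ⟨n, rfl⟩ : ∃ n, N = 4*n+2 := ⟨N/4, by omega⟩
  obtain ⟨p, k, hp, e⟩ := dirichlet (12*(4*n+2)) (3*(4*n+2)-1) (by omega) (by
    rw [show 3*(4*n+2) - 1 = 12*n+5 by omega, ← Nat.isCoprime_iff_coprime]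
    refine ⟨-((12*n+6+1)*(1+(12*n+6)^2)), 2*(6*n+3)^3, ?_⟩
    push_cast
    ring)
  have e' : (p:ℤ) = 3*(1+4*k)*(4*n+2) - 1 := by
    have : p + 1 = 3*(1+4*k)*(4*n+2) := by
      have : 3*(1+4*k)*(4*n+2) = 3*(4*n+2) + 12*(4*n+2)*k := by ring
      omega
    zify at this; linarith
  have h4 : p % 4 = 1 := by
    have : (p:ℤ) = 4*(3*(n + 4*k*n + 2*k)+1) + 1 := by rw [e']; ring
    omega
  obtain ⟨s, hs⟩ := sq_of_jac p hp ((1+4*k : ℕ):ℤ) (jac_main (1+4*k) p 1 (by omega) h4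
    ⟨3*(4*n+2), by push_cast; rw [e']; ring⟩ (jacobiSym.one_left _))
  exact rep_of _ _ p s (by positivity) (by push_cast; rw [e']) (by exact_mod_cast hp.pos) hs

theorem rep3 (N : ℕ) (h : N % 4 = 3) : ∃ x y z : ℤ, x^2+2*(y^2+y*z+z^2) = N := by
  obtain ⟨n, rfl⟩ : ∃ n, N = 4*n+3 := ⟨N/4, by omega⟩
  obtain ⟨p, k, hp, e⟩ := dirichlet (24*(4*n+3)) (6*(4*n+3)-1) (by omega) (by
    rw [show 6*(4*n+3) - 1 = 24*n+17 by omega, ← Nat.isCoprime_iff_coprime]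
    refine ⟨-((24*n+18+1)*(1+(24*n+18)^2)), 2*(12*n+9)^3, ?_⟩
    push_cast
    ring)
  have e' : (p:ℤ) = 3*(2*(1+4*k))*(4*n+3) - 1 := by
    have : p + 1 = 3*(2*(1+4*k))*(4*n+3) := by
      have : 3*(2*(1+4*k))*(4*n+3) = 6*(4*n+3) + 24*(4*n+3)*k := by ring
      omega
    zify at this; linarith
  have h4 : p % 8 = 1 := by
    have : (p:ℤ) = 8*(3*(n + 4*k*n + 3*k)+2) + 1 := by rw [e']; ring
    omega
  have hj := jac_main (1+4*k) p 1 (by omega) (by omega)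
    ⟨6*(4*n+3), by push_cast; rw [e']; ring⟩ (jacobiSym.one_left _)
  obtain ⟨s, hs⟩ := sq_of_jac p hp (2*((1+4*k : ℕ):ℤ)) (by
    rw [show -(2*((1+4*k : ℕ):ℤ)) = 2 * (-((1+4*k : ℕ):ℤ)) by ring, jacobiSym.mul_left, hj,
      jac_two p h4, one_mul])
  exact rep_of _ _ p s (by positivity) (by push_cast; rw [e']) (by exact_mod_cast hp.pos) hs

theorem rep1 (N : ℕ) (h : N % 8 = 1) : ∃ x y z : ℤ, x^2+2*(y^2+y*z+z^2) = N := by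
  obtain ⟨n, rfl⟩ : ∃ n, N = 8*n+1 := ⟨N/8, by omega⟩
  obtain ⟨p, k, hp, e⟩ := dirichlet (12*(8*n+1)) (12*n+1) (by omega) (by
    rw [← Nat.isCoprime_iff_coprime]
    exact ⟨1+24*n, -(3*n), by push_cast; ring⟩)
  have e' : 2*(p:ℤ) = 3*(1+8*k)*(8*n+1) - 1 := by
    rw [e]; push_cast; ring
  have h4 : p % 4 = 1 := by
    have : (p:ℤ) = 4*(3*n + 3*(8*n+1)*k) + 1 := by rw [e]; push_cast; ring
    omega
  obtain ⟨s, hs⟩ := sq_of_jac p hp ((1+8*k : ℕ):ℤ) (jac_main (1+8*k) p 2 (by omega) h4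
    ⟨3*(8*n+1), by push_cast; rw [e']; ring⟩ (jac_two _ (by omega)))
  obtain ⟨s, hs, hs2⟩ : ∃ s : ℤ, (p:ℤ) ∣ s^2 + ((1+8*k : ℕ):ℤ) ∧ s % 2 = 1 := by
    rcases Int.emod_two_eq_zero_or_one s with h0 | h0
    · refine ⟨s + p, ?_, by omega⟩
      have : (s+p)^2 + ((1+8*k : ℕ):ℤ) = (s^2 + ((1+8*k : ℕ):ℤ)) + p*(2*s+p) := by ring
      rw [this]
      exact dvd_add hs (dvd_mul_right _ _)
    · exact ⟨s, hs, h0⟩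
  refine rep_of _ ((1+8*k : ℕ):ℤ) (2*p) s (by positivity) (by push_cast; rw [e']) (by have := hp.pos; omega) ?_
  refine IsCoprime.mul_dvd ?_ ?_ hs
  · refine ⟨-(2*(p/4 : ℕ)), 1, ?_⟩
    have : p = 4*(p/4)+1 := by omega
    zify at this
    push_cast
    linarith
  · obtain ⟨u, rfl⟩ : ∃ u, s = 2*u+1 := ⟨s/2, by omega⟩
    exact ⟨2*u^2+2*u+1+4*k, by push_cast; ring⟩

theorem fin_of (n : ℤ) (t m : ℤ) (h : ∃ x y z : ℤ, x^2+2*(y^2+y*z+z^2) = n) (hm : m = 2*n+5*t^2) :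
    ∃ x y z t : ℤ, 2 * x ^ 2 + 3 * y ^ 2 + 4 * z ^ 2 + 5 * t ^ 2 = m := by
  obtain ⟨x, y, z, h⟩ := h
  have : ∃ u v : ℤ, u^2+3*v^2 = y^2+y*z+z^2 := by
    rcases Int.even_or_odd' y with ⟨v, rfl | rfl⟩
    · exact ⟨z+v, v, by ring⟩
    · rcases Int.even_or_odd' z with ⟨w, rfl | rfl⟩
      · exact ⟨2*v+1+w, w, by ring⟩
      · exact ⟨v-w, v+w+1, by ring⟩
  obtain ⟨u, v, huv⟩ := this
  exact ⟨x, 2*v, u, t, by rw [hm, ← h, ← huv]; ring⟩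

theorem rep4 (n : ℤ) (h : ∃ x y z : ℤ, x^2+2*(y^2+y*z+z^2) = n) :
    ∃ x y z : ℤ, x^2+2*(y^2+y*z+z^2) = 4*n := by
  obtain ⟨x, y, z, rfl⟩ := h
  exact ⟨2*x, 2*y, 2*z, by ring⟩

theorem repZ (n : ℤ) (h0 : 0 ≤ n) (h : n % 4 = 2 ∨ n % 4 = 3 ∨ n % 8 = 1) :
    ∃ x y z : ℤ, x^2+2*(y^2+y*z+z^2) = n := by
  lift n to ℕ using h0
  rcases h with h | h | h
  · exact rep2 n (by omega)
  · exact rep3 n (by omega)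
  · exact rep1 n (by omega)

set_option maxRecDepth 100000 in
theorem small : ∀ m < 250, 2 ≤ m → ∃ x < 4, ∃ y < 10, ∃ z < 8, ∃ t < 8,
    2 * x ^ 2 + 3 * y ^ 2 + 4 * z ^ 2 + 5 * t ^ 2 = m := by decide +kernel

theorem stmt_7 :
    ∀ m : ℤ, m ≠ 0 →
      ((∃ x y z t : ℤ, 2 * x ^ 2 + 3 * y ^ 2 + 4 * z ^ 2 + 5 * t ^ 2 = m) ↔ 2 ≤ m) := by
  intro m hm0
  constructor
  · rintro ⟨x, y, z, t, h⟩
    have : 0 ≤ m := by rw [← h]; positivity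
    by_contra hc
    obtain rfl : m = 1 := by omega
    have h1 := sq_nonneg x
    have h2 := sq_nonneg y
    have h3 := sq_nonneg z
    have h4 := sq_nonneg t
    omega
  · intro h
    by_cases hs : m < 250
    · lift m to ℕ using by omega
      obtain ⟨x, -, y, -, z, -, t, -, e⟩ := small m (by omega) (by omega)
      exact ⟨x, y, z, t, by exact_mod_cast e⟩
    push Not at hs
    rcases Int.even_or_odd' m with ⟨M, rfl | rfl⟩
    · by_cases c1 : M % 4 = 2 ∨ M % 4 = 3 ∨ M % 8 = 1
      · exact fin_of M 0 _ (repZ M (by omega) c1) (by ring)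
      · exact fin_of (M-10) 2 _ (repZ _ (by omega) (by omega)) (by ring)
    · have o : ∀ t : ℤ, ∀ n, 2*M+1 = 2*n + 5*t^2 → 0 ≤ n → (n % 4 = 2 ∨ n % 4 = 3 ∨ n % 8 = 1) →
        ∃ x y z t : ℤ, 2 * x ^ 2 + 3 * y ^ 2 + 4 * z ^ 2 + 5 * t ^ 2 = 2*M+1 :=
        fun t n h1 h2 h3 => fin_of n t _ (repZ n h2 h3) h1
      have o4 : ∀ t : ℤ, ∀ n, 2*M+1 = 2*(4*n) + 5*t^2 → 0 ≤ n → (n % 4 = 2 ∨ n % 4 = 3 ∨ n % 8 = 1) →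
        ∃ x y z t : ℤ, 2 * x ^ 2 + 3 * y ^ 2 + 4 * z ^ 2 + 5 * t ^ 2 = 2*M+1 :=
        fun t n h1 h2 h3 => fin_of (4*n) t _ (rep4 n (repZ n h2 h3)) h1
      by_cases c1 : (M-2) % 4 = 0
      · obtain ⟨n, hn⟩ : ∃ n, M - 2 = 4*n := ⟨(M-2)/4, by omega⟩
        have c : n % 4 = 0 ∨ n % 4 = 1 ∨ n % 4 = 2 ∨ n % 4 = 3 := by omega
        rcases c with c | c | c | c
        · exact o4 7 (n - 30) (by omega) (by omega) (by omega)
        · exact o4 5 (n - 15) (by omega) (by omega) (by omega)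
        · exact o4 1 n (by omega) (by omega) (by omega)
        · exact o4 1 n (by omega) (by omega) (by omega)
      · by_cases c2 : (M-2) % 8 = 5
        · exact o 3 (M-22) (by omega) (by omega) (by omega)
        · exact o 1 (M-2) (by omega) (by omega) (by omega)
end

section
/- The diagonal quadratic form ⟨3,4,5,6,7⟩ is tight T(3)-universal; that is, the set of nonzero integers represented by 3x_1² + 4x_2² + 5x_3² + 6x_4² + 7x_5² is exactly the set of integers ≥ 3. -/
theorem shift_aux (p q : ℤ) (hp : 0 < p) : ∃ t : ℤ, -p ≤ 2 * (q + t * p) ∧ 2 * (q + t * p) ≤ p := by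
  refine ⟨-((2 * q + p) / (2 * p)), ?_, ?_⟩
  · have h1 := Int.emod_add_mul_ediv (2 * q + p) (2 * p)
    have h2 := Int.emod_nonneg (2 * q + p) (show 2 * p ≠ 0 by omega)
    nlinarith
  · have h1 := Int.emod_add_mul_ediv (2 * q + p) (2 * p)
    have h2 := Int.emod_lt_of_pos (2 * q + p) (show 0 < 2 * p by omega)
    nlinarith

theorem binary_aux (n : ℕ) : ∀ p q r : ℤ, p = n → 0 < p → 0 < p * r - q ^ 2 →
    ∃ α β γ δ : ℤ, α * δ - β * γ = 1 ∧ 0 < p * α ^ 2 + 2 * q * α * γ + r * γ ^ 2 ∧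
      3 * (p * α ^ 2 + 2 * q * α * γ + r * γ ^ 2) ^ 2 ≤ 4 * (p * r - q ^ 2) := by
  induction n using Nat.strong_induction_on with
  | _ n ih =>
    intro p q r hpn hp hD
    obtain ⟨t, ht1, ht2⟩ := shift_aux p q hp
    have hsq : 4 * (q + t * p) ^ 2 ≤ p ^ 2 := by nlinarith
    have hid : p * (r + 2 * t * q + t ^ 2 * p) - (q + t * p) ^ 2 = p * r - q ^ 2 := by ring
    generalize hq' : q + t * p = q' at *
    generalize hr' : r + 2 * t * q + t ^ 2 * p = r' at *
    by_cases hlt : r' < p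
    · have hr0 : 0 < r' := by
        by_contra hcon
        nlinarith [mul_nonneg hp.le (show 0 ≤ -r' by omega), sq_nonneg q']
      obtain ⟨α, β, γ, δ, h1, h2, h3⟩ := ih r'.toNat (by omega) r' (-q') p (by omega) hr0
        (by linarith [hid, (by ring : r' * p - (-q') ^ 2 = p * r' - q' ^ 2)])
      have key : p * (α * t - γ) ^ 2 + 2 * q * (α * t - γ) * α + r * α ^ 2
          = r' * α ^ 2 + 2 * (-q') * α * γ + p * γ ^ 2 := by
        subst hq' hr'; ring
      refine ⟨α * t - γ, β * t - δ, α, β, by linear_combination h1, ?_, ?_⟩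
      · rw [key]; exact h2
      · rw [key]
        calc _ ≤ _ := h3
          _ = 4 * (p * r - q ^ 2) := by rw [← hid]; ring
    · refine ⟨1, 0, 0, 1, by ring, by simpa using hp, ?_⟩
      have : p * p ≤ p * r' := mul_le_mul_of_nonneg_left (by omega) hp.le
      nlinarith

theorem ternary_aux (n : ℕ) : ∀ a b c d e f : ℤ, a = n → 0 < a → 0 < a * b - f ^ 2 →
    a * b * c + 2 * d * e * f - a * d ^ 2 - b * e ^ 2 - c * f ^ 2 = 1 →
    ∀ x y z : ℤ, ∃ u v w : ℤ,
      a * x ^ 2 + b * y ^ 2 + c * z ^ 2 + 2 * d * y * z + 2 * e * x * z + 2 * f * x * y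
        = u ^ 2 + v ^ 2 + w ^ 2 := by
  induction n using Nat.strong_induction_on with
  | _ n ih =>
    intro a b c d e f han ha hG hdet x y z
    have hgd : (a * b - f ^ 2) * (a * c - e ^ 2) - (a * d - e * f) ^ 2 = a := by
      linear_combination a * hdet
    obtain ⟨α, β, γ, δ, h1, h2, h3⟩ := binary_aux (a * b - f ^ 2).toNat (a * b - f ^ 2)
      (a * d - e * f) (a * c - e ^ 2) (by omega) hG (by rw [hgd]; exact ha)
    rw [hgd] at h3
    obtain ⟨t, ht1, ht2⟩ := shift_aux a (f * α + e * γ) ha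
    obtain ⟨f', hf'⟩ : ∃ f', f' = f * α + e * γ + t * a := ⟨_, rfl⟩
    obtain ⟨b', hb'⟩ : ∃ b', b' = b * α ^ 2 + 2 * d * α * γ + c * γ ^ 2
      + 2 * t * (f * α + e * γ) + t ^ 2 * a := ⟨_, rfl⟩
    obtain ⟨c', hc'⟩ : ∃ c', c' = b * β ^ 2 + 2 * d * β * δ + c * δ ^ 2 := ⟨_, rfl⟩
    obtain ⟨e', he'⟩ : ∃ e', e' = f * β + e * δ := ⟨_, rfl⟩
    obtain ⟨d', hd'⟩ : ∃ d', d' = b * α * β + d * (α * δ + β * γ) + c * γ * δ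
      + t * (f * β + e * δ) := ⟨_, rfl⟩
    have hG' : a * b' - f' ^ 2 = (a * b - f ^ 2) * α ^ 2 + 2 * (a * d - e * f) * α * γ
        + (a * c - e ^ 2) * γ ^ 2 := by
      subst hf' hb'; ring
    rw [← hG'] at h2 h3
    have hdet' : a * b' * c' + 2 * d' * e' * f' - a * d' ^ 2 - b' * e' ^ 2 - c' * f' ^ 2 = 1 := by
      have : a * b' * c' + 2 * d' * e' * f' - a * d' ^ 2 - b' * e' ^ 2 - c' * f' ^ 2
        = (a * b * c + 2 * d * e * f - a * d ^ 2 - b * e ^ 2 - c * f ^ 2)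
          * (α * δ - β * γ) ^ 2 := by
        subst hf' hb' hc' hd' he'; ring
      rw [this, hdet, h1]; norm_num
    rw [← hf'] at ht1 ht2
    obtain ⟨y', hy'⟩ : ∃ y', y' = δ * y - β * z := ⟨_, rfl⟩
    obtain ⟨z', hz'⟩ : ∃ z', z' = -γ * y + α * z := ⟨_, rfl⟩
    obtain ⟨x', hx'⟩ : ∃ x', x' = x - t * y' := ⟨_, rfl⟩
    have ey : y = α * y' + β * z' := by subst hy' hz'; linear_combination (-y) * h1
    have ez : z = γ * y' + δ * z' := by subst hy' hz'; linear_combination (-z) * h1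
    have ex : x = x' + t * y' := by rw [hx']; ring
    have hQ : a * x ^ 2 + b * y ^ 2 + c * z ^ 2 + 2 * d * y * z + 2 * e * x * z + 2 * f * x * y
        = a * x' ^ 2 + b' * y' ^ 2 + c' * z' ^ 2 + 2 * d' * y' * z' + 2 * e' * x' * z'
          + 2 * f' * x' * y' := by
      rw [ey, ez, ex, hf', hb', hc', hd', he']; ring
    rw [hQ]
    clear hQ ey ez ex hx' hy' hz' hf' hb' hc' hd' he' hG' hgd h1 hdet hG
    have hsq : 4 * f' ^ 2 ≤ a ^ 2 := by nlinarith
    have hb0 : 0 < b' := by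
      by_contra hcon
      nlinarith [mul_nonneg ha.le (show 0 ≤ -b' by omega), sq_nonneg f']
    by_cases hlt : b' < a
    · obtain ⟨u, v, w, h⟩ := ih b'.toNat (by omega) b' a c' e' d' f' (by omega) hb0
        (by linarith [mul_comm a b']) (by linear_combination hdet') y' x' z'
      exact ⟨u, v, w, by rw [← h]; ring⟩
    · have hab : a * a ≤ a * b' := mul_le_mul_of_nonneg_left (by omega) ha.le
      have hG3 : 3 * a ^ 2 ≤ 4 * (a * b' - f' ^ 2) := by nlinarith
      have ha1 : a = 1 := by
        by_contra hne
        have ha2 : 2 ≤ a := by omega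
        have h5 : (3 * a ^ 2) * (3 * a ^ 2) ≤ (4 * (a * b' - f' ^ 2)) * (4 * (a * b' - f' ^ 2)) :=
          mul_le_mul hG3 hG3 (by positivity) (by linarith)
        have h6 : 27 * a ^ 4 ≤ 64 * a := by nlinarith
        have h7 : 8 * a ≤ a ^ 4 := by
          have : 8 ≤ a ^ 3 := by
            calc (8 : ℤ) = 2 ^ 3 := by norm_num
              _ ≤ a ^ 3 := pow_le_pow_left₀ (by norm_num) ha2 3
          nlinarith
        linarith
      subst ha1
      have hf0 : f' = 0 := by omega
      subst hf0
      have hb1 : b' = 1 := by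
        by_contra hne
        nlinarith [show 2 ≤ b' by omega]
      subst hb1
      exact ⟨x' + e' * z', y' + d' * z', z', by linear_combination z' ^ 2 * hdet'⟩

theorem three_sq_of_dvd (n b m A : ℤ) (hb : 0 < b) (hA : 0 < A) (hAn : A = b * n - 1)
    (h : A ∣ m ^ 2 + b) : ∃ u v w : ℤ, n = u ^ 2 + v ^ 2 + w ^ 2 := by
  obtain ⟨l, hl⟩ := h
  obtain ⟨u, v, w, h⟩ := ternary_aux A.toNat A l n 1 0 m (by omega) hA (by linarith)
    (by linear_combination (-n) * hl - hAn) 0 0 1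
  exact ⟨u, v, w, by rw [← h]; ring⟩

theorem exists_sq_aux (p : ℕ) [Fact p.Prime] (b : ℤ) (h : jacobiSym (-b) p = 1) :
    ∃ m : ℤ, (p : ℤ) ∣ m ^ 2 + b := by
  obtain ⟨r, hr⟩ := ZMod.isSquare_of_jacobiSym_eq_one h
  obtain ⟨m, rfl⟩ := ZMod.intCast_surjective r
  refine ⟨m, ?_⟩
  rw [← ZMod.intCast_zmod_eq_zero_iff_dvd]
  push_cast at hr ⊢
  linear_combination -hr

theorem three_sq_two (n : ℕ) (hn : n % 4 = 2) : ∃ u v w : ℤ, (n : ℤ) = u ^ 2 + v ^ 2 + w ^ 2 := by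
  have hcop : (n - 1).Coprime (4 * n) := by
    apply Nat.Coprime.mul_right
    · have : (n - 1).Coprime (2 ^ 2) := by
        apply Nat.Coprime.pow_right
        rw [Nat.coprime_two_right, Nat.odd_iff]; omega
      simpa using this
    · have := Nat.coprime_self_sub_left (m := 1) (n := n) (by omega)
      rw [this]; simp
  obtain ⟨p, hpn, hp, hmod⟩ := Nat.forall_exists_prime_gt_and_modEq n (by omega) hcop
  have : Fact p.Prime := ⟨hp⟩
  obtain ⟨k, hk⟩ := (Nat.modEq_iff_dvd' (by omega)).1 hmod.symm
  have hpe : p = 4 * n * k + (n - 1) := by omega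
  have hpz : (p : ℤ) = ((4 * k + 1 : ℕ) : ℤ) * n - 1 := by
    rw [hpe]; push_cast [Nat.cast_sub (show 1 ≤ n by omega)]; ring
  have hp4 : p % 4 = 1 := by
    have : p = 4 * (n * k) + (n - 1) := by rw [hpe]; ring
    omega
  have hbodd : Odd (4 * k + 1) := by rw [Nat.odd_iff]; omega
  have hpodd : Odd p := by rw [Nat.odd_iff]; omega
  have hJ : jacobiSym (-((4 * k + 1 : ℕ) : ℤ)) p = 1 := by
    rw [jacobiSym.neg _ hpodd, ZMod.χ₄_nat_one_mod_four hp4, one_mul,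
      jacobiSym.quadratic_reciprocity_one_mod_four (by omega) hpodd,
      jacobiSym.mod_left' (a₂ := -1), jacobiSym.at_neg_one hbodd,
      ZMod.χ₄_nat_one_mod_four (by omega)]
    rw [hpz]
    apply Int.ModEq.symm
    rw [Int.modEq_iff_dvd]
    exact ⟨n, by ring⟩
  obtain ⟨m, hm⟩ := exists_sq_aux p _ hJ
  exact three_sq_of_dvd n _ m p (by positivity) (by exact_mod_cast hp.pos) hpz hm

theorem three_sq_one (n : ℕ) (hn : n % 4 = 1) : ∃ u v w : ℤ, (n : ℤ) = u ^ 2 + v ^ 2 + w ^ 2 := by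
  obtain ⟨c, hc⟩ : ∃ c, 2 * c + 1 = 3 * n := ⟨(3 * n - 1) / 2, by omega⟩
  have hcop : c.Coprime (4 * n) := by
    apply Nat.Coprime.mul_right
    · have : c.Coprime (2 ^ 2) := by
        apply Nat.Coprime.pow_right
        rw [Nat.coprime_two_right, Nat.odd_iff]; omega
      simpa using this
    · rw [← Nat.isCoprime_iff_coprime]
      exact ⟨-2, 3, by have : (2 * c + 1 : ℤ) = 3 * n := by exact_mod_cast hc
                       linarith⟩
  obtain ⟨p, hpn, hp, hmod⟩ := Nat.forall_exists_prime_gt_and_modEq c (by omega) hcop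
  have : Fact p.Prime := ⟨hp⟩
  obtain ⟨k, hk⟩ := (Nat.modEq_iff_dvd' (by omega)).1 hmod.symm
  have hpe : p = 4 * n * k + c := by omega
  have hpz : (2 * p : ℤ) = ((8 * k + 3 : ℕ) : ℤ) * n - 1 := by
    have : (2 * c + 1 : ℤ) = 3 * n := by exact_mod_cast hc
    rw [hpe]; push_cast; linear_combination this
  have hp2 : p % 2 = 1 := by
    have : p = 4 * (n * k) + c := by rw [hpe]; ring
    omega
  have hbodd : Odd (8 * k + 3) := by rw [Nat.odd_iff]; omega
  have hpodd : Odd p := by rw [Nat.odd_iff]; omega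
  have hpb : jacobiSym p (8 * k + 3) = 1 := by
    have h1 : jacobiSym (-2 * p) (8 * k + 3) = 1 := by
      rw [jacobiSym.mod_left' (a₂ := 1), jacobiSym.one_left]
      apply Int.ModEq.symm
      rw [Int.modEq_iff_dvd]
      exact ⟨-n, by linear_combination -hpz⟩
    rw [jacobiSym.mul_left, jacobiSym.at_neg_two hbodd] at h1
    have h2 : ZMod.χ₈' ((8 * k + 3 : ℕ) : ZMod 8) = 1 := by
      rw [ZMod.χ₈'_nat_eq_if_mod_eight]
      have : (8 * k + 3) % 8 = 3 := by omega
      have : (8 * k + 3) % 2 = 1 := by omega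
      simp [*]
    rw [h2, one_mul] at h1
    exact h1
  have hJ : jacobiSym (-((8 * k + 3 : ℕ) : ℤ)) p = 1 := by
    rw [jacobiSym.neg _ hpodd]
    rcases (show p % 4 = 1 ∨ p % 4 = 3 by omega) with h4 | h4
    · rw [ZMod.χ₄_nat_one_mod_four h4, one_mul,
        jacobiSym.quadratic_reciprocity_one_mod_four' hbodd h4, hpb]
    · rw [ZMod.χ₄_nat_three_mod_four h4,
        jacobiSym.quadratic_reciprocity_three_mod_four (by omega) h4, hpb]
      norm_num
  obtain ⟨m, hm⟩ := exists_sq_aux p _ hJ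
  obtain ⟨m', hm', hodd⟩ : ∃ m' : ℤ, (p : ℤ) ∣ m' ^ 2 + (8 * k + 3 : ℕ) ∧ m' % 2 = 1 := by
    rcases Int.emod_two_eq_zero_or_one m with h | h
    · refine ⟨m + p, ?_, by omega⟩
      have : (m + p) ^ 2 + ((8 * k + 3 : ℕ) : ℤ) = (m ^ 2 + (8 * k + 3 : ℕ)) + p * (2 * m + p) := by
        ring
      rw [this]
      exact dvd_add hm (dvd_mul_right _ _)
    · exact ⟨m, hm, h⟩
  refine three_sq_of_dvd n _ m' (2 * p) (by positivity) ?_ hpz ?_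
  · have := hp.pos
    positivity
  · apply IsCoprime.mul_dvd
    · have : Nat.Coprime 2 p := by rw [Nat.coprime_two_left]; exact hpodd
      exact_mod_cast Nat.isCoprime_iff_coprime.2 this
    · obtain ⟨j, hj⟩ : ∃ j, m' = 2 * j + 1 := ⟨m' / 2, by omega⟩
      exact ⟨2 * j ^ 2 + 2 * j + 4 * k + 2, by rw [hj]; push_cast; ring⟩
    · exact hm'

theorem perm_aux (n a b c : ℤ) (h : n = a ^ 2 + b ^ 2 + c ^ 2) (h3 : (a + b + c) % 3 = 0) :
    ∃ x y w : ℤ, 2 * n = 3 * x ^ 2 + 4 * y ^ 2 + 6 * w ^ 2 := by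
  have key : ∀ a b c : ℤ, n = a ^ 2 + b ^ 2 + c ^ 2 → (a + b + c) % 3 = 0 → (a - b) % 2 = 0 →
      ∃ x y w : ℤ, 2 * n = 3 * x ^ 2 + 4 * y ^ 2 + 6 * w ^ 2 := by
    intro a b c h h3 h2
    obtain ⟨w, hw⟩ : ∃ w, a + b + c = 3 * w := ⟨(a + b + c) / 3, by omega⟩
    obtain ⟨y, hy⟩ : ∃ y, a - b = 2 * y := ⟨(a - b) / 2, by omega⟩
    refine ⟨w - c, y, w, ?_⟩
    have hc : c = 3 * w - a - b := by linarith
    have ha : a = b + 2 * y := by linarith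
    subst hc; subst ha; subst h; ring
  rcases (show (a - b) % 2 = 0 ∨ (b - c) % 2 = 0 ∨ (a - c) % 2 = 0 by omega) with h2 | h2 | h2
  · exact key a b c h h3 h2
  · exact key b c a (by rw [h]; ring) (by omega) h2
  · exact key a c b (by rw [h]; ring) (by omega) h2

theorem tern_346 (n : ℕ) (h4 : n % 4 = 1 ∨ n % 4 = 2) (h3 : n % 3 = 0 ∨ n % 3 = 2) :
    ∃ x y w : ℤ, 2 * (n : ℤ) = 3 * x ^ 2 + 4 * y ^ 2 + 6 * w ^ 2 := by
  obtain ⟨a, b, c, h⟩ : ∃ u v w : ℤ, (n : ℤ) = u ^ 2 + v ^ 2 + w ^ 2 := by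
    rcases h4 with h4 | h4
    · exact three_sq_one n h4
    · exact three_sq_two n h4
  have hmod : ∀ a : ℤ, (a % 3 = 0 ∧ a ^ 2 % 3 = 0) ∨ (a % 3 = 1 ∧ a ^ 2 % 3 = 1) ∨
      (a % 3 = 2 ∧ a ^ 2 % 3 = 1) := by
    intro a
    rcases (show a % 3 = 0 ∨ a % 3 = 1 ∨ a % 3 = 2 by omega) with h | h | h <;>
      simp [pow_two, Int.mul_emod, h]
  have : (a + b + c) % 3 = 0 ∨ (a + b + -c) % 3 = 0 ∨ (a + -b + c) % 3 = 0 ∨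
      (-a + b + c) % 3 = 0 := by
    have ha := hmod a
    have hb := hmod b
    have hc := hmod c
    generalize a ^ 2 = A at *
    generalize b ^ 2 = B at *
    generalize c ^ 2 = C at *
    omega
  rcases this with h0 | h0 | h0 | h0
  · exact perm_aux n _ _ _ h h0
  · exact perm_aux n _ _ _ (by rw [h]; ring) h0
  · exact perm_aux n _ _ _ (by rw [h]; ring) h0
  · exact perm_aux n _ _ _ (by rw [h]; ring) h0

theorem small_aux_s8 : ∀ m : Fin 81, 3 ≤ m.val → ∃ x : Fin 6, ∃ y : Fin 5, ∃ z : Fin 4, ∃ w : Fin 3,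
    ∃ v : Fin 2,
    3 * x.val ^ 2 + 4 * y.val ^ 2 + 5 * z.val ^ 2 + 6 * w.val ^ 2 + 7 * v.val ^ 2 = m.val := by
  decide +kernel

theorem stmt_8 :
    ∀ m : ℤ, m ≠ 0 →
      ((∃ x₁ x₂ x₃ x₄ x₅ : ℤ,
          3 * x₁ ^ 2 + 4 * x₂ ^ 2 + 5 * x₃ ^ 2 + 6 * x₄ ^ 2 + 7 * x₅ ^ 2 = m) ↔ 3 ≤ m) := by
  intro m hm
  constructor
  · rintro ⟨a, b, c, d, e, rfl⟩
    have hpos : ∀ t : ℤ, t ^ 2 = 0 ∨ 1 ≤ t ^ 2 := fun t => by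
      have := sq_nonneg t
      omega
    have ha := hpos a
    have hb := hpos b
    have hc := hpos c
    have hd := hpos d
    have he := hpos e
    omega
  · intro h3
    by_cases hs : m < 81
    · obtain ⟨x, y, z, w, v, h⟩ := small_aux_s8 ⟨m.toNat, by omega⟩ (by simp; omega)
      refine ⟨x.val, y.val, z.val, w.val, v.val, ?_⟩
      have h' : (((3 * x.val ^ 2 + 4 * y.val ^ 2 + 5 * z.val ^ 2 + 6 * w.val ^ 2
        + 7 * v.val ^ 2 : ℕ)) : ℤ) = (m.toNat : ℤ) := by exact_mod_cast h
      rw [Int.toNat_of_nonneg (by omega)] at h'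
      push_cast at h'
      exact h'
    · have key : ∀ z v : ℤ, 5 * z ^ 2 + 7 * v ^ 2 ≤ 80 →
          ((m - (5 * z ^ 2 + 7 * v ^ 2)) % 8 = 2 ∨ (m - (5 * z ^ 2 + 7 * v ^ 2)) % 8 = 4) →
          ((m - (5 * z ^ 2 + 7 * v ^ 2)) % 3 = 0 ∨ (m - (5 * z ^ 2 + 7 * v ^ 2)) % 3 = 1) →
          ∃ x₁ x₂ x₃ x₄ x₅ : ℤ,
          3 * x₁ ^ 2 + 4 * x₂ ^ 2 + 5 * x₃ ^ 2 + 6 * x₄ ^ 2 + 7 * x₅ ^ 2 = m := by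
        intro z v h1 h8 h3
        generalize hk : 5 * z ^ 2 + 7 * v ^ 2 = k at *
        obtain ⟨x, y, w, h⟩ := tern_346 ((m - k) / 2).toNat (by omega) (by omega)
        refine ⟨x, y, z, w, v, ?_⟩
        have : 2 * (((m - k) / 2).toNat : ℤ) = m - k := by omega
        linarith
      have hz : ∃ k ∈ [(0, 0), (1, 1), (0, 1), (4, 0), (1, 2), (3, 2), (2, 1), (2, 0), ((1, 0) : ℤ × ℤ)],
          ((m - (5 * k.1 ^ 2 + 7 * k.2 ^ 2)) % 8 = 2 ∨ (m - (5 * k.1 ^ 2 + 7 * k.2 ^ 2)) % 8 = 4) ∧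
          ((m - (5 * k.1 ^ 2 + 7 * k.2 ^ 2)) % 3 = 0 ∨ (m - (5 * k.1 ^ 2 + 7 * k.2 ^ 2)) % 3 = 1) ∧
          5 * k.1 ^ 2 + 7 * k.2 ^ 2 ≤ 80 := by
        simp only [List.exists_mem_cons_iff, List.not_mem_nil, false_and, exists_false, or_false]
        norm_num
        have hr1 : 0 ≤ m % 24 := by omega
        have hr2 : m % 24 < 24 := by omega
        have hr3 : m = 24 * (m / 24) + m % 24 := by omega
        generalize m / 24 = q at hr3
        generalize m % 24 = r at *
        clear key hs h3 hm
        subst hr3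
        interval_cases r <;> omega
      obtain ⟨⟨z, v⟩, -, h8, h3', h80⟩ := hz
      exact key z v h80 h8 h3'
end

section
/- The diagonal quadratic form ⟨4,4,5,6,7⟩ is tight T(4)-universal; that is, the set of nonzero integers represented by 4x_1² + 4x_2² + 5x_3² + 6x_4² + 7x_5² is exactly the set of integers ≥ 4. -/
/-- Davenport–Cassels for three squares. -/
theorem dc3 (N : ℤ) : ∀ k : ℕ, ∀ Z X Y W : ℤ, Z.toNat = k → 0 < Z →
    N * Z ^ 2 = X ^ 2 + Y ^ 2 + W ^ 2 → ∃ a b c : ℤ, N = a ^ 2 + b ^ 2 + c ^ 2 := by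
  intro k
  induction k using Nat.strong_induction_on with
  | _ k ih =>
  intro Z X Y W hk hZ h
  have near : ∀ t : ℤ, ∃ u r : ℤ, t = Z * u + r ∧ 4 * r ^ 2 ≤ Z ^ 2 := by
    intro t
    have h1 := Int.emod_add_mul_ediv t Z
    have h2 := Int.emod_nonneg t hZ.ne'
    have h3 := Int.emod_lt_of_pos t hZ
    by_cases h4 : 2 * (t % Z) ≤ Z
    · exact ⟨t / Z, t % Z, by linarith, by nlinarith⟩
    · exact ⟨t / Z + 1, t % Z - Z, by linarith, by nlinarith⟩
  obtain ⟨u1, r1, rfl, e1⟩ := near X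
  obtain ⟨u2, r2, rfl, e2⟩ := near Y
  obtain ⟨u3, r3, rfl, e3⟩ := near W
  obtain ⟨Z', hZ'⟩ : ∃ Z', Z' = N * Z - 2 * ((Z * u1 + r1) * u1 + (Z * u2 + r2) * u2
    + (Z * u3 + r3) * u3) + Z * (u1 ^ 2 + u2 ^ 2 + u3 ^ 2) := ⟨_, rfl⟩
  have key : r1 ^ 2 + r2 ^ 2 + r3 ^ 2 = Z * Z' := by
    rw [hZ']; linear_combination -h
  have hnn : 0 ≤ Z' := by
    by_contra hc
    push Not at hc
    have := mul_neg_of_pos_of_neg hZ hc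
    nlinarith [sq_nonneg r1, sq_nonneg r2, sq_nonneg r3]
  have hlt : Z' < Z := by
    by_contra hc
    push Not at hc
    nlinarith
  rcases hnn.eq_or_lt with h0 | hpos
  · rw [← h0, mul_zero] at key
    have a1 : r1 = 0 := by
      apply pow_eq_zero_iff (n := 2) (by norm_num) |>.1
      nlinarith [sq_nonneg r1, sq_nonneg r2, sq_nonneg r3]
    have a2 : r2 = 0 := by
      apply pow_eq_zero_iff (n := 2) (by norm_num) |>.1
      nlinarith [sq_nonneg r1, sq_nonneg r2, sq_nonneg r3]
    have a3 : r3 = 0 := by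
      apply pow_eq_zero_iff (n := 2) (by norm_num) |>.1
      nlinarith [sq_nonneg r1, sq_nonneg r2, sq_nonneg r3]
    subst a1 a2 a3
    refine ⟨u1, u2, u3, ?_⟩
    have : Z ^ 2 ≠ 0 := by positivity
    apply mul_right_cancel₀ this
    rw [h]; ring
  · obtain ⟨q, hq⟩ : ∃ q, q = u1 ^ 2 + u2 ^ 2 + u3 ^ 2 - N := ⟨_, rfl⟩
    refine ih Z'.toNat (by omega) Z' (Z' * u1 + q * r1) (Z' * u2 + q * r2) (Z' * u3 + q * r3)
      rfl hpos ?_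
    have e : 2 * (u1 * r1 + u2 * r2 + u3 * r3) = - Z' - Z * q := by
      rw [hZ', hq]; ring
    have : (Z' * u1 + q * r1) ^ 2 + (Z' * u2 + q * r2) ^ 2 + (Z' * u3 + q * r3) ^ 2
      = Z' ^ 2 * (q + N) + Z' * q * (2 * (u1 * r1 + u2 * r2 + u3 * r3)) + q ^ 2 * (Z * Z') := by
      rw [← key, hq]; ring
    rw [this, e]; ring

set_option maxHeartbeats 1000000 in
theorem three_sq_of_prime (N p : ℕ) (hN : 0 < N) (hp : p.Prime) (hp4 : p % 4 = 1)
    (hd : N ∣ p + 1) (hs : IsSquare ((N : ℤ) : ZMod p)) :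
    ∃ a b c : ℤ, (N : ℤ) = a ^ 2 + b ^ 2 + c ^ 2 := by
  have : Fact p.Prime := ⟨hp⟩
  have : NeZero N := ⟨hN.ne'⟩
  obtain ⟨s, hs⟩ := hs
  obtain ⟨s, rfl⟩ := ZMod.intCast_surjective s
  obtain ⟨a, b, hab⟩ := Nat.Prime.sq_add_sq (p := p) (by omega)
  have hab' : (a : ℤ) ^ 2 + (b : ℤ) ^ 2 = p := by exact_mod_cast hab
  let S := Finset.range (Nat.sqrt (p * N) + 1) ×ˢ
    (Finset.range (Nat.sqrt N + 1) ×ˢ Finset.range (Nat.sqrt p + 1))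
  let f : ℕ × ℕ × ℕ → ZMod N × ZMod p := fun t =>
    (((t.1 : ℤ) - (t.2.1 : ℤ) : ℤ), ((t.1 : ℤ) - s * (t.2.2 : ℤ) : ℤ))
  have hcard : (Finset.univ : Finset (ZMod N × ZMod p)).card < S.card := by
    simp only [S, Finset.card_univ, Fintype.card_prod, ZMod.card, Finset.card_product,
      Finset.card_range]
    have h1 := Nat.lt_succ_sqrt' (p * N)
    have h2 := Nat.lt_succ_sqrt' N
    have h3 := Nat.lt_succ_sqrt' p
    simp only [Nat.succ_eq_add_one] at h1 h2 h3
    by_contra hc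
    push Not at hc
    have h4 := Nat.pow_le_pow_left hc 2
    have h5 : (N * p) * (N * p) < (Nat.sqrt (p * N) + 1) ^ 2 *
      ((Nat.sqrt N + 1) ^ 2 * (Nat.sqrt p + 1) ^ 2) := by
      apply Nat.mul_lt_mul'' (by linarith) 
      exact Nat.mul_lt_mul'' h2 h3
    nlinarith
  obtain ⟨t, ht, t', ht', hne, heq⟩ := Finset.exists_ne_map_eq_of_card_lt_of_maps_to hcard
    (f := f) (fun _ _ => Finset.mem_coe.2 (Finset.mem_univ _))
  obtain ⟨x, y, z⟩ := t
  obtain ⟨x', y', z'⟩ := t'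
  simp only [S, Finset.mem_product, Finset.mem_range, Nat.lt_succ_iff] at ht ht'
  simp only [f, Prod.mk.injEq, ZMod.intCast_eq_intCast_iff_dvd_sub] at heq
  obtain ⟨hx, hy, hz⟩ := ht
  obtain ⟨hx', hy', hz'⟩ := ht'
  have bd : ∀ u v w : ℕ, u ≤ Nat.sqrt w → v ≤ Nat.sqrt w → ((v : ℤ) - u) ^ 2 ≤ w := by
    intro u v w hu hv
    have h1 := Nat.sqrt_le' w
    have h2 : ((v : ℤ) - u) ^ 2 ≤ (Nat.sqrt w : ℤ) ^ 2 := by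
      apply sq_le_sq'
      · have : (u : ℤ) ≤ Nat.sqrt w := by exact_mod_cast hu
        linarith [Int.natCast_nonneg v]
      · have : (v : ℤ) ≤ Nat.sqrt w := by exact_mod_cast hv
        linarith [Int.natCast_nonneg u]
    have h3 : (Nat.sqrt w : ℤ) ^ 2 ≤ w := by exact_mod_cast h1
    linarith
  have bx := bd _ _ _ hx hx'
  have by' := bd _ _ _ hy hy'
  have bz := bd _ _ _ hz hz'
  obtain ⟨d1, d2⟩ := heq
  have hne' : ¬ ((x' : ℤ) - x = 0 ∧ (y' : ℤ) - y = 0 ∧ (z' : ℤ) - z = 0) := by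
    rintro ⟨h1, h2, h3⟩
    apply hne
    simp only [Prod.mk.injEq]
    omega
  have d1' : (N : ℤ) ∣ ((x' : ℤ) - x) - ((y' : ℤ) - y) := by
    convert d1 using 1; ring
  have d2' : (p : ℤ) ∣ ((x' : ℤ) - x) - s * ((z' : ℤ) - z) := by
    convert d2 using 1; ring
  generalize (x' : ℤ) - x = X at *
  generalize (y' : ℤ) - y = Y at *
  generalize (z' : ℤ) - z = Z at *
  have hsd : (p : ℤ) ∣ s * s - N := by
    rw [← ZMod.intCast_eq_intCast_iff_dvd_sub]
    push_cast at hs ⊢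
    exact hs
  have hd' : (N : ℤ) ∣ p + 1 := by exact_mod_cast hd
  have dN : (N : ℤ) ∣ X ^ 2 + p * Y ^ 2 - N * Z ^ 2 := by
    obtain ⟨g, hg⟩ := d1'
    obtain ⟨k, hk⟩ := hd'
    refine ⟨g * (X + Y) + k * Y ^ 2 - Z ^ 2, ?_⟩
    linear_combination (X + Y) * hg + Y ^ 2 * hk
  have dp : (p : ℤ) ∣ X ^ 2 + p * Y ^ 2 - N * Z ^ 2 := by
    obtain ⟨g, hg⟩ := d2'
    obtain ⟨k, hk⟩ := hsd
    refine ⟨g * (X + s * Z) + k * Z ^ 2 + Y ^ 2, ?_⟩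
    linear_combination (X + s * Z) * hg + Z ^ 2 * hk
  have hcop : IsCoprime (N : ℤ) (p : ℤ) := by
    obtain ⟨k, hk⟩ := hd'
    exact ⟨k, -1, by linear_combination -hk⟩
  obtain ⟨v, hv⟩ := hcop.mul_dvd dN dp
  have hNz : (0 : ℤ) < N := by exact_mod_cast hN
  have hpz : (0 : ℤ) < p := by exact_mod_cast hp.pos
  have hNp : (0 : ℤ) < N * p := by positivity
  have hpns : ∀ q : ℤ, q ^ 2 ≠ p := by
    intro q hq
    have hpp : Prime (p : ℤ) := Nat.prime_iff_prime_int.1 hp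
    rw [← hq] at hpp
    exact hpp.irreducible.not_isSquare ⟨q, sq q⟩
  push_cast at bx
  have hvlo : -1 < v := by
    by_contra hc
    push Not at hc
    have h1 : (N : ℤ) * p * v ≤ - (N * p) := by nlinarith
    have h2 : (N : ℤ) * Z ^ 2 < N * p :=
      mul_lt_mul_of_pos_left (lt_of_le_of_ne bz (hpns Z)) hNz
    nlinarith [sq_nonneg X, mul_nonneg hpz.le (sq_nonneg Y)]
  by_cases hY : Y ^ 2 = N
  · exact ⟨Y, 0, 0, by rw [← hY]; ring⟩
  have hvhi : v < 2 := by
    by_contra hc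
    push Not at hc
    have h1 : 2 * (N * p) ≤ (N : ℤ) * p * v := by nlinarith
    have h2 : (p : ℤ) * Y ^ 2 < p * N :=
      mul_lt_mul_of_pos_left (lt_of_le_of_ne by' hY) hpz
    nlinarith [mul_nonneg hNz.le (sq_nonneg Z)]
  obtain rfl | rfl : v = 0 ∨ v = 1 := by omega
  · have hZ0 : Z ≠ 0 := by
      rintro rfl
      have hx0 : X = 0 := by
        apply pow_eq_zero_iff (n := 2) (by norm_num) |>.1
        have g1 := sq_nonneg X
        have g2 := mul_nonneg hpz.le (sq_nonneg Y)
        have g3 : X ^ 2 + p * Y ^ 2 = 0 := by linear_combination hv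
        linarith
      have hy0 : Y = 0 := by
        apply pow_eq_zero_iff (n := 2) (by norm_num) |>.1
        subst hx0
        have : (p : ℤ) * Y ^ 2 = 0 := by linear_combination hv
        rcases mul_eq_zero.1 this with h | h
        · omega
        · exact h
      exact hne' ⟨hx0, hy0, rfl⟩
    refine dc3 N _ |Z| X (a * Y) (b * Y) rfl (abs_pos.2 hZ0) ?_
    rw [sq_abs]
    linear_combination -hv - Y ^ 2 * hab'
  · refine dc3 N _ (Z ^ 2 + p) (X * Z + p * Y) (a * (Z * Y - X)) (b * (Z * Y - X)) rfl
      (by positivity) ?_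
    linear_combination (-(Z ^ 2) - p) * hv - (Z * Y - X) ^ 2 * hab'

theorem jac_neg_one_s9 {p M : ℕ} (hd : M ∣ p + 1) : jacobiSym (p : ℤ) M = jacobiSym (-1) M := by
  apply jacobiSym.mod_left'
  apply (Int.modEq_iff_dvd.2 _).symm
  obtain ⟨k, hk⟩ := hd
  refine ⟨k, ?_⟩
  have : (p : ℤ) + 1 = M * k := by exact_mod_cast hk
  linarith

theorem three_sq_s9 (N : ℕ) (h : N % 4 = 1 ∨ N % 4 = 2) :
    ∃ a b c : ℤ, (N : ℤ) = a ^ 2 + b ^ 2 + c ^ 2 := by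
  rcases h with h | h
  · have hc : (2 * N - 1).Coprime (4 * N) := by
      have h1 : (2 * N - 1).Coprime (2 * N) := by
        have := Nat.coprime_self_add_right (m := 2 * N - 1) (n := 1)
        rw [Nat.sub_add_cancel (by omega)] at this
        exact this.2 (by simp)
      have h2 : (2 * N - 1).Coprime 2 := h1.coprime_mul_right_right
      have := h2.mul_right h1
      rwa [show 2 * (2 * N) = 4 * N by ring] at this
    obtain ⟨p, -, hp, hm⟩ := Nat.forall_exists_prime_gt_and_modEq 2 (q := 4 * N) (by omega) hc
    have : Fact p.Prime := ⟨hp⟩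
    have hp4 : p % 4 = 1 := by
      have : p ≡ 2 * N - 1 [MOD 4] := hm.of_mul_right N
      unfold Nat.ModEq at this; omega
    have hd : N ∣ p + 1 := by
      have h1 : p ≡ 2 * N - 1 [MOD N] := hm.of_mul_left 4
      have h2 := h1.add_right 1
      rw [Nat.sub_add_cancel (by omega)] at h2
      exact (h2.dvd_iff dvd_rfl).2 ⟨2, by ring⟩
    refine three_sq_of_prime N p (by omega) hp hp4 hd ?_
    have hodd : Odd N := Nat.odd_iff.2 (by omega)
    have hJ : jacobiSym N p = 1 := by
      rw [jacobiSym.quadratic_reciprocity_one_mod_four h (Nat.odd_iff.2 (by omega)),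
        jac_neg_one_s9 hd, jacobiSym.at_neg_one hodd, ZMod.χ₄_nat_one_mod_four h]
    rw [← jacobiSym.legendreSym.to_jacobiSym] at hJ
    by_contra hns
    rw [(legendreSym.eq_neg_one_iff p).2 hns] at hJ
    omega
  · obtain ⟨M, rfl⟩ : ∃ M, N = 2 * M := ⟨N / 2, by omega⟩
    have hc : (2 * M - 1).Coprime (8 * M) := by
      have h1 : (2 * M - 1).Coprime (2 * M) := by
        have := Nat.coprime_self_add_right (m := 2 * M - 1) (n := 1)
        rw [Nat.sub_add_cancel (by omega)] at this
        exact this.2 (by simp)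
      have h2 : (2 * M - 1).Coprime 2 := h1.coprime_mul_right_right
      have := (h2.mul_right h2).mul_right h1
      rwa [show 2 * 2 * (2 * M) = 8 * M by ring] at this
    obtain ⟨p, -, hp, hm⟩ := Nat.forall_exists_prime_gt_and_modEq 2 (q := 8 * M) (by omega) hc
    have : Fact p.Prime := ⟨hp⟩
    have hp8 : p % 8 = (2 * M - 1) % 8 := hm.of_mul_right M
    have hp4 : p % 4 = 1 := by omega
    have hd : 2 * M ∣ p + 1 := by
      have h0 : p ≡ 2 * M - 1 [MOD (4 * (2 * M))] := by
        rwa [show 4 * (2 * M) = 8 * M by ring]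
      have h1 : p ≡ 2 * M - 1 [MOD (2 * M)] := h0.of_mul_left 4
      have h2 := h1.add_right 1
      rw [Nat.sub_add_cancel (by omega)] at h2
      exact (h2.dvd_iff dvd_rfl).2 ⟨1, by ring⟩
    refine three_sq_of_prime (2 * M) p (by omega) hp hp4 hd ?_
    have hodd : Odd M := Nat.odd_iff.2 (by omega)
    have hpodd : Odd p := Nat.odd_iff.2 (by omega)
    have hJ : jacobiSym ((2 * M : ℕ) : ℤ) p = 1 := by
      push_cast
      rw [jacobiSym.mul_left, jacobiSym.quadratic_reciprocity_one_mod_four' hodd hp4,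
        jac_neg_one_s9 (dvd_trans (Dvd.intro_left 2 rfl) hd), jacobiSym.at_neg_one hodd,
        jacobiSym.at_two hpodd, ZMod.χ₈_nat_eq_if_mod_eight, ZMod.χ₄_nat_eq_if_mod_four]
      have : M % 4 = 1 ∨ M % 4 = 3 := by omega
      rcases this with hM | hM
      · have : p % 8 = 1 := by omega
        have : M % 2 = 1 := by omega
        have : p % 2 = 1 := by omega
        clear hp8
        simp [*]
      · have : p % 8 = 5 := by omega
        have : M % 2 = 1 := by omega
        have : p % 2 = 1 := by omega
        clear hp8
        simp [*]
    rw [← jacobiSym.legendreSym.to_jacobiSym] at hJ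
    by_contra hns
    rw [(legendreSym.eq_neg_one_iff p).2 hns] at hJ
    omega

theorem form115_aux (m A B C : ℤ) (h : 5 * m = A ^ 2 + B ^ 2 + C ^ 2) (hC : (5 : ℤ) ∣ C) :
    ∃ x y z : ℤ, m = x ^ 2 + y ^ 2 + 5 * z ^ 2 := by
  obtain ⟨c, rfl⟩ := hC
  have h5 : (5 : ℤ) ∣ (A - 2 * B) * (A + 2 * B) :=
    ⟨m - 5 * c ^ 2 - B ^ 2, by linear_combination -h⟩
  have hp5 : Prime (5 : ℤ) := by norm_num
  rcases hp5.dvd_or_dvd h5 with ⟨k, hk⟩ | ⟨k, hk⟩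
  · obtain rfl : A = 2 * B + 5 * k := by linarith
    refine ⟨B + 2 * k, k, c, ?_⟩
    linarith
  · obtain rfl : A = -2 * B + 5 * k := by linarith
    refine ⟨B - 2 * k, k, c, ?_⟩
    linarith

theorem form115 (m : ℤ) (h0 : 0 ≤ m) (h : m % 4 = 1 ∨ m % 4 = 2) :
    ∃ x y z : ℤ, m = x ^ 2 + y ^ 2 + 5 * z ^ 2 := by
  obtain ⟨n, rfl⟩ := Int.eq_ofNat_of_zero_le h0
  obtain ⟨A, B, C, hABC⟩ := three_sq_s9 (5 * n) (by omega)
  push_cast at hABC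
  have sqm : ∀ t : ℤ, (5 ∣ t ∧ t ^ 2 % 5 = 0) ∨ t ^ 2 % 5 = 1 ∨ t ^ 2 % 5 = 4 := by
    intro t
    have : t % 5 = 0 ∨ t % 5 = 1 ∨ t % 5 = 2 ∨ t % 5 = 3 ∨ t % 5 = 4 := by omega
    rcases this with h | h | h | h | h <;> simp [pow_two, Int.mul_emod, h]
    omega
  have : (5 : ℤ) ∣ A ∨ (5 : ℤ) ∣ B ∨ (5 : ℤ) ∣ C := by
    have a := sqm A
    have b := sqm B
    have c := sqm C
    generalize A ^ 2 = A2 at *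
    generalize B ^ 2 = B2 at *
    generalize C ^ 2 = C2 at *
    omega
  rcases this with h | h | h
  · exact form115_aux n B C A (by linarith) h
  · exact form115_aux n A C B (by linarith) h
  · exact form115_aux n A B C (by linarith) h

/-- The set of integers represented by the form. -/
def RepForm (m : ℤ) : Prop := ∃ x₁ x₂ x₃ x₄ x₅ : ℤ,
  4 * x₁ ^ 2 + 4 * x₂ ^ 2 + 5 * x₃ ^ 2 + 6 * x₄ ^ 2 + 7 * x₅ ^ 2 = m

theorem rep_of_s9 (m k w v : ℤ) (h0 : 0 ≤ k) (h : k % 4 = 1 ∨ k % 4 = 2)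
    (hm : m = 4 * k + 6 * w ^ 2 + 7 * v ^ 2) : RepForm m := by
  obtain ⟨x, y, z, hk⟩ := form115 k h0 h
  exact ⟨x, y, 2 * z, w, v, by rw [hm, hk]; ring⟩

theorem rep_of' (m k w v : ℤ) (h0 : 0 ≤ k) (h : k % 4 = 1 ∨ k % 4 = 2)
    (hm : m = 16 * k + 6 * w ^ 2 + 7 * v ^ 2) : RepForm m := by
  obtain ⟨x, y, z, hk⟩ := form115 k h0 h
  exact ⟨2 * x, 2 * y, 4 * z, w, v, by rw [hm, hk]; ring⟩

theorem rep_small (m : ℤ) (hm : 4 ≤ m) (hs : m < 260) : RepForm m := by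
  have key : ∀ n : ℕ, n < 260 → 4 ≤ n → ∃ a < 9, ∃ b < 9, ∃ c < 4, ∃ d < 4, ∃ e < 4,
      4 * a ^ 2 + 4 * b ^ 2 + 5 * c ^ 2 + 6 * d ^ 2 + 7 * e ^ 2 = n := by
    decide +kernel
  obtain ⟨a, -, b, -, c, -, d, -, e, -, h⟩ := key m.toNat (by omega) (by omega)
  refine ⟨a, b, c, d, e, ?_⟩
  have : (m.toNat : ℤ) = m := by omega
  rw [← this, ← h]
  push_cast
  ring

theorem rep_all (m : ℤ) (hm : 4 ≤ m) : RepForm m := by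
  by_cases hs : m < 260
  · exact rep_small m hm hs
  obtain ⟨k, hk⟩ : ∃ k, k = m / 4 := ⟨_, rfl⟩
  have h4 : m % 4 = 0 ∨ m % 4 = 1 ∨ m % 4 = 2 ∨ m % 4 = 3 := by omega
  rcases h4 with h | h | h | h
  · by_cases hk4 : k % 4 = 1 ∨ k % 4 = 2
    · exact rep_of_s9 m k 0 0 (by omega) hk4 (by omega)
    · exact rep_of_s9 m (k - 6) 2 0 (by omega) (by omega) (by omega)
  · by_cases hk4 : (k - 3) % 4 = 1 ∨ (k - 3) % 4 = 2
    · exact rep_of_s9 m (k - 3) 1 1 (by omega) hk4 (by omega)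
    · exact rep_of_s9 m (k - 17) 1 3 (by omega) (by omega) (by omega)
  · by_cases hk4 : (k - 1) % 4 = 1 ∨ (k - 1) % 4 = 2
    · exact rep_of_s9 m (k - 1) 1 0 (by omega) hk4 (by omega)
    by_cases hk5 : (k - 1) % 4 = 0
    · exact rep_of_s9 m (k - 8) 1 2 (by omega) (by omega) (by omega)
    by_cases hk6 : ((k - 8) / 4) % 4 = 1 ∨ ((k - 8) / 4) % 4 = 2
    · exact rep_of' m ((k - 8) / 4) 1 2 (by omega) hk6 (by omega)
    · exact rep_of' m ((k - 8) / 4 - 14) 1 6 (by omega) (by omega) (by omega)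
  · by_cases hk4 : (k - 1) % 4 = 1 ∨ (k - 1) % 4 = 2
    · exact rep_of_s9 m (k - 1) 0 1 (by omega) hk4 (by omega)
    · exact rep_of_s9 m (k - 7) 2 1 (by omega) (by omega) (by omega)

/-- The diagonal form `⟨4,4,5,6,7⟩` is tight `T(4)`-universal. -/
theorem stmt_9 :
    ∀ m : ℤ, m ≠ 0 →
      ((∃ x₁ x₂ x₃ x₄ x₅ : ℤ,
          4 * x₁ ^ 2 + 4 * x₂ ^ 2 + 5 * x₃ ^ 2 + 6 * x₄ ^ 2 + 7 * x₅ ^ 2 = m) ↔ 4 ≤ m) := by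
  intro m hm
  constructor
  · rintro ⟨a, b, c, d, e, rfl⟩
    have sq01 : ∀ t : ℤ, t ^ 2 = 0 ∨ 1 ≤ t ^ 2 := by
      intro t
      have := sq_nonneg t
      omega
    have := sq01 a
    have := sq01 b
    have := sq01 c
    have := sq01 d
    have := sq01 e
    omega
  · exact rep_all m
end

section
/- Let n be a positive integer and let f be a positive definite integral quadratic form of rank r. Assume that the minimum nonzero value of f on ℤ^r is n or n+1, that f represents every integer m with n+1 ≤ m ≤ 2n−1, and that there is an integer s with n ≤ s ≤ 14n such that f represents every integer m with s ≤ m ≤ s + 2n − 1. Then the form g(x_1,x_2,x_3,y) = n·x_1² + n·x_2² + 2n·x_3² + f(y) of rank r+3 is tight T(n)-universal; consequently t(n) ≤ r + 3. -/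
def G3 (a b c d e f x y z : ℤ) : ℤ :=
  a * x ^ 2 + b * y ^ 2 + c * z ^ 2 + 2 * d * (y * z) + 2 * e * (x * z) + 2 * f * (x * y)

lemma near_mul (f a : ℤ) (ha : 0 < a) : ∃ k : ℤ, 4 * (f + k * a) ^ 2 ≤ a ^ 2 := by
  refine ⟨-((2 * f + a) / (2 * a)), ?_⟩
  have h1 := Int.emod_add_mul_ediv (2 * f + a) (2 * a)
  have h2 := Int.emod_nonneg (2 * f + a) (b := 2 * a) (by omega)
  have h3 := Int.emod_lt_of_pos (2 * f + a) (b := 2 * a) (by omega)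
  set q := (2 * f + a) / (2 * a)
  set t := (2 * f + a) % (2 * a)
  have : 2 * (f + -q * a) = t - a := by linarith
  have h4 : 4 * (f + -q * a) ^ 2 = (t - a) ^ 2 := by rw [← this]; ring
  rw [h4]
  nlinarith

lemma three_sq_of_form (N : ℕ) : ∀ a b c d e f : ℤ, 0 < a → 0 < a * b - f ^ 2 →
    a * b * c + 2 * d * e * f - a * d ^ 2 - b * e ^ 2 - c * f ^ 2 = 1 →
    a + (a * b - f ^ 2) ≤ N →
    ∀ x y z : ℤ, ∃ u v w : ℤ, G3 a b c d e f x y z = u ^ 2 + v ^ 2 + w ^ 2 := by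
  induction N with
  | zero => intro a b c d e f h1 h2 _ h3; exfalso; push_cast at h3; linarith
  | succ N ih =>
    intro a b c d e f ha hA hdet hN x y z
    push_cast at hN
    by_cases hs1 : 3 * a ^ 2 > 4 * (a * b - f ^ 2)
    · obtain ⟨k, hk⟩ := near_mul f a ha
      -- x = x' + k y
      have key : a * (b + 2 * k * f + k ^ 2 * a) = (a * b - f ^ 2) + (f + k * a) ^ 2 := by ring
      have hlt : b + 2 * k * f + k ^ 2 * a < a := by
        have : a * (b + 2 * k * f + k ^ 2 * a) < a * a := by rw [key]; nlinarith
        exact lt_of_mul_lt_mul_left this ha.le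
      have hpos : 0 < b + 2 * k * f + k ^ 2 * a := by
        have : 0 < a * (b + 2 * k * f + k ^ 2 * a) := by rw [key]; positivity
        exact (mul_pos_iff_of_pos_left ha).1 this
      have hA' : (b + 2 * k * f + k ^ 2 * a) * a - (f + k * a) ^ 2 = a * b - f ^ 2 := by ring
      obtain ⟨u, v, w, h⟩ := ih (b + 2 * k * f + k ^ 2 * a) a c e (d + k * e) (f + k * a)
        hpos (by rw [hA']; exact hA) (by rw [← hdet]; ring) (by rw [hA']; linarith)
        y (x - k * y) z
      exact ⟨u, v, w, by rw [← h]; unfold G3; ring⟩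
    by_cases hs2 : 3 * (a * b - f ^ 2) ^ 2 > 4 * a
    · obtain ⟨k, hk⟩ := near_mul (a * d - e * f) (a * b - f ^ 2) hA
      have key : (a * b - f ^ 2) * (a * (c + 2 * k * d + k ^ 2 * b) - (e + k * f) ^ 2)
          = a + (a * d - e * f + k * (a * b - f ^ 2)) ^ 2 := by
        linear_combination a * hdet
      set A := a * b - f ^ 2 with hAdef
      set B := a * (c + 2 * k * d + k ^ 2 * b) - (e + k * f) ^ 2 with hB
      have hlt : B < A := by
        have : A * B < A * A := by rw [key]; nlinarith
        exact lt_of_mul_lt_mul_left this hA.le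
      have hpos : 0 < B := by
        have : 0 < A * B := by rw [key]; positivity
        exact (mul_pos_iff_of_pos_left hA).1 this
      obtain ⟨u, v, w, h⟩ := ih a (c + 2 * k * d + k ^ 2 * b) b (d + k * b) f (e + k * f)
        ha hpos (by rw [← hdet]; ring) (by linarith)
        x z (y - k * z)
      exact ⟨u, v, w, by rw [← h]; unfold G3; ring⟩
    · push Not at hs1 hs2
      set A := a * b - f ^ 2 with hAdef
      have ha1 : a = 1 := by
        by_contra hne
        have h2 : 2 ≤ a := by omega
        have : a ≤ A := by nlinarith
        nlinarith
      have hA1 : A = 1 := by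
        subst ha1; nlinarith
      subst ha1
      have hb : b = 1 + f ^ 2 := by linarith
      subst hb
      refine ⟨x + f * y + e * z, y + (d - e * f) * z, z, ?_⟩
      unfold G3
      linear_combination z ^ 2 * hdet

lemma three_sq_s13 (N : ℕ) (hN : N % 4 = 2) : ∃ u v w : ℤ, (N : ℤ) = u ^ 2 + v ^ 2 + w ^ 2 := by
  have hcop : IsUnit ((N - 1 : ℕ) : ZMod (4 * N)) := by
    rw [ZMod.isUnit_iff_coprime]
    refine Nat.Coprime.mul_right ?_ ?_
    · have : Nat.Coprime (N - 1) 2 := by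
        rw [Nat.coprime_two_right, Nat.odd_iff]; omega
      exact Nat.Coprime.mul_right this this
    · have h : N = (N - 1) + 1 := by omega
      conv => arg 2; rw [h]
      simp
  have : NeZero (4 * N) := ⟨by omega⟩
  obtain ⟨p, hpg, hp, hpm⟩ := Nat.forall_exists_prime_gt_and_eq_mod hcop N
  rw [ZMod.natCast_eq_natCast_iff] at hpm
  obtain ⟨v, hv⟩ := (Nat.modEq_iff_dvd' (by omega)).1 hpm.symm
  have hpv : p + 1 = (4 * v + 1) * N := by
    have : p = N - 1 + 4 * N * v := by omega
    have h1 : p + 1 = N + 4 * N * v := by omega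
    rw [h1]; ring
  have hp4 : p % 4 = 1 := by
    have : p + 1 = 4 * (v * N) + N := by rw [hpv]; ring
    omega
  have : Fact p.Prime := ⟨hp⟩
  set b := 4 * v + 1 with hb
  have hb4 : b % 4 = 1 := by omega
  have hbodd : Odd b := by rw [Nat.odd_iff]; omega
  have hpodd : Odd p := by rw [Nat.odd_iff]; omega
  have hj : jacobiSym (-(b : ℤ)) p = 1 := by
    rw [← neg_one_mul, jacobiSym.mul_left, jacobiSym.at_neg_one hpodd,
      ZMod.χ₄_nat_one_mod_four hp4, one_mul,
      jacobiSym.quadratic_reciprocity_one_mod_four hb4 hpodd]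
    have h1 : ((p : ℤ)) % b = (-1) % b := by
      apply Int.ModEq.symm
      rw [Int.modEq_iff_dvd]
      refine ⟨N, ?_⟩
      have : (p : ℤ) + 1 = b * N := by exact_mod_cast hpv
      linarith
    rw [jacobiSym.mod_left' h1, jacobiSym.at_neg_one hbodd, ZMod.χ₄_nat_one_mod_four hb4]
  rw [← jacobiSym.legendreSym.to_jacobiSym] at hj
  have hsq := (legendreSym.eq_one_iff p (a := -(b : ℤ)) (by
    intro h0
    rw [(legendreSym.eq_zero_iff p _).2 h0] at hj
    exact absurd hj (by norm_num))).1 hj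
  obtain ⟨t', ht'⟩ := hsq
  obtain ⟨t, rfl⟩ := ZMod.intCast_surjective t'
  have hd : (p : ℤ) ∣ b + t ^ 2 := by
    rw [← ZMod.intCast_zmod_eq_zero_iff_dvd]
    push_cast at ht' ⊢
    linear_combination -ht'
  obtain ⟨α, hα⟩ := hd
  have hp0 : (0 : ℤ) < p := by exact_mod_cast hp.pos
  have hb0 : (0 : ℤ) < b := by exact_mod_cast (by omega : 0 < b)
  have hα0 : 0 < α := by
    have : 0 < (p : ℤ) * α := by rw [← hα]; positivity
    exact (mul_pos_iff_of_pos_left hp0).1 this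
  have hpvz : (p : ℤ) + 1 = b * N := by exact_mod_cast hpv
  have hA : α * p - t ^ 2 = b := by linarith
  obtain ⟨u, v, w, h⟩ := three_sq_of_form (α + (α * p - t ^ 2)).toNat α p N 0 1 t hα0
    (by rw [hA]; exact hb0) (by linear_combination N * hA - hpvz) (Int.self_le_toNat _) 0 0 1
  exact ⟨u, v, w, by rw [← h]; unfold G3; ring⟩

lemma odd_rep (m : ℤ) (h0 : 0 ≤ m) (hm : m % 2 = 1) :
    ∃ x y z : ℤ, x ^ 2 + y ^ 2 + 2 * z ^ 2 = m := by
  have aux : ∀ a b c : ℤ, 2 * m = a ^ 2 + b ^ 2 + c ^ 2 → a % 2 = 1 → b % 2 = 1 → c % 2 = 0 →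
      ∃ x y z : ℤ, x ^ 2 + y ^ 2 + 2 * z ^ 2 = m := by
    intro a b c h ha hb hc
    obtain ⟨x, hx⟩ : ∃ x, a + b = 2 * x := ⟨(a + b) / 2, by omega⟩
    obtain ⟨z, hz⟩ : ∃ z, c = 2 * z := ⟨c / 2, by omega⟩
    obtain rfl : a = 2 * x - b := by linarith
    subst hz
    exact ⟨x, x - b, z, by linarith⟩
  obtain ⟨k, rfl⟩ := Int.eq_ofNat_of_zero_le h0
  obtain ⟨a, b, c, h⟩ := three_sq_s13 (2 * k) (by omega)
  push_cast at h
  have sq : ∀ a : ℤ, (a % 2 = 0 ∧ a ^ 2 % 4 = 0) ∨ (a % 2 = 1 ∧ a ^ 2 % 4 = 1) := by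
    intro a
    rcases Int.emod_two_eq_zero_or_one a with h | h
    · left; refine ⟨h, ?_⟩
      obtain ⟨q, rfl⟩ : ∃ q, a = 2 * q := ⟨a / 2, by omega⟩
      have : (2 * q) ^ 2 = 4 * q ^ 2 := by ring
      omega
    · right; refine ⟨h, ?_⟩
      obtain ⟨q, rfl⟩ : ∃ q, a = 2 * q + 1 := ⟨a / 2, by omega⟩
      have : (2 * q + 1) ^ 2 = 4 * (q ^ 2 + q) + 1 := by ring
      omega
  rcases sq a with ⟨ha, ha'⟩ | ⟨ha, ha'⟩ <;> rcases sq b with ⟨hb, hb'⟩ | ⟨hb, hb'⟩ <;>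
    rcases sq c with ⟨hc, hc'⟩ | ⟨hc, hc'⟩ <;> try (exfalso; omega)
  · exact aux b c a (by linarith) hb hc ha
  · exact aux a c b (by linarith) ha hc hb
  · exact aux a b c h ha hb hc

lemma small_rep (m : ℤ) (h0 : 0 ≤ m) (hm : m < 14) :
    ∃ x y z : ℤ, x ^ 2 + y ^ 2 + 2 * z ^ 2 = m := by
  rcases Int.emod_two_eq_zero_or_one m with h | h
  · have : m = 0 ∨ m = 2 ∨ m = 4 ∨ m = 6 ∨ m = 8 ∨ m = 10 ∨ m = 12 := by omega
    rcases this with rfl | rfl | rfl | rfl | rfl | rfl | rfl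
    · exact ⟨0, 0, 0, by norm_num⟩
    · exact ⟨0, 0, 1, by norm_num⟩
    · exact ⟨2, 0, 0, by norm_num⟩
    · exact ⟨2, 0, 1, by norm_num⟩
    · exact ⟨2, 2, 0, by norm_num⟩
    · exact ⟨1, 3, 0, by norm_num⟩
    · exact ⟨1, 3, 1, by norm_num⟩
  · exact odd_rep m h0 h

lemma QFval_zero {k : ℕ} (M : Matrix (Fin k) (Fin k) ℤ) : QFval M 0 = 0 := by
  simp [QFval]

lemma main_rep (n : ℕ) (hn : 0 < n) (r : ℕ) (F : Matrix (Fin r) (Fin r) ℤ)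
    (hlow : ∀ y : Fin r → ℤ, y ≠ 0 → (n : ℤ) ≤ QFval F y)
    (hrep : ∀ m : ℤ, (n : ℤ) + 1 ≤ m → m ≤ 2 * (n : ℤ) - 1 → QFRep F m)
    (hs : ∃ s : ℤ, (n : ℤ) ≤ s ∧ s ≤ 14 * (n : ℤ) ∧
      ∀ m : ℤ, s ≤ m → m ≤ s + 2 * (n : ℤ) - 1 → QFRep F m) (m : ℤ) (hm : m ≠ 0) :
      ((∃ x₁ x₂ x₃ : ℤ, ∃ y : Fin r → ℤ,
          (n : ℤ) * x₁ ^ 2 + (n : ℤ) * x₂ ^ 2 + 2 * (n : ℤ) * x₃ ^ 2 + QFval F y = m) ↔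
        (n : ℤ) ≤ m) := by
  have hn' : (0 : ℤ) < n := by exact_mod_cast hn
  constructor
  · rintro ⟨a, b, c, y, h⟩
    by_cases hy : y = 0
    · subst hy
      rw [QFval_zero] at h
      have h' : (n : ℤ) * (a ^ 2 + b ^ 2 + 2 * c ^ 2) = m := by linarith
      have h1 : 0 ≤ a ^ 2 + b ^ 2 + 2 * c ^ 2 := by positivity
      have h2 : a ^ 2 + b ^ 2 + 2 * c ^ 2 ≠ 0 := by
        intro h0; rw [h0] at h'; simp at h'; exact hm h'.symm
      have h3 : 1 ≤ a ^ 2 + b ^ 2 + 2 * c ^ 2 := by omega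
      nlinarith
    · have := hlow y hy
      have h1 : 0 ≤ (n : ℤ) * a ^ 2 + (n : ℤ) * b ^ 2 + 2 * (n : ℤ) * c ^ 2 := by positivity
      linarith
  · intro hnm
    have comb : ∀ q v : ℤ, (∃ x y z : ℤ, x ^ 2 + y ^ 2 + 2 * z ^ 2 = q) → QFRep F v →
        m = n * q + v → (∃ x₁ x₂ x₃ : ℤ, ∃ y : Fin r → ℤ,
          (n : ℤ) * x₁ ^ 2 + (n : ℤ) * x₂ ^ 2 + 2 * (n : ℤ) * x₃ ^ 2 + QFval F y = m) := by
      rintro q v ⟨x, y, z, rfl⟩ ⟨w, rfl⟩ rfl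
      exact ⟨x, y, z, w, by ring⟩
    have rep0 : QFRep F 0 := ⟨0, QFval_zero F⟩
    obtain ⟨s, hs1, hs2, hs3⟩ := hs
    by_cases h1 : m < s
    · have e1 := Int.emod_add_mul_ediv m n
      have e2 := Int.emod_nonneg m hn'.ne'
      have e3 := Int.emod_lt_of_pos m hn'
      set q := m / n
      set t := m % n
      have q1 : 1 ≤ q := by
        by_contra hq
        have : q ≤ 0 := by omega
        nlinarith
      have q2 : q < 14 := by
        by_contra hq
        have : 14 ≤ q := by omega
        nlinarith
      by_cases ht : t = 0
      · exact comb q 0 (small_rep q (by omega) q2) rep0 (by linarith)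
      · exact comb (q - 1) (n + t) (small_rep _ (by omega) (by omega))
          (hrep _ (by omega) (by omega)) (by linarith)
    by_cases h2 : m ≤ s + 2 * (n : ℤ) - 1
    · exact comb 0 m ⟨0, 0, 0, by norm_num⟩ (hs3 m (by omega) h2) (by ring)
    · have hp : (0 : ℤ) < 2 * n := by omega
      have e1 := Int.emod_add_mul_ediv (m - n - s) (2 * n)
      have e2 := Int.emod_nonneg (m - n - s) hp.ne'
      have e3 := Int.emod_lt_of_pos (m - n - s) hp
      set q := (m - n - s) / (2 * n)
      set t := (m - n - s) % (2 * n)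
      have q1 : 0 ≤ q := Int.ediv_nonneg (by omega) hp.le
      exact comb (2 * q + 1) (s + t) (odd_rep _ (by omega) (by omega))
        (hs3 _ (by omega) (by omega)) (by linarith)

def bigD (n : ℕ) : Matrix (Fin 3) (Fin 3) ℤ := Matrix.diagonal ![(n : ℤ), n, 2 * n]

def bigM (n : ℕ) {r : ℕ} (F : Matrix (Fin r) (Fin r) ℤ) :
    Matrix (Fin (3 + r)) (Fin (3 + r)) ℤ :=
  Matrix.reindex finSumFinEquiv finSumFinEquiv (Matrix.fromBlocks (bigD n) 0 0 F)

lemma bigM_val (n : ℕ) {r : ℕ} (F : Matrix (Fin r) (Fin r) ℤ) (x : Fin (3 + r) → ℤ) :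
    QFval (bigM n F) x = (n : ℤ) * (x (Fin.castAdd r 0)) ^ 2 + (n : ℤ) * (x (Fin.castAdd r 1)) ^ 2
      + 2 * (n : ℤ) * (x (Fin.castAdd r 2)) ^ 2 + QFval F (fun i => x (Fin.natAdd 3 i)) := by
  unfold QFval bigM
  rw [← finSumFinEquiv.sum_comp]
  simp_rw [← finSumFinEquiv.sum_comp (M := ℤ)]
  simp [Fintype.sum_sum_type, Fin.sum_univ_three, bigD, Matrix.diagonal]
  ring

theorem stmt_13 (n : ℕ) (hn : 0 < n) (r : ℕ) (F : Matrix (Fin r) (Fin r) ℤ)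
    (hsym : F.IsSymm) (hpd : QFPosDef F)
    (hmin : IsLeast {m : ℤ | ∃ x : Fin r → ℤ, x ≠ 0 ∧ QFval F x = m} (n : ℤ) ∨
            IsLeast {m : ℤ | ∃ x : Fin r → ℤ, x ≠ 0 ∧ QFval F x = m} ((n : ℤ) + 1))
    (hrep : ∀ m : ℤ, (n : ℤ) + 1 ≤ m → m ≤ 2 * (n : ℤ) - 1 → QFRep F m)
    (hs : ∃ s : ℤ, (n : ℤ) ≤ s ∧ s ≤ 14 * (n : ℤ) ∧
      ∀ m : ℤ, s ≤ m → m ≤ s + 2 * (n : ℤ) - 1 → QFRep F m) :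
    (∀ m : ℤ, m ≠ 0 →
      ((∃ x₁ x₂ x₃ : ℤ, ∃ y : Fin r → ℤ,
          (n : ℤ) * x₁ ^ 2 + (n : ℤ) * x₂ ^ 2 + 2 * (n : ℤ) * x₃ ^ 2 + QFval F y = m) ↔
        (n : ℤ) ≤ m)) ∧
    ∃ k ≤ r + 3, ∃ M : Matrix (Fin k) (Fin k) ℤ,
      M.IsSymm ∧ QFPosDef M ∧ QFTight n M := by
  have hn' : (0 : ℤ) < n := by exact_mod_cast hn
  have hlow : ∀ y : Fin r → ℤ, y ≠ 0 → (n : ℤ) ≤ QFval F y := by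
    intro y hy
    rcases hmin with h | h
    · exact h.2 ⟨y, hy, rfl⟩
    · have : (n : ℤ) + 1 ≤ QFval F y := h.2 ⟨y, hy, rfl⟩
      linarith
  have main := main_rep n hn r F hlow hrep hs
  refine ⟨main, 3 + r, by omega, bigM n F, ?_, ?_, ?_⟩
  · unfold Matrix.IsSymm bigM
    rw [Matrix.transpose_reindex, Matrix.fromBlocks_transpose, hsym.eq]
    simp [bigD]
  · intro x hx
    rw [bigM_val]
    by_cases hy : (fun i => x (Fin.natAdd 3 i)) = 0
    · rw [hy, QFval_zero]
      by_contra hcon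
      push Not at hcon
      apply hx
      have hc : (n : ℤ) * ((x (Fin.castAdd r 0)) ^ 2 + (x (Fin.castAdd r 1)) ^ 2
        + 2 * (x (Fin.castAdd r 2)) ^ 2) ≤ n * 0 := by linarith
      have hc' := le_of_mul_le_mul_left hc hn'
      have h0 : x (Fin.castAdd r 0) = 0 := by nlinarith
      have h1 : x (Fin.castAdd r 1) = 0 := by nlinarith
      have h2 : x (Fin.castAdd r 2) = 0 := by nlinarith
      funext i
      refine Fin.addCases (fun j => ?_) (fun j => congrFun hy j) i
      fin_cases j
      · exact h0
      · exact h1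
      · exact h2
    · have := hpd _ hy
      positivity
  · intro m hm
    rw [← main m hm]
    constructor
    · rintro ⟨x, hx⟩
      exact ⟨_, _, _, _, by rw [← hx, bigM_val]⟩
    · rintro ⟨a, b, c, y, h⟩
      refine ⟨Fin.append ![a, b, c] y, ?_⟩
      rw [bigM_val, ← h]
      simp [Fin.append_left, Fin.append_right]
end
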